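/- (Dacorogna–Moser, divergence equation.) Let Ω ⊂ ℝⁿ be a smooth bounded domain, let k ∈ ℕ and α ∈ (0,1). Then there exists a constant C = C(k, α, Ω) > 0 such that: for every function g of class C^{k,α}(cl Ω) with ∫_Ω g(x) dx = 0, there exists a vector field v of class C^{k+1,α}(cl Ω) satisfying div v(x) = g(x) for all x ∈ Ω, v(x) = 0 for all x ∈ ∂Ω, and ‖v‖_{C^{k+1,α}(cl Ω)} ≤ C ‖g‖_{C^{k,α}(cl Ω)}. Moreover, if g is C^∞ on a neighborhood of cl Ω, then v can be chosen C^∞ on a neighborhood of cl Ω. -/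

import Mathlib

noncomputable section

/-- A smooth bounded domain: a bounded connected open set given as a regular sublevel
set of a smooth function. -/
def SmoothBoundedDomain {n : ℕ} (Ω : Set (EuclideanSpace ℝ (Fin n))) : Prop :=
  IsOpen Ω ∧ Bornology.IsBounded Ω ∧ IsConnected Ω ∧
  ∃ Φ : EuclideanSpace ℝ (Fin n) → ℝ, ContDiff ℝ (⊤ : ℕ∞) Φ ∧
    Ω = {x | Φ x < 0} ∧ frontier Ω = {x | Φ x = 0} ∧
    ∀ x ∈ frontier Ω, fderiv ℝ Φ x ≠ 0

/-- `u` is of class C^{k,α} on the compact set `A`: it is C^k on a neighborhood of `A`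
and its k-th derivative is α-Hölder on `A`. -/
def HolderClassOn {n : ℕ} {F : Type*} [NormedAddCommGroup F] [NormedSpace ℝ F]
    (k : ℕ) (α : ℝ) (u : EuclideanSpace ℝ (Fin n) → F)
    (A : Set (EuclideanSpace ℝ (Fin n))) : Prop :=
  (∃ O, IsOpen O ∧ A ⊆ O ∧ ContDiffOn ℝ k u O) ∧
  ∃ C : ℝ, 0 ≤ C ∧ ∀ x ∈ A, ∀ y ∈ A,
    ‖iteratedFDeriv ℝ k u x - iteratedFDeriv ℝ k u y‖ ≤ C * ‖x - y‖ ^ α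

/-- The C^{k,α} norm of `u` on a set `A`. -/
def holderNorm {n : ℕ} {F : Type*} [NormedAddCommGroup F] [NormedSpace ℝ F]
    (k : ℕ) (α : ℝ) (u : EuclideanSpace ℝ (Fin n) → F)
    (A : Set (EuclideanSpace ℝ (Fin n))) : ℝ :=
  (∑ j ∈ Finset.range (k + 1), sSup ((fun x => ‖iteratedFDeriv ℝ j u x‖) '' A)) +
  sSup ((fun p : EuclideanSpace ℝ (Fin n) × EuclideanSpace ℝ (Fin n) =>
      ‖iteratedFDeriv ℝ k u p.1 - iteratedFDeriv ℝ k u p.2‖ / ‖p.1 - p.2‖ ^ α) ''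
    {p | p.1 ∈ A ∧ p.2 ∈ A ∧ p.1 ≠ p.2})

/-- Divergence of a vector field at a point: trace of the total derivative. -/
def diver {n : ℕ} (v : EuclideanSpace ℝ (Fin n) → EuclideanSpace ℝ (Fin n))
    (x : EuclideanSpace ℝ (Fin n)) : ℝ :=
  LinearMap.trace ℝ (EuclideanSpace ℝ (Fin n)) (fderiv ℝ v x).toLinearMap

open Set Filter Topology MeasureTheory
open scoped ContDiff

/-- `u` and its derivatives up to order `k` are bounded by `M` on `A`, and `α`-Hölder on `A`
with constant `M`. -/
structure HolderBound {E F : Type} [NormedAddCommGroup E] [NormedSpace ℝ E]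
    [NormedAddCommGroup F] [NormedSpace ℝ F]
    (k : ℕ) (α M : ℝ) (A : Set E) (u : E → F) : Prop where
  bound : ∀ j ≤ k, ∀ x ∈ A, ‖iteratedFDeriv ℝ j u x‖ ≤ M
  holder : ∀ j ≤ k, ∀ x ∈ A, ∀ y ∈ A,
    ‖iteratedFDeriv ℝ j u x - iteratedFDeriv ℝ j u y‖ ≤ M * ‖x - y‖ ^ α

section HolderCalculus

variable {E F G H : Type} [NormedAddCommGroup E] [NormedSpace ℝ E]
  [NormedAddCommGroup F] [NormedSpace ℝ F] [NormedAddCommGroup G] [NormedSpace ℝ G]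
  [NormedAddCommGroup H] [NormedSpace ℝ H]
  {k : ℕ} {α M : ℝ} {A : Set E} {u : E → F}

theorem norm_iteratedFDeriv_zero_sub (u : E → F) (x y : E) :
    ‖iteratedFDeriv ℝ 0 u x - iteratedFDeriv ℝ 0 u y‖ = ‖u x - u y‖ := by
  simp only [iteratedFDeriv_zero_eq_comp, Function.comp_apply, ← map_sub,
    LinearIsometryEquiv.norm_map]

theorem norm_iteratedFDeriv_succ_sub (u : E → F) (j : ℕ) (x y : E) :
    ‖iteratedFDeriv ℝ (j + 1) u x - iteratedFDeriv ℝ (j + 1) u y‖ =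
      ‖iteratedFDeriv ℝ j (fderiv ℝ u) x - iteratedFDeriv ℝ j (fderiv ℝ u) y‖ := by
  simp only [iteratedFDeriv_succ_eq_comp_right, Function.comp_apply]
  rw [← dist_eq_norm, ← dist_eq_norm, LinearIsometryEquiv.dist_map]

theorem holderBound_zero_iff :
    HolderBound 0 α M A u ↔
      (∀ x ∈ A, ‖u x‖ ≤ M) ∧ ∀ x ∈ A, ∀ y ∈ A, ‖u x - u y‖ ≤ M * ‖x - y‖ ^ α := by
  constructor
  · intro h
    refine ⟨fun x hx => ?_, fun x hx y hy => ?_⟩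
    · simpa using h.bound 0 le_rfl x hx
    · simpa only [norm_iteratedFDeriv_zero_sub] using h.holder 0 le_rfl x hx y hy
  · rintro ⟨h1, h2⟩
    refine ⟨fun j hj x hx => ?_, fun j hj x hx y hy => ?_⟩
    · obtain rfl : j = 0 := by omega
      simpa using h1 x hx
    · obtain rfl : j = 0 := by omega
      simpa only [norm_iteratedFDeriv_zero_sub] using h2 x hx y hy

theorem holderBound_succ_iff :
    HolderBound (k + 1) α M A u ↔ HolderBound 0 α M A u ∧ HolderBound k α M A (fderiv ℝ u) := by
  constructor
  · intro h
    refine ⟨⟨fun j hj => h.bound j (by omega), fun j hj => h.holder j (by omega)⟩, ?_, ?_⟩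
    · intro j hj x hx
      rw [norm_iteratedFDeriv_fderiv]
      exact h.bound (j + 1) (by omega) x hx
    · intro j hj x hx y hy
      rw [← norm_iteratedFDeriv_succ_sub]
      exact h.holder (j + 1) (by omega) x hx y hy
  · rintro ⟨h0, h1⟩
    refine ⟨fun j hj x hx => ?_, fun j hj x hx y hy => ?_⟩
    · rcases j with _ | j
      · exact h0.bound 0 le_rfl x hx
      · rw [← norm_iteratedFDeriv_fderiv]
        exact h1.bound j (by omega) x hx
    · rcases j with _ | j
      · exact h0.holder 0 le_rfl x hx y hy
      · rw [norm_iteratedFDeriv_succ_sub]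
        exact h1.holder j (by omega) x hx y hy

namespace HolderBound

theorem of_le {l : ℕ} (h : HolderBound k α M A u) (hl : l ≤ k) : HolderBound l α M A u :=
  ⟨fun j hj => h.bound j (hj.trans hl), fun j hj => h.holder j (hj.trans hl)⟩

theorem mono_const {N : ℝ} (h : HolderBound k α M A u) (hN : M ≤ N) :
    HolderBound k α N A u :=
  ⟨fun j hj x hx => (h.bound j hj x hx).trans hN, fun j hj x hx y hy =>
    (h.holder j hj x hx y hy).trans (by gcongr)⟩

theorem mono_set {B : Set E} (h : HolderBound k α M A u) (hB : B ⊆ A) :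
    HolderBound k α M B u :=
  ⟨fun j hj x hx => h.bound j hj x (hB hx), fun j hj x hx y hy =>
    h.holder j hj x (hB hx) y (hB hy)⟩

theorem congr {v : E → F} (h : HolderBound k α M A u) (huv : ∀ x ∈ A, v =ᶠ[𝓝 x] u) :
    HolderBound k α M A v := by
  refine ⟨fun j hj x hx => ?_, fun j hj x hx y hy => ?_⟩
  · rw [((huv x hx).iteratedFDeriv ℝ j).eq_of_nhds]
    exact h.bound j hj x hx
  · rw [((huv x hx).iteratedFDeriv ℝ j).eq_of_nhds, ((huv y hy).iteratedFDeriv ℝ j).eq_of_nhds]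
    exact h.holder j hj x hx y hy

theorem zero (hM : 0 ≤ M) : HolderBound k α M A (fun _ : E => (0 : F)) := by
  have : ∀ j x, iteratedFDeriv ℝ j (fun _ : E => (0 : F)) x = 0 := fun j x => by
    simp
  refine ⟨fun j hj x hx => ?_, fun j hj x hx y hy => ?_⟩
  · simpa [this] using hM
  · simp only [this, sub_self, norm_zero]
    positivity

theorem add {v : E → F} {N : ℝ} (hu : ContDiff ℝ k u) (hv : ContDiff ℝ k v)
    (h : HolderBound k α M A u) (h' : HolderBound k α N A v) :
    HolderBound k α (M + N) A (fun x => u x + v x) := by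
  have key : ∀ j ≤ k, ∀ x, iteratedFDeriv ℝ j (fun x => u x + v x) x =
      iteratedFDeriv ℝ j u x + iteratedFDeriv ℝ j v x := fun j hj x =>
    iteratedFDeriv_add_apply (hu.of_le (by exact_mod_cast hj)).contDiffAt
      (hv.of_le (by exact_mod_cast hj)).contDiffAt
  refine ⟨fun j hj x hx => ?_, fun j hj x hx y hy => ?_⟩
  · rw [key j hj]
    exact (norm_add_le _ _).trans (add_le_add (h.bound j hj x hx) (h'.bound j hj x hx))
  · rw [key j hj, key j hj, add_sub_add_comm, add_mul]
    exact (norm_add_le _ _).trans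
      (add_le_add (h.holder j hj x hx y hy) (h'.holder j hj x hx y hy))

theorem sum {ι : Type*} (s : Finset ι) {v : ι → E → F} {N : ι → ℝ}
    (hv : ∀ i ∈ s, ContDiff ℝ k (v i)) (h : ∀ i ∈ s, HolderBound k α (N i) A (v i)) :
    HolderBound k α (∑ i ∈ s, N i) A (fun x => ∑ i ∈ s, v i x) := by
  classical
  induction s using Finset.induction_on with
  | empty => simpa using HolderBound.zero (k := k) (A := A) (F := F) le_rfl
  | insert i s hi ih =>
    simp only [Finset.sum_insert hi]
    have h1 : ∀ j ∈ s, ContDiff ℝ k (v j) := fun j hj => hv j (Finset.mem_insert_of_mem hj)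
    exact add (hv i (Finset.mem_insert_self _ _)) (ContDiff.sum h1)
      (h i (Finset.mem_insert_self _ _))
      (ih h1 fun j hj => h j (Finset.mem_insert_of_mem hj))

theorem clm_comp (L : F →L[ℝ] G) (hu : ContDiff ℝ k u) (h : HolderBound k α M A u) :
    HolderBound k α (‖L‖ * M) A (fun x => L (u x)) := by
  have key : ∀ j ≤ k, ∀ x, iteratedFDeriv ℝ j (fun x => L (u x)) x =
      L.compContinuousMultilinearMap (iteratedFDeriv ℝ j u x) := fun j hj x =>
    L.iteratedFDeriv_comp_left hu.contDiffAt (by exact_mod_cast hj)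
  refine ⟨fun j hj x hx => ?_, fun j hj x hx y hy => ?_⟩
  · rw [key j hj]
    exact (L.norm_compContinuousMultilinearMap_le _).trans (by gcongr; exact h.bound j hj x hx)
  · rw [key j hj, key j hj]
    have : L.compContinuousMultilinearMap (iteratedFDeriv ℝ j u x) -
        L.compContinuousMultilinearMap (iteratedFDeriv ℝ j u y) =
        L.compContinuousMultilinearMap (iteratedFDeriv ℝ j u x - iteratedFDeriv ℝ j u y) := by
      ext m
      simp
    rw [this, mul_assoc]
    exact (L.norm_compContinuousMultilinearMap_le _).trans
      (by gcongr; exact h.holder j hj x hx y hy)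

theorem bilinear (B : F →L[ℝ] G →L[ℝ] H) {v : E → G} {N : ℝ} (hM : 0 ≤ M) (hN : 0 ≤ N)
    (hu : ContDiff ℝ k u) (hv : ContDiff ℝ k v)
    (h : HolderBound k α M A u) (h' : HolderBound k α N A v) :
    HolderBound k α (2 ^ (k + 1) * ‖B‖ * M * N) A (fun x => B (u x) (v x)) := by
  have base : ∀ {F G H : Type} [NormedAddCommGroup F] [NormedSpace ℝ F] [NormedAddCommGroup G]
      [NormedSpace ℝ G] [NormedAddCommGroup H] [NormedSpace ℝ H] (B : F →L[ℝ] G →L[ℝ] H)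
      {u : E → F} {v : E → G}, HolderBound 0 α M A u → HolderBound 0 α N A v →
      HolderBound 0 α (2 * ‖B‖ * M * N) A (fun x => B (u x) (v x)) := by
    intro F G H _ _ _ _ _ _ B u v h h'
    rw [holderBound_zero_iff] at *
    have hb : ∀ a b, ‖a‖ ≤ M → ‖b‖ ≤ N → ‖B a b‖ ≤ ‖B‖ * M * N := fun a b ha hb =>
      (B.le_opNorm₂ a b).trans (by gcongr)
    refine ⟨fun x hx => (hb _ _ (h.1 x hx) (h'.1 x hx)).trans ?_, fun x hx y hy => ?_⟩
    · nlinarith [show 0 ≤ ‖B‖ * M * N by positivity]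
    · have e : B (u x) (v x) - B (u y) (v y) = B (u x - u y) (v x) + B (u y) (v x - v y) := by
        simp
      rw [e]
      have e1 : ‖B (u x - u y) (v x)‖ ≤ ‖B‖ * (M * ‖x - y‖ ^ α) * N :=
        (B.le_opNorm₂ _ _).trans (by gcongr; exacts [h.2 x hx y hy, h'.1 x hx])
      have e2 : ‖B (u y) (v x - v y)‖ ≤ ‖B‖ * M * (N * ‖x - y‖ ^ α) :=
        (B.le_opNorm₂ _ _).trans (by gcongr; exacts [h.1 y hy, h'.2 x hx y hy])
      calc _ ≤ _ := norm_add_le _ _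
        _ ≤ _ := add_le_add e1 e2
        _ = _ := by ring
  induction k generalizing F G H with
  | zero => simpa using base B h h'
  | succ k ih =>
    rw [holderBound_succ_iff]
    have hpow : (1 : ℝ) ≤ 2 ^ (k + 1) := one_le_pow₀ (by norm_num)
    constructor
    · refine (base B (h.of_le (by omega)) (h'.of_le (by omega))).mono_const ?_
      have : 0 ≤ ‖B‖ * M * N := by positivity
      rw [pow_succ]
      nlinarith
    · have hu' := hu.differentiable (by simp)
      have hv' := hv.differentiable (by simp)
      have e : fderiv ℝ (fun x => B (u x) (v x)) = fun x =>
          B.precompR E (u x) (fderiv ℝ v x) + B.precompL E (fderiv ℝ u x) (v x) := by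
        funext x
        exact B.fderiv_of_bilinear (hu' x) (hv' x)
      have hu1 : ContDiff ℝ k (fderiv ℝ u) := hu.fderiv_right (by simp)
      have hv1 : ContDiff ℝ k (fderiv ℝ v) := hv.fderiv_right (by simp)
      have hu0 : ContDiff ℝ k u := hu.of_le (by simp)
      have hv0 : ContDiff ℝ k v := hv.of_le (by simp)
      rw [e]
      have t1 := ih (B.precompR E) hu0 hv1 (h.of_le (by omega)) (holderBound_succ_iff.1 h').2
      have t2 := ih (B.precompL E) hu1 hv0 (holderBound_succ_iff.1 h).2 (h'.of_le (by omega))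
      refine (HolderBound.add ?_ ?_ t1 t2).mono_const ?_
      · exact (B.precompR E).isBoundedBilinearMap.contDiff.comp (hu0.prodMk hv1)
      · exact (B.precompL E).isBoundedBilinearMap.contDiff.comp (hu1.prodMk hv0)
      · have n1 := B.norm_precompR_le E
        have n2 := B.norm_precompL_le E
        calc _ ≤ 2 ^ (k + 1) * ‖B‖ * M * N + 2 ^ (k + 1) * ‖B‖ * M * N := by gcongr
          _ = _ := by ring

theorem comp {E' : Type} [NormedAddCommGroup E'] [NormedSpace ℝ E'] (k : ℕ) {φ : E → E'} {B : Set E'}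
    {L K : ℝ} (hα : 0 ≤ α) (hL : 0 ≤ L) (hK : 0 ≤ K) (hφ : ContDiff ℝ (k + 1) φ)
    (hAB : MapsTo φ A B) (hlip : ∀ x ∈ A, ∀ y ∈ A, ‖φ x - φ y‖ ≤ L * ‖x - y‖)
    (hφK : HolderBound k α K A (fderiv ℝ φ)) :
    ∃ C, 0 ≤ C ∧ ∀ (F : Type) [NormedAddCommGroup F] [NormedSpace ℝ F] (u : E' → F) (M : ℝ),
      0 ≤ M → ContDiff ℝ k u → HolderBound k α M B u →
        HolderBound k α (C * M) A (fun x => u (φ x)) := by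
  have base : ∀ (F : Type) [NormedAddCommGroup F] [NormedSpace ℝ F] (u : E' → F) (M : ℝ),
      0 ≤ M → HolderBound 0 α M B u → HolderBound 0 α ((1 + L ^ α) * M) A (fun x => u (φ x)) := by
    intro F _ _ u M hM h
    rw [holderBound_zero_iff] at *
    have hLα : 0 ≤ L ^ α := by positivity
    refine ⟨fun x hx => (h.1 _ (hAB hx)).trans (by nlinarith), fun x hx y hy => ?_⟩
    calc _ ≤ M * ‖φ x - φ y‖ ^ α := h.2 _ (hAB hx) _ (hAB hy)
      _ ≤ M * (L * ‖x - y‖) ^ α := by gcongr; exact hlip x hx y hy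
      _ = L ^ α * M * ‖x - y‖ ^ α := by
        rw [Real.mul_rpow hL (norm_nonneg _)]
        ring
      _ ≤ _ := by gcongr; linarith
  induction k with
  | zero => exact ⟨1 + L ^ α, by positivity, fun F _ _ u M hM _ h => base F u M hM h⟩
  | succ k ih =>
    obtain ⟨C, hC, ih⟩ := ih (hφ.of_le (by simp)) (hφK.of_le (by omega))
    set D := 2 ^ (k + 1) * C * K
    have hD : 0 ≤ D := by positivity
    refine ⟨(1 + L ^ α) + D, by positivity, fun F _ _ u M hM hu h => ?_⟩
    rw [holderBound_succ_iff]
    constructor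
    · refine (base F u M hM (h.of_le (by omega))).mono_const ?_
      nlinarith
    · have e : fderiv ℝ (fun x => u (φ x)) = fun x =>
          ContinuousLinearMap.compL ℝ E E' F (fderiv ℝ u (φ x)) (fderiv ℝ φ x) := by
        funext x
        exact fderiv_comp x (hu.differentiable (by simp) _) (hφ.differentiable (by simp) _)
      rw [e]
      have hu1 : ContDiff ℝ k (fderiv ℝ u) := hu.fderiv_right (by simp)
      have t := ih _ (fderiv ℝ u) M hM hu1 (holderBound_succ_iff.1 h).2
      have hφ0 : ContDiff ℝ k φ := hφ.of_le (by
        exact_mod_cast (by omega : k ≤ k + 1 + 1))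
      have hφ1 : ContDiff ℝ k (fderiv ℝ φ) := hφ.fderiv_right (by
        exact_mod_cast (by omega : k + 1 ≤ k + 1 + 1))
      refine (bilinear (ContinuousLinearMap.compL ℝ E E' F) (by positivity) hK
        (hu1.comp hφ0) hφ1 t (hφK.of_le (by omega))).mono_const ?_
      calc _ ≤ 2 ^ (k + 1) * 1 * (C * M) * K := by
            gcongr
            exact ContinuousLinearMap.norm_compL_le ℝ E E' F
        _ = D * M := by ring
        _ ≤ _ := by
          have : 0 ≤ L ^ α := by positivity
          nlinarith

/-- Localisation of Hölder bounds: for functions supported in a ball it suffices to have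
them on the concentric ball of twice the radius. -/
theorem of_tsupport_subset {q : E} {r : ℝ} (hr : 0 < r) (hα : 0 ≤ α) (hM : 0 ≤ M)
    (hsupp : tsupport u ⊆ Metric.closedBall q r)
    (h : HolderBound k α M (A ∩ Metric.ball q (2 * r)) u) :
    HolderBound k α ((1 + (r ^ α)⁻¹) * M) A u := by
  have hz : ∀ j, ∀ x, x ∉ Metric.closedBall q r → iteratedFDeriv ℝ j u x = 0 := by
    intro j x hx
    exact image_eq_zero_of_notMem_tsupport fun h => hx (hsupp (tsupport_iteratedFDeriv_subset j h))
  have hrα : 0 ≤ (r ^ α)⁻¹ := by positivity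
  have hsub : Metric.closedBall q r ⊆ Metric.ball q (2 * r) :=
    Metric.closedBall_subset_ball (by linarith)
  have hb : ∀ j ≤ k, ∀ x ∈ A, ‖iteratedFDeriv ℝ j u x‖ ≤ M := by
    intro j hj x hx
    by_cases hxb : x ∈ Metric.closedBall q r
    · exact h.bound j hj x ⟨hx, hsub hxb⟩
    · rw [hz j x hxb]
      simpa using hM
  have far : ∀ j ≤ k, ∀ x ∈ A, ∀ y ∈ A, x ∈ Metric.closedBall q r → y ∉ Metric.ball q (2 * r) →
      ‖iteratedFDeriv ℝ j u x - iteratedFDeriv ℝ j u y‖ ≤ (r ^ α)⁻¹ * M * ‖x - y‖ ^ α := by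
    intro j hj x hx y hy hxb hyb
    rw [hz j y fun h => hyb (hsub h), sub_zero]
    have hd : r ≤ ‖x - y‖ := by
      rw [Metric.mem_closedBall] at hxb
      rw [Metric.mem_ball] at hyb
      rw [← dist_eq_norm]
      linarith [dist_triangle y x q, dist_comm y x]
    have : 1 ≤ (r ^ α)⁻¹ * ‖x - y‖ ^ α := by
      rw [inv_mul_eq_div, one_le_div (by positivity)]
      gcongr
    nlinarith [hb j hj x hx]
  refine ⟨fun j hj x hx => (hb j hj x hx).trans (by nlinarith), fun j hj x hx y hy => ?_⟩
  have hpos : 0 ≤ ‖x - y‖ ^ α := by positivity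
  have hle1 : M * ‖x - y‖ ^ α ≤ (1 + (r ^ α)⁻¹) * M * ‖x - y‖ ^ α := by
    gcongr
    nlinarith
  have hle2 : (r ^ α)⁻¹ * M * ‖x - y‖ ^ α ≤ (1 + (r ^ α)⁻¹) * M * ‖x - y‖ ^ α := by
    gcongr
    linarith
  by_cases hxb : x ∈ Metric.ball q (2 * r) <;> by_cases hyb : y ∈ Metric.ball q (2 * r)
  · exact (h.holder j hj x ⟨hx, hxb⟩ y ⟨hy, hyb⟩).trans hle1
  · by_cases hxc : x ∈ Metric.closedBall q r
    · exact (far j hj x hx y hy hxc hyb).trans hle2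
    · rw [hz j x hxc, hz j y fun h => hyb (hsub h)]
      simp only [sub_self, norm_zero]
      positivity
  · by_cases hyc : y ∈ Metric.closedBall q r
    · rw [norm_sub_rev, norm_sub_rev x y]
      rw [norm_sub_rev x y] at hle2
      exact (far j hj y hy x hx hyc hxb).trans hle2
    · rw [hz j y hyc, hz j x fun h => hxb (hsub h)]
      simp only [sub_self, norm_zero]
      positivity
  · rw [hz j x fun h => hxb (hsub h), hz j y fun h => hyb (hsub h)]
    simp only [sub_self, norm_zero]
    positivity

/-- Lipschitz functions on bounded sets are Hölder. -/
theorem lipschitz_le_rpow {a b D K : ℝ} (hα : α ∈ Ioo (0 : ℝ) 1) (hK : 0 ≤ K) (hb : 0 ≤ b)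
    (hbD : b ≤ D) (h : a ≤ K * b) : a ≤ K * D ^ (1 - α) * b ^ α := by
  refine h.trans ?_
  rw [mul_assoc]
  gcongr
  rcases hb.eq_or_lt with rfl | hb'
  · exact mul_nonneg (by positivity) (by positivity)
  · calc b = b ^ (1 - α) * b ^ α := by
          rw [← Real.rpow_add hb']
          simp
      _ ≤ _ := by
        gcongr
        linarith [hα.2]

theorem of_contDiff [FiniteDimensional ℝ E] (k : ℕ) (hα : α ∈ Ioo (0 : ℝ) 1)
    (hu : ContDiff ℝ ∞ u) (hA : Bornology.IsBounded A) :
    ∃ M, 0 ≤ M ∧ HolderBound k α M A u := by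
  have := FiniteDimensional.proper_real E
  obtain ⟨R, hR⟩ := hA.subset_closedBall 0
  have hRpos : A ⊆ Metric.closedBall 0 (max R 0) :=
    hR.trans (Metric.closedBall_subset_closedBall (le_max_left _ _))
  set R' := max R 0
  have hR' : 0 ≤ R' := le_max_right _ _
  have hcont : ∀ j, Continuous (iteratedFDeriv ℝ j u) := fun j =>
    hu.continuous_iteratedFDeriv (by exact_mod_cast le_top)
  have hbd : ∀ j, ∃ M, 0 ≤ M ∧ ∀ x ∈ Metric.closedBall (0 : E) R', ‖iteratedFDeriv ℝ j u x‖ ≤ M := by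
    intro j
    obtain ⟨M, hM⟩ := (isCompact_closedBall (0 : E) R').exists_bound_of_continuousOn
      (hcont j).continuousOn
    exact ⟨M, (norm_nonneg _).trans (hM 0 (Metric.mem_closedBall_self hR')), hM⟩
  choose N hN0 hN using hbd
  refine ⟨∑ j ∈ Finset.range (k + 1), (N j + N (j + 1) * (2 * R') ^ (1 - α)),
    Finset.sum_nonneg fun j _ => add_nonneg (hN0 j) (mul_nonneg (hN0 _) (by positivity)), ?_⟩
  have hle : ∀ j ≤ k, N j + N (j + 1) * (2 * R') ^ (1 - α) ≤
      ∑ j ∈ Finset.range (k + 1), (N j + N (j + 1) * (2 * R') ^ (1 - α)) := fun j hj =>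
    Finset.single_le_sum
      (f := fun j => N j + N (j + 1) * (2 * R') ^ (1 - α))
      (fun j _ => add_nonneg (hN0 j) (mul_nonneg (hN0 _) (by positivity)))
      (Finset.mem_range.2 (by omega))
  have hp : ∀ j, 0 ≤ N (j + 1) * (2 * R') ^ (1 - α) := fun j =>
    mul_nonneg (hN0 _) (by positivity)
  refine ⟨fun j hj x hx => ?_, fun j hj x hx y hy => ?_⟩
  · have := hle j hj
    have := hN j x (hRpos hx)
    linarith [hp j]
  · have hlip : ‖iteratedFDeriv ℝ j u x - iteratedFDeriv ℝ j u y‖ ≤ N (j + 1) * ‖x - y‖ := by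
      refine Convex.norm_image_sub_le_of_norm_fderiv_le (𝕜 := ℝ)
        (fun z _ => hu.differentiable_iteratedFDeriv (by exact_mod_cast WithTop.coe_lt_top _) z)
        (fun z hz => ?_) (convex_closedBall (0 : E) R') (hRpos hy) (hRpos hx)
      rw [norm_fderiv_iteratedFDeriv]
      exact hN (j + 1) z hz
    have hd : ‖x - y‖ ≤ 2 * R' := by
      have h1 := mem_closedBall_zero_iff.1 (hRpos hx)
      have h2 := mem_closedBall_zero_iff.1 (hRpos hy)
      linarith [norm_sub_le x y]
    refine (lipschitz_le_rpow hα (hN0 _) (norm_nonneg _) hd hlip).trans ?_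
    gcongr
    linarith [hle j hj, hN0 j]

end HolderBound

end HolderCalculus

section Averages

set_option linter.unusedSectionVars false

variable {E F G H : Type} [NormedAddCommGroup E] [NormedSpace ℝ E]
  [NormedAddCommGroup F] [NormedSpace ℝ F] [NormedAddCommGroup G] [NormedSpace ℝ G]
  [NormedAddCommGroup H] [NormedSpace ℝ H]
  {P : Type} [MeasurableSpace P] {μ : Measure P} {b : P → G} {c : P → E}

/-- Weighted average of translates of `u`. -/
def translateAverage (μ : Measure P) (b : P → G) (c : P → E) (B : F →L[ℝ] G →L[ℝ] H)
    (u : E → F) (x : E) : H :=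
  ∫ p, B (u (x - c p)) (b p) ∂μ

theorem translateAverage_aestronglyMeasurable (hb : Integrable b μ)
    (hc : AEStronglyMeasurable c μ) (B : F →L[ℝ] G →L[ℝ] H) {u : E → F} (hu : Continuous u)
    (x : E) : AEStronglyMeasurable (fun p => B (u (x - c p)) (b p)) μ := by
  have h1 : AEStronglyMeasurable (fun p => u (x - c p)) μ :=
    hu.comp_aestronglyMeasurable (aestronglyMeasurable_const.sub hc)
  exact B.aestronglyMeasurable_comp₂ h1 hb.aestronglyMeasurable

theorem norm_translateAverage_integrand_le (B : F →L[ℝ] G →L[ℝ] H) {a : F} {b : G} {M : ℝ}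
    (h : ‖a‖ ≤ M) : ‖B a b‖ ≤ ‖B‖ * M * ‖b‖ :=
  (B.le_opNorm₂ a b).trans (by gcongr)

theorem translateAverage_integrable (hb : Integrable b μ)
    (hc : AEStronglyMeasurable c μ) (B : F →L[ℝ] G →L[ℝ] H) {u : E → F} (hu : Continuous u)
    {M : ℝ} (hM : ∀ x, ‖u x‖ ≤ M) (x : E) : Integrable (fun p => B (u (x - c p)) (b p)) μ :=
  (hb.norm.const_mul (‖B‖ * M)).mono' (translateAverage_aestronglyMeasurable hb hc B hu x)
    (Eventually.of_forall fun _ => norm_translateAverage_integrand_le B (hM _))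

theorem translateAverage_continuous (hb : Integrable b μ)
    (hc : AEStronglyMeasurable c μ) (B : F →L[ℝ] G →L[ℝ] H) {u : E → F} (hu : Continuous u)
    {M : ℝ} (hM : ∀ x, ‖u x‖ ≤ M) : Continuous (translateAverage μ b c B u) := by
  refine continuous_of_dominated (bound := fun p => ‖B‖ * M * ‖b p‖)
    (fun x => translateAverage_aestronglyMeasurable hb hc B hu x)
    (fun x => Eventually.of_forall fun p => norm_translateAverage_integrand_le B (hM _))
    (hb.norm.const_mul _) (Eventually.of_forall fun p => ?_)
  fun_prop

theorem hasFDerivAt_translateAverage (hb : Integrable b μ)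
    (hc : AEStronglyMeasurable c μ) (B : F →L[ℝ] G →L[ℝ] H) {u : E → F} (hu : ContDiff ℝ 1 u)
    {M : ℝ} (hM : ∀ x, ‖u x‖ ≤ M) {M' : ℝ} (hM' : ∀ x, ‖fderiv ℝ u x‖ ≤ M') (x : E) :
    HasFDerivAt (translateAverage μ b c B u)
      (translateAverage μ b c (B.precompL E) (fderiv ℝ u) x) x := by
  refine hasFDerivAt_integral_of_dominated_of_fderiv_le (s := univ)
    (F' := fun y p => B.precompL E (fderiv ℝ u (y - c p)) (b p))
    (bound := fun p => ‖B‖ * M' * ‖b p‖) univ_mem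
    (Eventually.of_forall fun y => translateAverage_aestronglyMeasurable hb hc B hu.continuous y)
    (translateAverage_integrable hb hc B hu.continuous hM x)
    (translateAverage_aestronglyMeasurable hb hc _ (hu.continuous_fderiv (by simp)) x)
    (Eventually.of_forall fun p y _ => (norm_translateAverage_integrand_le _ (hM' _)).trans
      (mul_le_mul_of_nonneg_right (mul_le_mul_of_nonneg_right (B.norm_precompL_le E)
        ((norm_nonneg _).trans (hM' 0))) (norm_nonneg _)))
    (hb.norm.const_mul _) (Eventually.of_forall fun p y _ => ?_)
  have h1 : HasFDerivAt (fun y => u (y - c p)) (fderiv ℝ u (y - c p)) y := by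
    have := (hu.differentiable (by simp) (y - c p)).hasFDerivAt
    simpa [Function.comp_def] using this.comp y ((hasFDerivAt_id y).sub_const (c p))
  have h2 := B.hasFDerivAt_of_bilinear h1 (hasFDerivAt_const (b p) y)
  convert h2 using 1
  simp

theorem translateAverage_holderBound (hb : Integrable b μ) (hc : AEStronglyMeasurable c μ)
    {A A' : Set E} {α : ℝ} (hA : ∀ p, b p ≠ 0 → ∀ x ∈ A', x - c p ∈ A)
    (k : ℕ) (B : F →L[ℝ] G →L[ℝ] H) (u : E → F)
    (hu : ContDiff ℝ k u) {M' : ℝ} (hM' : ∀ j ≤ k, ∀ x, ‖iteratedFDeriv ℝ j u x‖ ≤ M') :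
    ContDiff ℝ k (translateAverage μ b c B u) ∧ ∀ M, 0 ≤ M → HolderBound k α M A u →
      HolderBound k α (‖B‖ * (∫ p, ‖b p‖ ∂μ) * M) A' (translateAverage μ b c B u) := by
  have base : ∀ {F H : Type} [NormedAddCommGroup F] [NormedSpace ℝ F]
      [NormedAddCommGroup H] [NormedSpace ℝ H] (B : F →L[ℝ] G →L[ℝ] H) (u : E → F)
      (hu : Continuous u) (hM' : ∀ x, ‖u x‖ ≤ M'),
      Continuous (translateAverage μ b c B u) ∧ ∀ M, 0 ≤ M → HolderBound 0 α M A u →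
      HolderBound 0 α (‖B‖ * (∫ p, ‖b p‖ ∂μ) * M) A' (translateAverage μ b c B u) := by
    intro F H _ _ _ _ B u hu hM'
    refine ⟨translateAverage_continuous hb hc B hu hM', fun M hM h => ?_⟩
    rw [holderBound_zero_iff] at *
    constructor
    · intro x hx
      calc _ ≤ ∫ p, ‖B‖ * M * ‖b p‖ ∂μ := by
            refine norm_integral_le_of_norm_le (hb.norm.const_mul _)
              (Eventually.of_forall fun p => ?_)
            by_cases hp : b p = 0
            · simp [hp]
            · exact norm_translateAverage_integrand_le B (h.1 _ (hA p hp x hx))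
        _ = _ := by rw [integral_const_mul]; ring
    · intro x hx y hy
      rw [translateAverage, translateAverage,
        ← integral_sub (translateAverage_integrable hb hc B hu hM' x)
          (translateAverage_integrable hb hc B hu hM' y)]
      calc _ ≤ ∫ p, ‖B‖ * (M * ‖x - y‖ ^ α) * ‖b p‖ ∂μ := by
            refine norm_integral_le_of_norm_le (hb.norm.const_mul _)
              (Eventually.of_forall fun p => ?_)
            by_cases hp : b p = 0
            · simp [hp]
            · have e := h.2 _ (hA p hp x hx) _ (hA p hp y hy)
              rw [sub_sub_sub_cancel_right] at e
              have := norm_translateAverage_integrand_le B (b := b p) e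
              simpa using this
        _ = _ := by rw [integral_const_mul]; ring
  induction k generalizing F H with
  | zero =>
    have := base B u hu.continuous (fun x => by simpa using hM' 0 le_rfl x)
    exact ⟨contDiff_zero.2 this.1, this.2⟩
  | succ k ih =>
    have b0 := base B u hu.continuous (fun x => by simpa using hM' 0 (by omega) x)
    have hu1 : ContDiff ℝ k (fderiv ℝ u) := hu.fderiv_right (by simp)
    have hd : ∀ x, HasFDerivAt (translateAverage μ b c B u)
        (translateAverage μ b c (B.precompL E) (fderiv ℝ u) x) x :=
      hasFDerivAt_translateAverage hb hc B (hu.of_le (by exact_mod_cast (by omega : 1 ≤ k + 1)))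
        (M := M') (fun x => by simpa using hM' 0 (by omega) x)
        (M' := M') (fun x => by
          have := hM' 1 (by omega) x
          rwa [← norm_iteratedFDeriv_fderiv, norm_iteratedFDeriv_zero] at this)
    have hf : fderiv ℝ (translateAverage μ b c B u) =
        translateAverage μ b c (B.precompL E) (fderiv ℝ u) := funext fun x => (hd x).fderiv
    have i1 := ih (B.precompL E) (fderiv ℝ u) hu1 (fun j hj x => by
      rw [norm_iteratedFDeriv_fderiv]
      exact hM' (j + 1) (by omega) x)
    refine ⟨?_, fun M hM h => ?_⟩
    · rw [Nat.cast_succ, contDiff_succ_iff_fderiv]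
      refine ⟨fun x => (hd x).differentiableAt, by simp, ?_⟩
      rw [hf]
      exact i1.1
    · rw [holderBound_succ_iff] at h ⊢
      refine ⟨b0.2 M hM h.1, ?_⟩
      rw [hf]
      refine (i1.2 M hM h.2).mono_const ?_
      have n2 := B.norm_precompL_le E
      gcongr

end Averages

/-- Euclidean space of dimension `n`. -/
abbrev Euc (n : ℕ) : Type := EuclideanSpace ℝ (Fin n)

section CompactSupport

variable {E F : Type} [NormedAddCommGroup E] [NormedSpace ℝ E]
  [NormedAddCommGroup F] [NormedSpace ℝ F] {u : E → F}

theorem HolderBound.of_hasCompactSupport [FiniteDimensional ℝ E] {α : ℝ} (k : ℕ) (hα : α ∈ Ioo (0 : ℝ) 1)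
    (hu : ContDiff ℝ ∞ u) (hc : HasCompactSupport u) :
    ∃ M, 0 ≤ M ∧ HolderBound k α M univ u := by
  obtain ⟨r, hr, hsub⟩ := hc.isCompact.isBounded.subset_closedBall_lt 0 0
  obtain ⟨M, hM, h⟩ := HolderBound.of_contDiff k hα hu
    (A := univ ∩ Metric.ball (0 : E) (2 * r)) (Metric.isBounded_ball.subset inter_subset_right)
  exact ⟨_, by positivity, HolderBound.of_tsupport_subset hr hα.1.le hM hsub h⟩

theorem exists_bound_iteratedFDeriv_of_hasCompactSupport {k : ℕ} (hu : ContDiff ℝ k u)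
    (hc : HasCompactSupport u) : ∃ M, 0 ≤ M ∧ ∀ j ≤ k, ∀ x, ‖iteratedFDeriv ℝ j u x‖ ≤ M := by
  have : ∀ j, ∃ M, 0 ≤ M ∧ (j ≤ k → ∀ x, ‖iteratedFDeriv ℝ j u x‖ ≤ M) := by
    intro j
    by_cases hj : j ≤ k
    · obtain ⟨M, hM⟩ := (hc.iteratedFDeriv j).exists_bound_of_continuous
        (hu.continuous_iteratedFDeriv (𝕜 := ℝ) (by exact_mod_cast hj))
      exact ⟨M, (norm_nonneg _).trans (hM 0), fun _ => hM⟩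
    · exact ⟨0, le_rfl, fun h => absurd h hj⟩
  choose N hN0 hN using this
  refine ⟨∑ j ∈ Finset.range (k + 1), N j, Finset.sum_nonneg fun j _ => hN0 j, fun j hj x => ?_⟩
  exact (hN j hj x).trans (Finset.single_le_sum (f := N) (fun j _ => hN0 j)
    (Finset.mem_range.2 (by omega)))

end CompactSupport

section Divergence

variable {n : ℕ}

/-- The trace as a continuous linear functional. -/
def traceCLM (n : ℕ) : (Euc n →L[ℝ] Euc n) →L[ℝ] ℝ :=
  LinearMap.toContinuousLinearMap
    ((LinearMap.trace ℝ (Euc n)).comp (ContinuousLinearMap.coeLM ℝ))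

theorem diver_eq_traceCLM (v : Euc n → Euc n) (x : Euc n) :
    diver v x = traceCLM n (fderiv ℝ v x) := rfl

theorem traceCLM_smulRight (f : Euc n →L[ℝ] ℝ) (a : Euc n) :
    traceCLM n (f.smulRight a) = f a :=
  LinearMap.trace_smulRight f.toLinearMap a

theorem diver_translateAverage {P : Type} [MeasurableSpace P] {μ : Measure P} {b c : P → Euc n}
    (hb : Integrable b μ) (hc : AEStronglyMeasurable c μ) {u : Euc n → ℝ} (hu : ContDiff ℝ 1 u)
    (hs : HasCompactSupport u) (x : Euc n) :
    Integrable (fun p => fderiv ℝ u (x - c p) (b p)) μ ∧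
    diver (translateAverage μ b c (ContinuousLinearMap.lsmul ℝ ℝ) u) x =
      ∫ p, fderiv ℝ u (x - c p) (b p) ∂μ := by
  obtain ⟨M, hM⟩ := hs.exists_bound_of_continuous hu.continuous
  obtain ⟨M', hM'⟩ := (hs.fderiv ℝ).exists_bound_of_continuous (hu.continuous_fderiv (by simp))
  have hi := translateAverage_integrable hb hc
    ((ContinuousLinearMap.lsmul ℝ ℝ : ℝ →L[ℝ] Euc n →L[ℝ] Euc n).precompL (Euc n))
    (hu.continuous_fderiv (by simp)) hM' x
  have key : ∀ p, traceCLM n ((ContinuousLinearMap.lsmul ℝ ℝ : ℝ →L[ℝ] Euc n →L[ℝ] Euc n).precompL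
      (Euc n) (fderiv ℝ u (x - c p)) (b p)) = fderiv ℝ u (x - c p) (b p) := by
    intro p
    rw [← traceCLM_smulRight]
    congr 1
  constructor
  · simpa only [key] using (traceCLM n).integrable_comp hi
  · rw [diver_eq_traceCLM, (hasFDerivAt_translateAverage hb hc _ hu hM hM' x).fderiv,
      translateAverage, ← (traceCLM n).integral_comp_comm hi]
    simp only [key]

theorem setIntegral_fderiv_segment {u : Euc n → ℝ} (hu : ContDiff ℝ 1 u) (x ζ : Euc n) :
    ∫ s in Icc (0 : ℝ) 1, fderiv ℝ u (x - s • ζ) ζ = u x - u (x - ζ) := by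
  rw [integral_Icc_eq_integral_Ioc, ← intervalIntegral.integral_of_le zero_le_one]
  have hd : ∀ s : ℝ, HasDerivAt (fun s : ℝ => -u (x - s • ζ)) (fderiv ℝ u (x - s • ζ) ζ) s := by
    intro s
    have h1 : HasDerivAt (fun s : ℝ => x - s • ζ) (-ζ) s := by
      simpa using ((hasDerivAt_id s).smul_const ζ).const_sub x
    have h2 := ((hu.differentiable (by simp) (x - s • ζ)).hasFDerivAt.comp_hasDerivAt s h1).fun_neg
    simpa [Function.comp_def] using h2
  rw [intervalIntegral.integral_eq_sub_of_hasDerivAt (fun s _ => hd s)]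
  · simp
    ring
  · apply Continuous.intervalIntegrable
    have := hu.continuous_fderiv (by simp)
    fun_prop

/-- Solution of the divergence equation modulo a bump, preserving regularity. -/
theorem exists_diver_eq_sub_bump {α δ : ℝ} (hα : α ∈ Ioo (0 : ℝ) 1) (hδ : 0 < δ) (k : ℕ)
    {K : Set (Euc n)} (hKc : Convex ℝ K) (hKb : Bornology.IsBounded K) {c : Euc n} (hcK : c ∈ K) :
    ∃ ρ : Euc n → ℝ, ContDiff ℝ ∞ ρ ∧ (∀ x, ρ x ≠ 0 → ‖x - c‖ ≤ δ) ∧ ∃ C, 0 ≤ C ∧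
      ∀ h : Euc n → ℝ, ContDiff ℝ (k + 1 : ℕ) h → (∀ x, h x ≠ 0 → x ∈ K) →
      ∃ (z : Euc n → Euc n) (m : ℝ), ContDiff ℝ (k + 1 : ℕ) z ∧
        (∀ x, diver z x = h x - m * ρ x) ∧
        (∀ x, z x ≠ 0 → ∃ y ∈ K, ‖x - y‖ ≤ δ) ∧
        (∀ M, 0 ≤ M → HolderBound (k + 1) α M univ h →
          |m| ≤ C * M ∧ HolderBound (k + 1) α (C * M) univ z) ∧
        (ContDiff ℝ ∞ h → ContDiff ℝ ∞ z) := by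
  obtain ⟨R, hR, hKR⟩ := hKb.subset_closedBall_lt 0 c
  set f : ContDiffBump (0 : Euc n) := ⟨δ / 2, δ, by positivity, by linarith⟩ with hf
  set ρ := f.normed volume with hρ
  have hρs : ContDiff ℝ ∞ ρ := f.contDiff_normed
  have hρc : HasCompactSupport ρ := f.hasCompactSupport_normed
  have hρδ : ∀ x, ρ x ≠ 0 → ‖x‖ ≤ δ := by
    intro x hx
    have : x ∈ Function.support (f.normed volume) := hx
    rw [f.support_normed_eq, mem_ball_zero_iff] at this
    exact this.le
  have hρ1 : ∫ x, ρ x = 1 := f.integral_normed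
  obtain ⟨N, hN, hρN⟩ := HolderBound.of_hasCompactSupport (k + 1) hα hρs hρc
  set I : Measure ℝ := volume.restrict (Icc 0 1) with hI
  have : IsFiniteMeasure I := by rw [hI]; infer_instance
  have hI1 : I.real univ = 1 := by simp [hI]
  set B : ℝ →L[ℝ] Euc n →L[ℝ] Euc n := ContinuousLinearMap.lsmul ℝ ℝ with hB
  have hBn : ‖B‖ ≤ 1 := ContinuousLinearMap.opNorm_lsmul_le
  set b₁ : Euc n × ℝ → Euc n := fun p => ρ p.1 • p.1
  set c₁ : Euc n × ℝ → Euc n := fun p => p.2 • p.1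
  set c₂ : Euc n × ℝ → Euc n := fun p => c + p.2 • (p.1 - c)
  have hb₁' : Integrable (fun ζ : Euc n => ρ ζ • ζ) :=
    (hρs.continuous.smul continuous_id).integrable_of_hasCompactSupport hρc.smul_right
  have hb₁ : Integrable b₁ (volume.prod I) := hb₁'.comp_fst I
  have hc₁ : AEStronglyMeasurable c₁ (volume.prod I) :=
    (continuous_snd.smul continuous_fst).aestronglyMeasurable
  have hc₂ : AEStronglyMeasurable c₂ (volume.prod I) :=
    (continuous_const.add (continuous_snd.smul (continuous_fst.sub continuous_const))).aestronglyMeasurable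
  set C₁ := ∫ p, ‖b₁ p‖ ∂(volume.prod I)
  have hC₁ : 0 ≤ C₁ := integral_nonneg fun _ => norm_nonneg _
  set W := volume.real (Metric.closedBall c R)
  have hW : 0 ≤ W := measureReal_nonneg
  refine ⟨fun x => ρ (x - c), hρs.comp (contDiff_id.sub contDiff_const), fun x hx => hρδ _ hx,
    C₁ + R * W * N + W, by positivity, fun h hh hhK => ?_⟩
  have hhc : HasCompactSupport h := by
    refine HasCompactSupport.of_support_subset_isCompact (isCompact_closedBall c R) fun x hx => ?_
    exact hKR (hhK x hx)
  set b₂ : Euc n × ℝ → Euc n := fun p => h p.1 • (p.1 - c)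
  have hb₂' : Integrable (fun y : Euc n => h y • (y - c)) :=
    (hh.continuous.smul (continuous_id.sub continuous_const)).integrable_of_hasCompactSupport
      hhc.smul_right
  have hb₂ : Integrable b₂ (volume.prod I) := hb₂'.comp_fst I
  set z₁ := translateAverage (volume.prod I) b₁ c₁ B h
  set z₂ := translateAverage (volume.prod I) b₂ c₂ B ρ
  obtain ⟨Mh, -, hMh⟩ := exists_bound_iteratedFDeriv_of_hasCompactSupport hh hhc
  have av₁ := translateAverage_holderBound (α := α) (A := univ) (A' := univ) hb₁ hc₁ (by simp) (k + 1)
    B h hh hMh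
  have av₂ := translateAverage_holderBound (α := α) (A := univ) (A' := univ) hb₂ hc₂ (by simp) (k + 1)
    B ρ (hρs.of_le (by exact_mod_cast le_top)) (fun j hj x => hρN.bound j hj x (mem_univ x))
  have hh1 : ContDiff ℝ 1 h := hh.of_le (by exact_mod_cast (by omega : 1 ≤ k + 1))
  have hρ1' : ContDiff ℝ 1 ρ := hρs.of_le (by exact_mod_cast le_top)
  refine ⟨fun x => z₁ x + -z₂ x, ∫ y, h y, av₁.1.add av₂.1.neg, fun x => ?_, fun x hx => ?_,
    fun M hM hhM => ⟨?_, ?_⟩, fun hsm => ?_⟩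
  · have hconv : Integrable (fun ζ => ρ ζ * h (x - ζ)) := by
      refine Continuous.integrable_of_hasCompactSupport ?_ hρc.mul_right
      have := hρs.continuous
      have := hh.continuous
      fun_prop
    have hconv2 : Integrable (fun y => h y * ρ (x - y)) := by
      refine Continuous.integrable_of_hasCompactSupport ?_ hhc.mul_right
      have := hρs.continuous
      have := hh.continuous
      fun_prop
    have d₁ : diver z₁ x = h x - ∫ ζ, ρ ζ * h (x - ζ) := by
      obtain ⟨i, e⟩ := diver_translateAverage hb₁ hc₁ hh1 hhc x
      rw [e, integral_prod _ i]
      have : ∀ ζ, ∫ s, fderiv ℝ h (x - c₁ (ζ, s)) (b₁ (ζ, s)) ∂I =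
          h x * ρ ζ - ρ ζ * h (x - ζ) := by
        intro ζ
        simp only [b₁, c₁, map_smul, smul_eq_mul]
        rw [integral_const_mul, setIntegral_fderiv_segment hh1]
        ring
      simp only [this]
      rw [integral_sub (f.integrable_normed.const_mul _) hconv, integral_const_mul, hρ1, mul_one]
    have d₂ : diver z₂ x = (∫ y, h y) * ρ (x - c) - ∫ y, h y * ρ (x - y) := by
      obtain ⟨i, e⟩ := diver_translateAverage hb₂ hc₂ hρ1' hρc x
      rw [e, integral_prod _ i]
      have : ∀ y, ∫ s, fderiv ℝ ρ (x - c₂ (y, s)) (b₂ (y, s)) ∂I =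
          h y * ρ (x - c) - h y * ρ (x - y) := by
        intro y
        simp only [b₂, c₂, map_smul, smul_eq_mul, ← sub_sub]
        rw [integral_const_mul, setIntegral_fderiv_segment hρ1']
        rw [sub_sub_sub_cancel_right]
        ring
      simp only [this]
      rw [integral_sub ((hh.continuous.integrable_of_hasCompactSupport hhc).mul_const _) hconv2,
        integral_mul_const]
    have e : ∫ ζ, ρ ζ * h (x - ζ) = ∫ y, h y * ρ (x - y) := by
      rw [← integral_sub_left_eq_self _ volume x]
      simp [mul_comm]
    have hz : fderiv ℝ (fun x => z₁ x + -z₂ x) x = fderiv ℝ z₁ x - fderiv ℝ z₂ x := by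
      simp only [← sub_eq_add_neg]
      exact fderiv_fun_sub (av₁.1.differentiable (by simp) x) (av₂.1.differentiable (by simp) x)
    rw [diver_eq_traceCLM, hz, map_sub, ← diver_eq_traceCLM, ← diver_eq_traceCLM, d₁, d₂, e]
    ring
  · have hs01 : ∀ᵐ p ∂((volume : Measure (Euc n)).prod I), p.2 ∈ Icc (0 : ℝ) 1 := by
      have h1 : ∀ᵐ s ∂I, s ∈ Icc (0 : ℝ) 1 := ae_restrict_mem measurableSet_Icc
      exact Measure.quasiMeasurePreserving_snd.ae h1
    by_contra hcon
    push Not at hcon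
    have hz₁ : z₁ x = 0 := by
      refine integral_eq_zero_of_ae ?_
      filter_upwards [hs01] with p hp
      by_contra hne
      simp only [hB, b₁, c₁, ContinuousLinearMap.lsmul_apply, Pi.zero_apply, smul_eq_zero,
        not_or] at hne
      have h1 := hcon _ (hhK _ hne.1)
      have h2 := hρδ _ hne.2.1
      rw [sub_sub_cancel, norm_smul, Real.norm_of_nonneg hp.1] at h1
      nlinarith [hp.2, norm_nonneg p.1]
    have hz₂ : z₂ x = 0 := by
      refine integral_eq_zero_of_ae ?_
      filter_upwards [hs01] with p hp
      by_contra hne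
      simp only [hB, b₂, c₂, ContinuousLinearMap.lsmul_apply, Pi.zero_apply, smul_eq_zero,
        not_or] at hne
      have h2 := hρδ _ hne.1
      have h3 : c + p.2 • (p.1 - c) ∈ K := hKc.add_smul_sub_mem hcK (hhK _ hne.2.1) hp
      exact absurd h2 (not_le.2 (hcon _ h3))
    exact hx (by simp [hz₁, hz₂])
  · have hb : ∀ x, ‖h x‖ ≤ M := fun x => (holderBound_zero_iff.1 (hhM.of_le (Nat.zero_le _))).1 x (mem_univ x)
    have : ∫ y, h y = ∫ y in Metric.closedBall c R, h y := by
      rw [setIntegral_eq_integral_of_forall_compl_eq_zero]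
      intro x hx
      by_contra hne
      exact hx (hKR (hhK x hne))
    rw [this, ← Real.norm_eq_abs]
    refine (norm_setIntegral_le_of_norm_le_const measure_closedBall_lt_top (fun x _ => hb x)).trans ?_
    change M * W ≤ _
    nlinarith [show 0 ≤ (C₁ + R * W * N) * M by positivity]
  · have hb : ∀ x, ‖h x‖ ≤ M := fun x => (holderBound_zero_iff.1 (hhM.of_le (Nat.zero_le _))).1 x (mem_univ x)
    have hb2 : ∫ p, ‖b₂ p‖ ∂(volume.prod I) ≤ M * R * W := by
      have e1 : ∫ p, ‖b₂ p‖ ∂(volume.prod I) = ∫ y, ‖h y • (y - c)‖ := by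
        have := integral_fun_fst (μ := volume) (ν := I) (fun y : Euc n => ‖h y • (y - c)‖)
        rw [hI1, one_smul] at this
        exact this
      have e2 : ∫ y, ‖h y • (y - c)‖ = ∫ y in Metric.closedBall c R, ‖h y • (y - c)‖ := by
        rw [setIntegral_eq_integral_of_forall_compl_eq_zero]
        intro x hx
        have : h x = 0 := by
          by_contra hne
          exact hx (hKR (hhK x hne))
        simp [this]
      rw [e1, e2]
      refine (le_abs_self _).trans ?_
      rw [← Real.norm_eq_abs]
      refine norm_setIntegral_le_of_norm_le_const measure_closedBall_lt_top fun y hy => ?_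
      rw [norm_norm, norm_smul]
      rw [mem_closedBall_iff_norm] at hy
      exact mul_le_mul (hb y) hy (norm_nonneg _) hM
    have t₂ := (av₂.2 N hN hρN).clm_comp (-ContinuousLinearMap.id ℝ (Euc n)) av₂.1
    have hid : ‖-ContinuousLinearMap.id ℝ (Euc n)‖ ≤ 1 := by
      rw [norm_neg]
      exact ContinuousLinearMap.norm_id_le
    refine (HolderBound.add av₁.1 av₂.1.neg (av₁.2 M hM hhM) t₂).mono_const ?_
    have hb20 : 0 ≤ ∫ p, ‖b₂ p‖ ∂(volume.prod I) := integral_nonneg fun _ => norm_nonneg _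
    have i1 : ‖B‖ * C₁ * M ≤ 1 * C₁ * M := by gcongr
    have i2 : ‖-ContinuousLinearMap.id ℝ (Euc n)‖ * (‖B‖ * (∫ p, ‖b₂ p‖ ∂(volume.prod I)) * N) ≤
      1 * (1 * (M * R * W) * N) := by gcongr
    nlinarith [show 0 ≤ W * M by positivity]
  · refine ContDiff.add (contDiff_infty.2 fun l => ?_) (ContDiff.neg (contDiff_infty.2 fun l => ?_))
    · have hl : ContDiff ℝ l h := hsm.of_le (by exact_mod_cast le_top)
      obtain ⟨Ml, -, hMl⟩ := exists_bound_iteratedFDeriv_of_hasCompactSupport hl hhc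
      exact (translateAverage_holderBound (α := α) (A := univ) (A' := univ) hb₁ hc₁ (by simp) l
        B h hl hMl).1
    · have hl : ContDiff ℝ l ρ := hρs.of_le (by exact_mod_cast le_top)
      obtain ⟨Ml, -, hMl⟩ := exists_bound_iteratedFDeriv_of_hasCompactSupport hl hρc
      exact (translateAverage_holderBound (α := α) (A := univ) (A' := univ) hb₂ hc₂ (by simp) l
        B ρ hl hMl).1

end Divergence

section ParametricIntegral

variable {X Y F : Type} [NormedAddCommGroup X] [NormedSpace ℝ X] [ProperSpace X]
  [TopologicalSpace Y] [SecondCountableTopology Y]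
  [MeasurableSpace Y] [OpensMeasurableSpace Y]
  [NormedAddCommGroup F] [NormedSpace ℝ F]

theorem hasFDerivAt_setIntegral_of_continuous {μ : Measure Y} [IsFiniteMeasureOnCompacts μ]
    {K : Set Y} (hK : IsCompact K) (hKm : MeasurableSet K) {q : X → Y → F} {q' : X → Y → X →L[ℝ] F}
    (hq : Continuous (Function.uncurry q)) (hq' : Continuous (Function.uncurry q'))
    (hd : ∀ x y, HasFDerivAt (fun x => q x y) (q' x y) x) (x : X) :
    HasFDerivAt (fun x => ∫ y in K, q x y ∂μ) (∫ y in K, q' x y ∂μ) x := by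
  obtain ⟨M, hM⟩ := ((isCompact_closedBall x 1).prod hK).exists_bound_of_continuousOn
    (f := Function.uncurry q') hq'.continuousOn
  have hf : IsFiniteMeasure (μ.restrict K) := ⟨by simpa using hK.measure_lt_top⟩
  have hqx : ∀ x, Continuous (q x) := fun x => hq.comp (Continuous.prodMk_right x)
  have hqx' : Continuous (q' x) := hq'.comp (Continuous.prodMk_right x)
  refine hasFDerivAt_integral_of_dominated_of_fderiv_le (F' := q') (bound := fun _ => M)
    (Metric.closedBall_mem_nhds x one_pos)
    (Eventually.of_forall fun y => (hqx y).aestronglyMeasurable)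
    ((hqx x).continuousOn.integrableOn_compact' hK hKm)
    hqx'.aestronglyMeasurable ?_ (integrable_const M)
    (Eventually.of_forall fun y z _ => hd z y)
  filter_upwards [ae_restrict_mem hKm] with y hy z hz
  exact hM (z, y) ⟨hz, hy⟩

end ParametricIntegral

section HalfSpace

variable {n : ℕ} {F : Type} [NormedAddCommGroup F] [NormedSpace ℝ F]

/-- The height function on Euclidean space in direction `i`. -/
def hgt (i : Fin n) : Euc n →L[ℝ] ℝ := EuclideanSpace.proj i

/-- The vertical unit vector in direction `i`. -/
def vert (i : Fin n) : Euc n := EuclideanSpace.single i 1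

/-- The projection onto the horizontal hyperplane. -/
def horiz (i : Fin n) : Euc n →L[ℝ] Euc n :=
  ContinuousLinearMap.id ℝ (Euc n) - (hgt i).smulRight (vert i)

theorem hgt_apply (i : Fin n) (x : Euc n) : hgt i x = x i := rfl

@[simp] theorem hgt_vert (i : Fin n) : hgt i (vert i) = 1 := by
  simp [hgt_apply, vert]

theorem horiz_apply (i : Fin n) (x : Euc n) : horiz i x = x - hgt i x • vert i := by
  simp [horiz]

@[simp] theorem hgt_horiz (i : Fin n) (x : Euc n) : hgt i (horiz i x) = 0 := by
  simp [horiz_apply]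

@[simp] theorem horiz_vert (i : Fin n) : horiz i (vert i) = 0 := by
  simp [horiz_apply]

theorem horiz_of_hgt_eq_zero {i : Fin n} {x : Euc n} (h : hgt i x = 0) : horiz i x = x := by
  simp [horiz_apply, h]

theorem abs_hgt_le (i : Fin n) (x : Euc n) : |hgt i x| ≤ ‖x‖ := by
  rw [hgt_apply, ← Real.norm_eq_abs]
  exact PiLp.norm_apply_le x i

theorem norm_vert (i : Fin n) : ‖vert i‖ = 1 := by
  simp [vert]

theorem norm_horiz_le (i : Fin n) (x : Euc n) : ‖horiz i x‖ ≤ 2 * ‖x‖ := by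
  rw [horiz_apply]
  refine (norm_sub_le _ _).trans ?_
  rw [norm_smul, norm_vert, mul_one, Real.norm_eq_abs]
  linarith [abs_hgt_le i x]

theorem sum_hgt_smul_vert (x : Euc n) : ∑ j, hgt j x • vert j = x := by
  simpa [hgt_apply, vert] using (EuclideanSpace.basisFun (Fin n) ℝ).sum_repr x

/-- Smooth functions supported in the unit ball. -/
structure IsTest (ψ : Euc n → ℝ) : Prop where
  contDiff : ContDiff ℝ ∞ ψ
  tsupport_subset : tsupport ψ ⊆ Metric.closedBall 0 1

theorem IsTest.coord_mul {ψ : Euc n → ℝ} (h : IsTest ψ) (j : Fin n) :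
    IsTest (fun η => hgt j η * ψ η) :=
  ⟨(hgt j).contDiff.mul h.contDiff, (tsupport_mul_subset_right).trans h.tsupport_subset⟩

theorem IsTest.fderiv_apply {ψ : Euc n → ℝ} (h : IsTest ψ) (a : Euc n) :
    IsTest (fun η => fderiv ℝ ψ η a) :=
  ⟨(h.contDiff.fderiv_right (m := ∞) (by simp)).clm_apply contDiff_const,
    ((closure_mono fun x hx => by
      intro h0
      simp [h0] at hx).trans (tsupport_fderiv_subset ℝ)).trans h.tsupport_subset⟩

theorem IsTest.hasCompactSupport {ψ : Euc n → ℝ} (h : IsTest ψ) : HasCompactSupport ψ :=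
  (isCompact_closedBall 0 1).of_isClosed_subset (isClosed_tsupport ψ) h.tsupport_subset

theorem IsTest.eq_zero {ψ : Euc n → ℝ} (h : IsTest ψ) {x : Euc n}
    (hx : x ∉ Metric.closedBall 0 1) : ψ x = 0 :=
  image_eq_zero_of_notMem_tsupport fun hmem => hx (h.tsupport_subset hmem)

/-- Parameter domain of the averaged primitive. -/
def conePar (n : ℕ) : Set (ℝ × Euc n) := Icc (0 : ℝ) 1 ×ˢ Metric.closedBall 0 1

theorem isCompact_conePar : IsCompact (conePar n) := isCompact_Icc.prod (isCompact_closedBall _ _)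

theorem measurableSet_conePar : MeasurableSet (conePar n) :=
  measurableSet_Icc.prod measurableSet_closedBall

/-- The direction of integration determined by `η`. -/
def coneDir (i : Fin n) (η : Euc n) : Euc n := vert i + horiz i η

@[fun_prop] theorem continuous_coneDir (i : Fin n) : Continuous (coneDir i) :=
  continuous_const.add (horiz i).continuous

/-- Primitive of `g` from the hyperplane, averaged over directions weighted by `ψ`. -/
def conePrim (i : Fin n) (ψ : Euc n → ℝ) (g : Euc n → F) (x : Euc n) : F :=
  hgt i x • ∫ p in conePar n, ψ p.2 • g (x - (p.1 * hgt i x) • coneDir i p.2)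

theorem setIntegral_conePar {q : ℝ × Euc n → F} (hq : Continuous q) :
    ∫ p in conePar n, q p = ∫ σ in (0 : ℝ)..1, ∫ η in Metric.closedBall (0 : Euc n) 1, q (σ, η) := by
  rw [intervalIntegral.integral_of_le zero_le_one, ← integral_Icc_eq_integral_Ioc, conePar,
    Measure.volume_eq_prod]
  exact setIntegral_prod _ (hq.continuousOn.integrableOn_compact' isCompact_conePar
    measurableSet_conePar)

theorem setIntegral_conePar_symm {q : ℝ × Euc n → F} (hq : Continuous q) :
    ∫ p in conePar n, q p = ∫ η in Metric.closedBall (0 : Euc n) 1, ∫ σ in (0 : ℝ)..1, q (σ, η) := by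
  simp_rw [intervalIntegral.integral_of_le zero_le_one, ← integral_Icc_eq_integral_Ioc]
  rw [conePar, Measure.volume_eq_prod, ← Measure.prod_restrict]
  refine integral_prod_symm _ ?_
  rw [Measure.prod_restrict]
  exact hq.continuousOn.integrableOn_compact' isCompact_conePar measurableSet_conePar

theorem integrableOn_conePar {G : Type} [NormedAddCommGroup G] {q : ℝ × Euc n → G} (hq : Continuous q) :
    IntegrableOn q (conePar n) :=
  hq.continuousOn.integrableOn_compact' isCompact_conePar measurableSet_conePar

variable [CompleteSpace F]

theorem integral_add_sub_one_smul_deriv {f f' : ℝ → F} (hf : ∀ σ, HasDerivAt f (f' σ) σ)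
    (hc : Continuous fun σ => f σ + (σ - 1) • f' σ) :
    ∫ σ in (0 : ℝ)..1, (f σ + (σ - 1) • f' σ) = f 0 := by
  have hd : ∀ σ : ℝ, HasDerivAt (fun σ : ℝ => (σ - 1) • f σ) (f σ + (σ - 1) • f' σ) σ := by
    intro σ
    refine (((hasDerivAt_id σ).sub_const 1).smul (hf σ)).congr_deriv ?_
    simp [add_comm]
  rw [intervalIntegral.integral_eq_sub_of_hasDerivAt (fun σ _ => hd σ)
    (hc.intervalIntegrable _ _)]
  simp

theorem hasFDerivAt_conePrim_aux (i : Fin n) {ψ : Euc n → ℝ} (hψ : Continuous ψ) {g : Euc n → F}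
    (hg : ContDiff ℝ 1 g) (x : Euc n) :
    HasFDerivAt (conePrim i ψ g)
      ((hgt i).smulRight ((∫ η in Metric.closedBall (0 : Euc n) 1, ψ η) • g x) +
        hgt i x • ∫ p in conePar n, ψ p.2 •
          (fderiv ℝ g (x - (p.1 * hgt i x) • coneDir i p.2)).comp
            (ContinuousLinearMap.id ℝ (Euc n) - (hgt i).smulRight (coneDir i p.2))) x := by
  have hgc := hg.continuous
  have hg'c : Continuous (fderiv ℝ g) := hg.continuous_fderiv (by simp)
  set y : Euc n → ℝ × Euc n → Euc n := fun x p => x - (p.1 * hgt i x) • coneDir i p.2 with hy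
  have hsr : Continuous fun p : ℝ × Euc n => (p.1 • (hgt i).smulRight (coneDir i p.2) :
      Euc n →L[ℝ] Euc n) := by
    have : Continuous fun v : Euc n => ((hgt i).smulRight v : Euc n →L[ℝ] Euc n) :=
      (ContinuousLinearMap.smulRightL ℝ (Euc n) (Euc n) (hgt i)).continuous
    fun_prop
  have hsr' : Continuous fun p : ℝ × Euc n => ((hgt i).smulRight (coneDir i p.2) :
      Euc n →L[ℝ] Euc n) := by
    have : Continuous fun v : Euc n => ((hgt i).smulRight v : Euc n →L[ℝ] Euc n) :=
      (ContinuousLinearMap.smulRightL ℝ (Euc n) (Euc n) (hgt i)).continuous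
    fun_prop
  have hyc : Continuous (Function.uncurry y) := by
    simp only [hy, Function.uncurry_def]
    fun_prop
  have hyx : ∀ x, Continuous (y x) := fun x => hyc.comp (Continuous.prodMk_right x)
  set q' : Euc n → ℝ × Euc n → Euc n →L[ℝ] F := fun x p =>
    ψ p.2 • (fderiv ℝ g (y x p)).comp
      (ContinuousLinearMap.id ℝ (Euc n) - p.1 • (hgt i).smulRight (coneDir i p.2)) with hq'
  have hq'c : Continuous (Function.uncurry q') := by
    simp only [hq', Function.uncurry_def]
    refine (hψ.comp (continuous_snd.comp continuous_snd)).smul ((hg'c.comp hyc).clm_comp ?_)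
    exact continuous_const.sub (hsr.comp continuous_snd)
  have hyd : ∀ x p, HasFDerivAt (fun x => y x p)
      (ContinuousLinearMap.id ℝ (Euc n) - p.1 • (hgt i).smulRight (coneDir i p.2)) x := by
    intro x p
    have h1 : HasFDerivAt (fun x => p.1 * hgt i x) (p.1 • hgt i) x :=
      (hgt i).hasFDerivAt.const_mul p.1
    have h2 := (hasFDerivAt_id x).fun_sub (h1.smul_const (coneDir i p.2))
    refine h2.congr_fderiv ?_
    ext1 v
    simp [mul_smul]
  have hD : HasFDerivAt (fun x => ∫ p in conePar n, ψ p.2 • g (y x p))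
      (∫ p in conePar n, q' x p) x := by
    refine hasFDerivAt_setIntegral_of_continuous isCompact_conePar measurableSet_conePar ?_ hq'c
      (fun x p => ?_) x
    · simp only [Function.uncurry_def]
      exact (hψ.comp (continuous_snd.comp continuous_snd)).smul (hgc.comp hyc)
    · exact ((hg.differentiable (by simp) _).hasFDerivAt.comp x (hyd x p)).const_smul (ψ p.2)
  have hS : HasFDerivAt (conePrim i ψ g) _ x := (hgt i).hasFDerivAt.smul hD
  refine hS.congr_fderiv ?_
  ext1 v
  have hψ2 : Continuous fun p : ℝ × Euc n => ψ p.2 := hψ.comp continuous_snd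
  have c1 : Continuous fun p => ψ p.2 • (fderiv ℝ g (y x p)).comp
      (ContinuousLinearMap.id ℝ (Euc n) - (hgt i).smulRight (coneDir i p.2)) :=
    hψ2.smul ((hg'c.comp (hyx x)).clm_comp (continuous_const.sub hsr'))
  have c2 : Continuous (q' x) := hq'c.comp (Continuous.prodMk_right x)
  have c3 : Continuous fun p => ψ p.2 • g (y x p) := hψ2.smul (hgc.comp (hyx x))
  have key : (∫ η in Metric.closedBall (0 : Euc n) 1, ψ η) • g x =
      ∫ p in conePar n, (ψ p.2 • g (y x p) + (p.1 - 1) • ψ p.2 • fderiv ℝ g (y x p)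
        (-(hgt i x • coneDir i p.2))) := by
    have cq : Continuous fun p : ℝ × Euc n => ψ p.2 • g (y x p) + (p.1 - 1) • ψ p.2 •
        fderiv ℝ g (y x p) (-(hgt i x • coneDir i p.2)) := by
      have h1 := hg'c.comp (hyx x)
      have h2 : Continuous fun p : ℝ × Euc n => fderiv ℝ g (y x p) (-(hgt i x • coneDir i p.2)) :=
        h1.clm_apply (by fun_prop)
      exact c3.add ((continuous_fst.sub continuous_const).smul (hψ2.smul h2))
    rw [setIntegral_conePar_symm cq, ← integral_smul_const]
    congr 1
    ext1 η
    have h1 : ∀ σ : ℝ, HasDerivAt (fun σ : ℝ => y x (σ, η)) (-(hgt i x • coneDir i η)) σ := by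
      intro σ
      have := (((hasDerivAt_id σ).mul_const (hgt i x)).smul_const (coneDir i η)).const_sub x
      simpa using this
    have h2 : ∀ σ : ℝ, HasDerivAt (fun σ : ℝ => ψ η • g (y x (σ, η)))
        (ψ η • fderiv ℝ g (y x (σ, η)) (-(hgt i x • coneDir i η))) σ := fun σ =>
      ((hg.differentiable (by simp) _).hasFDerivAt.comp_hasDerivAt σ (h1 σ)).const_smul (ψ η)
    rw [integral_add_sub_one_smul_deriv h2 (cq.comp (Continuous.prodMk_left η))]
    simp [hy]
  have i1 := (ContinuousLinearMap.apply ℝ F v).integrable_comp (integrableOn_conePar c1)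
  have i2 := (ContinuousLinearMap.apply ℝ F v).integrable_comp (integrableOn_conePar c2)
  have i3 := integrableOn_conePar c3
  have i4 : IntegrableOn (fun p : ℝ × Euc n => (p.1 - 1) • ψ p.2 • fderiv ℝ g (y x p)
        (-(hgt i x • coneDir i p.2))) (conePar n) := by
    refine integrableOn_conePar ?_
    have h1 := hg'c.comp (hyx x)
    have h2 : Continuous fun p : ℝ × Euc n => fderiv ℝ g (y x p) (-(hgt i x • coneDir i p.2)) :=
      h1.clm_apply (by fun_prop)
    exact ((continuous_fst.sub continuous_const).smul (hψ2.smul h2))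
  simp only [ContinuousLinearMap.apply_apply] at i1 i2
  rw [integral_add i3 i4] at key
  have e1 := ContinuousLinearMap.integral_apply (integrableOn_conePar c1) v
  have e2 := ContinuousLinearMap.integral_apply (integrableOn_conePar c2) v
  have e4 : hgt i x • (∫ p in conePar n, q' x p v) - hgt i x • (∫ p in conePar n,
      (ψ p.2 • (fderiv ℝ g (y x p)).comp
        (ContinuousLinearMap.id ℝ (Euc n) - (hgt i).smulRight (coneDir i p.2))) v) =
      hgt i v • ∫ p in conePar n, (p.1 - 1) • ψ p.2 • fderiv ℝ g (y x p)
        (-(hgt i x • coneDir i p.2)) := by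
    rw [← smul_sub, ← integral_sub i2 i1, ← integral_smul, ← integral_smul]
    congr 1
    ext1 p
    simp only [hq', smul_apply, ContinuousLinearMap.comp_apply,
      sub_apply, ContinuousLinearMap.smulRight_apply, map_sub, map_smul,
      map_neg, ContinuousLinearMap.id_apply]
    module
  change hgt i x • (∫ p in conePar n, q' x p) v + hgt i v • (∫ p in conePar n, ψ p.2 • g (y x p)) =
    hgt i v • ((∫ η in Metric.closedBall (0 : Euc n) 1, ψ η) • g x) + hgt i x •
      (∫ p in conePar n, ψ p.2 • (fderiv ℝ g (y x p)).comp
        (ContinuousLinearMap.id ℝ (Euc n) - (hgt i).smulRight (coneDir i p.2))) v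
  rw [e1, e2, key, smul_add, ← e4]
  module

end HalfSpace

section ConeDerivative

variable {n : ℕ} {F : Type} [NormedAddCommGroup F] [NormedSpace ℝ F]

theorem continuous_conePrim_integrand (i : Fin n) {ψ : Euc n → ℝ} (hψ : Continuous ψ)
    {g : Euc n → F} (hg : Continuous g) (x : Euc n) :
    Continuous fun p : ℝ × Euc n => ψ p.2 • g (x - (p.1 * hgt i x) • coneDir i p.2) := by
  fun_prop

theorem ContDiff.smulRight_const {k : WithTop ℕ∞} {E : Type} [NormedAddCommGroup E]
    [NormedSpace ℝ E] (f : E →L[ℝ] ℝ) {u : E → F} (hu : ContDiff ℝ k u) :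
    ContDiff ℝ k fun x => (f.smulRight (u x) : E →L[ℝ] F) :=
  (ContinuousLinearMap.smulRightL ℝ E F f).contDiff.comp hu

/-- Tangential derivative of the averaged primitive. -/
def coneTan (i : Fin n) (ψ : Euc n → ℝ) (j : Fin n) (g : Euc n → F) (x : Euc n) : F :=
  conePrim i ψ (fderiv ℝ g) x (horiz i (vert j))

theorem coneTan_eq (i : Fin n) {ψ : Euc n → ℝ} (hψ : Continuous ψ) (j : Fin n) {g : Euc n → F}
    (hg : ContDiff ℝ 1 g) (x : Euc n) :
    coneTan i ψ j g x = conePrim i ψ (fun y => fderiv ℝ g y (horiz i (vert j))) x := by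
  have hc := continuous_conePrim_integrand i hψ (hg.continuous_fderiv (by simp)) x
  simp only [coneTan, conePrim, smul_apply]
  rw [ContinuousLinearMap.integral_apply (integrableOn_conePar hc)]
  simp

variable [CompleteSpace F]

/-- The derivative of the averaged primitive. -/
def coneDeriv (i : Fin n) (ψ : Euc n → ℝ) (g : Euc n → F) (x : Euc n) : Euc n →L[ℝ] F :=
  (hgt i).smulRight ((∫ η in Metric.closedBall (0 : Euc n) 1, ψ η) • g x) +
    ∑ j, ((hgt j).smulRight (coneTan i ψ j g x) -
      (hgt i).smulRight (coneTan i (fun η => hgt j η * ψ η) j g x))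

theorem hasFDerivAt_conePrim (i : Fin n) {ψ : Euc n → ℝ} (hψ : Continuous ψ) {g : Euc n → F}
    (hg : ContDiff ℝ 1 g) (x : Euc n) :
    HasFDerivAt (conePrim i ψ g) (coneDeriv i ψ g x) x := by
  refine (hasFDerivAt_conePrim_aux i hψ hg x).congr_fderiv ?_
  have hg'c : Continuous (fderiv ℝ g) := hg.continuous_fderiv (by simp)
  have hc : ∀ {ψ : Euc n → ℝ}, Continuous ψ → ∀ j, Continuous fun p : ℝ × Euc n =>
      ψ p.2 • fderiv ℝ g (x - (p.1 * hgt i x) • coneDir i p.2) (horiz i (vert j)) :=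
    fun hψ j => continuous_conePrim_integrand i hψ (hg'c.clm_apply continuous_const) x
  have hψj : ∀ j, Continuous fun η => hgt j η * ψ η := fun j => (hgt j).continuous.mul hψ
  have hsr : Continuous fun p : ℝ × Euc n => ((hgt i).smulRight (coneDir i p.2) :
      Euc n →L[ℝ] Euc n) := by
    have : Continuous fun v : Euc n => ((hgt i).smulRight v : Euc n →L[ℝ] Euc n) :=
      (ContinuousLinearMap.smulRightL ℝ (Euc n) (Euc n) (hgt i)).continuous
    fun_prop
  have c1 : Continuous fun p : ℝ × Euc n => ψ p.2 •
      (fderiv ℝ g (x - (p.1 * hgt i x) • coneDir i p.2)).comp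
      (ContinuousLinearMap.id ℝ (Euc n) - (hgt i).smulRight (coneDir i p.2)) :=
    (hψ.comp continuous_snd).smul
      ((hg'c.comp (by fun_prop)).clm_comp (continuous_const.sub hsr))
  ext1 v
  simp only [coneDeriv, add_apply, smul_apply, ContinuousLinearMap.smulRight_apply, sum_apply,
    sub_apply]
  congr 1
  rw [ContinuousLinearMap.integral_apply (integrableOn_conePar c1)]
  simp_rw [coneTan_eq i hψ _ hg, coneTan_eq i (hψj _) _ hg, conePrim]
  have e : ∀ j, (hgt j v • hgt i x • (∫ p in conePar n, ψ p.2 •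
        fderiv ℝ g (x - (p.1 * hgt i x) • coneDir i p.2) (horiz i (vert j))) -
      hgt i v • hgt i x • ∫ p in conePar n, (hgt j p.2 * ψ p.2) •
        fderiv ℝ g (x - (p.1 * hgt i x) • coneDir i p.2) (horiz i (vert j))) =
      hgt i x • ∫ p in conePar n, (hgt j v - hgt i v * hgt j p.2) • ψ p.2 •
        fderiv ℝ g (x - (p.1 * hgt i x) • coneDir i p.2) (horiz i (vert j)) := by
    intro j
    rw [smul_comm (hgt j v), smul_comm (hgt i v), ← smul_sub, ← integral_smul, ← integral_smul,
      ← integral_sub]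
    · congr 2
      ext1 p
      module
    · exact integrableOn_conePar ((hc hψ j).const_smul (hgt j v))
    · exact integrableOn_conePar ((hc (hψj j) j).const_smul (hgt i v))
  simp_rw [e]
  rw [← Finset.smul_sum, ← integral_finsetSum]
  · congr 2
    ext1 p
    set L := fderiv ℝ g (x - (p.1 * hgt i x) • coneDir i p.2)
    have h1 : v - hgt i v • coneDir i p.2 = ∑ j, (hgt j v - hgt i v * hgt j p.2) • horiz i (vert j) := by
      simp_rw [← map_smul, ← map_sum, sub_smul, mul_smul, Finset.sum_sub_distrib, ← Finset.smul_sum,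
        sum_hgt_smul_vert, map_sub, map_smul]
      rw [horiz_apply i v, coneDir]
      module
    simp only [smul_apply, ContinuousLinearMap.comp_apply, sub_apply, ContinuousLinearMap.id_apply,
      ContinuousLinearMap.smulRight_apply, h1, map_sum, map_smul, Finset.smul_sum]
    exact Finset.sum_congr rfl fun j _ => smul_comm _ _ _
  · intro j _
    refine integrableOn_conePar ?_
    exact (continuous_const.sub (continuous_const.mul ((hgt j).continuous.comp continuous_snd))).smul
      (hc hψ j)

theorem fderiv_conePrim (i : Fin n) {ψ : Euc n → ℝ} (hψ : Continuous ψ) {g : Euc n → F}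
    (hg : ContDiff ℝ 1 g) : fderiv ℝ (conePrim i ψ g) = coneDeriv i ψ g :=
  funext fun x => (hasFDerivAt_conePrim i hψ hg x).fderiv

theorem contDiff_conePrim (i : Fin n) (k : ℕ) : ∀ {F : Type} [NormedAddCommGroup F]
    [NormedSpace ℝ F] [CompleteSpace F] {ψ : Euc n → ℝ}, IsTest ψ → ∀ {g : Euc n → F},
    ContDiff ℝ ∞ g → ContDiff ℝ k (conePrim i ψ g) := by
  induction k with
  | zero =>
    intro F _ _ _ ψ hψ g hg
    refine contDiff_zero.2 (continuous_iff_continuousAt.2 fun x => ?_)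
    exact (hasFDerivAt_conePrim i hψ.contDiff.continuous (hg.of_le (by simp)) x).continuousAt
  | succ k ih =>
    intro F _ _ _ ψ hψ g hg
    have hg1 : ContDiff ℝ 1 g := hg.of_le (by simp)
    rw [show ((k + 1 : ℕ) : WithTop ℕ∞) = (k : WithTop ℕ∞) + 1 by simp,
      contDiff_succ_iff_fderiv]
    refine ⟨fun x => (hasFDerivAt_conePrim i hψ.contDiff.continuous hg1 x).differentiableAt,
      by simp, ?_⟩
    rw [fderiv_conePrim i hψ.contDiff.continuous hg1]
    have hg' : ContDiff ℝ ∞ (fderiv ℝ g) := hg.fderiv_right (by simp)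
    have htan : ∀ {ψ : Euc n → ℝ}, IsTest ψ → ∀ j, ContDiff ℝ k (coneTan i ψ j g) :=
      fun hψ j => (ih hψ hg').clm_apply contDiff_const
    refine ContDiff.add (ContDiff.smulRight_const _ ?_) (ContDiff.sum fun j _ => ?_)
    · exact (hg.of_le (by exact_mod_cast le_top)).const_smul _
    · exact (ContDiff.smulRight_const _ (htan hψ j)).sub
        (ContDiff.smulRight_const _ (htan (hψ.coord_mul j) j))

end ConeDerivative

section SingularIntegral

variable {F : Type} [NormedAddCommGroup F] [NormedSpace ℝ F] {α A d a t t' : ℝ}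

theorem intervalIntegrable_sub_rpow (hα : α ∈ Ioo (0 : ℝ) 1) (a t : ℝ) :
    IntervalIntegrable (fun s => A * (t - s) ^ (α - 1)) volume a t := by
  have h := (intervalIntegral.intervalIntegrable_rpow' (a := t - a) (b := 0) (r := α - 1)
    (by linarith [hα.1])).comp_sub_left t
  simp only [sub_sub_cancel, sub_zero] at h
  exact h.const_mul A

theorem norm_integral_le_rpow (hα : α ∈ Ioo (0 : ℝ) 1) (hat : a ≤ t) {p : ℝ → F}
    (hp : ∀ s ∈ Ico a t, ‖p s‖ ≤ A * (t - s) ^ (α - 1)) :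
    ‖∫ s in a..t, p s‖ ≤ A * (t - a) ^ α / α := by
  refine (intervalIntegral.norm_integral_le_of_norm_le hat ?_
    (intervalIntegrable_sub_rpow (A := A) hα a t)).trans_eq ?_
  · have : ∀ᵐ s : ℝ, s ≠ t := by simp [ae_iff]
    filter_upwards [this] with s hs hs'
    exact hp s ⟨hs'.1.le, lt_of_le_of_ne hs'.2 hs⟩
  · rw [intervalIntegral.integral_const_mul,
      intervalIntegral.integral_comp_sub_left (fun s => s ^ (α - 1)) t, sub_self,
      integral_rpow (Or.inl (by linarith [hα.1])), sub_add_cancel, Real.zero_rpow hα.1.ne']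
    ring

theorem norm_integral_le_rpow_sub_two (hα : α ∈ Ioo (0 : ℝ) 1) (hA : 0 ≤ A) (hd : 0 < d)
    (h0t : 0 ≤ t - d) {p : ℝ → F}
    (hp : ∀ s ∈ Icc 0 (t - d), ‖p s‖ ≤ A * d * (t - s) ^ (α - 2)) :
    ‖∫ s in (0 : ℝ)..(t - d), p s‖ ≤ A * d ^ α / (1 - α) := by
  have hpos : ∀ x ∈ uIcc (0 : ℝ) (t - d), 0 < t - x := by
    intro x hx
    rw [uIcc_of_le h0t] at hx
    linarith [hx.2]
  have hc : ContinuousOn (fun s => A * d * (t - s) ^ (α - 2)) (uIcc 0 (t - d)) := by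
    refine continuousOn_const.mul (ContinuousOn.rpow_const (by fun_prop) fun x hx => ?_)
    exact Or.inl (hpos x hx).ne'
  refine (intervalIntegral.norm_integral_le_of_norm_le h0t ?_ hc.intervalIntegrable).trans ?_
  · exact Eventually.of_forall fun s hs => hp s ⟨hs.1.le, hs.2⟩
  · have h0 : (0 : ℝ) ∉ uIcc d t := by
      rw [uIcc_of_le (by linarith)]
      exact fun h => absurd h.1 (by linarith)
    rw [intervalIntegral.integral_const_mul,
      intervalIntegral.integral_comp_sub_left (fun s => s ^ (α - 2)) t, sub_sub_cancel, sub_zero,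
      integral_rpow (Or.inr ⟨by linarith [hα.2], h0⟩), show α - 2 + 1 = -(1 - α) by ring,
      div_neg, ← neg_div, neg_sub, ← mul_div_assoc]
    have h1 : 0 < 1 - α := by linarith [hα.2]
    refine div_le_div_of_nonneg_right ?_ h1.le
    have h2 : d * d ^ (-(1 - α)) = d ^ α := by
      rw [← Real.rpow_one_add' hd.le (by linarith [hα.1])]
      congr 1
      ring
    have h3 : 0 ≤ t ^ (-(1 - α)) := Real.rpow_nonneg (by linarith) _
    calc A * d * (d ^ (-(1 - α)) - t ^ (-(1 - α))) ≤ A * d * d ^ (-(1 - α)) := by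
          gcongr
          linarith
      _ = A * d ^ α := by rw [mul_assoc, h2]

theorem norm_integral_sub_integral_le (hα : α ∈ Ioo (0 : ℝ) 1) (hA : 0 ≤ A) (hd : 0 < d)
    (ht : 0 ≤ t) (htt' : t ≤ t') (hd' : t' - t ≤ d) {p q : ℝ → F} (hpc : Continuous p)
    (hqc : Continuous q) (hp : ∀ s ∈ Ico 0 t, ‖p s‖ ≤ A * (t - s) ^ (α - 1))
    (hq : ∀ s ∈ Ico 0 t', ‖q s‖ ≤ A * (t' - s) ^ (α - 1))
    (hpq : ∀ s ∈ Ico 0 t, ‖p s - q s‖ ≤ A * d * (t - s) ^ (α - 2)) :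
    ‖(∫ s in (0 : ℝ)..t, p s) - ∫ s in (0 : ℝ)..t', q s‖ ≤
      A * (1 / (1 - α) + 3 / α) * d ^ α := by
  have hα1 : 0 < 1 - α := by linarith [hα.2]
  have hα0 := hα.1
  have hdα : 0 ≤ d ^ α := Real.rpow_nonneg hd.le α
  set t₀ := max 0 (t - d) with ht₀
  have h0 : 0 ≤ t₀ := le_max_left _ _
  have h1 : t₀ ≤ t := max_le ht (by linarith)
  have h2 : t - t₀ ≤ d := by linarith [le_max_right 0 (t - d)]
  have hI : ∀ {f : ℝ → F}, Continuous f → ∀ a b : ℝ, IntervalIntegrable f volume a b :=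
    fun hf a b => hf.intervalIntegrable a b
  rw [← intervalIntegral.integral_add_adjacent_intervals (hI hpc 0 t₀) (hI hpc t₀ t),
    ← intervalIntegral.integral_add_adjacent_intervals (hI hqc 0 t₀) (hI hqc t₀ t'),
    add_sub_add_comm, ← intervalIntegral.integral_sub (hI hpc _ _) (hI hqc _ _)]
  have b1 : ‖∫ s in (0 : ℝ)..t₀, (p s - q s)‖ ≤ A * d ^ α / (1 - α) := by
    rcases le_total 0 (t - d) with h | h
    · rw [show t₀ = t - d from max_eq_right h]
      exact norm_integral_le_rpow_sub_two hα hA hd h fun s hs => hpq s ⟨hs.1, by linarith [hs.2]⟩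
    · rw [show t₀ = 0 from max_eq_left h, intervalIntegral.integral_same, norm_zero]
      positivity
  have b2 : ‖∫ s in t₀..t, p s‖ ≤ A * d ^ α / α := by
    refine (norm_integral_le_rpow hα h1 fun s hs => hp s ⟨h0.trans hs.1, hs.2⟩).trans ?_
    have := Real.rpow_le_rpow (by linarith) h2 hα0.le
    gcongr
  have b3 : ‖∫ s in t₀..t', q s‖ ≤ A * (2 * d ^ α) / α := by
    refine (norm_integral_le_rpow hα (h1.trans htt') fun s hs =>
      hq s ⟨h0.trans hs.1, hs.2⟩).trans ?_
    have h3 := Real.rpow_le_rpow (z := α) (by linarith) (show t' - t₀ ≤ 2 * d by linarith) hα0.le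
    rw [Real.mul_rpow (by norm_num) hd.le] at h3
    have h4 : (2 : ℝ) ^ α ≤ 2 := by
      simpa using Real.rpow_le_rpow_of_exponent_le (show (1 : ℝ) ≤ 2 by norm_num) hα.2.le
    have h5 : (t' - t₀) ^ α ≤ 2 * d ^ α := h3.trans (by gcongr)
    gcongr
  refine (norm_add_le _ _).trans ?_
  have h6 := norm_sub_le (∫ s in t₀..t, p s) (∫ s in t₀..t', q s)
  calc _ ≤ A * d ^ α / (1 - α) + (A * d ^ α / α + A * (2 * d ^ α) / α) := by linarith
    _ = _ := by ring

end SingularIntegral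

section SliceAverage

variable {n : ℕ} {F : Type} [NormedAddCommGroup F] [NormedSpace ℝ F]

/-- Average over a horizontal slice at scale `τ`. -/
def sliceAvg (i : Fin n) (ψ : Euc n → ℝ) (g : Euc n → F) (z : Euc n) (τ : ℝ) : F :=
  ∫ η in Metric.closedBall (0 : Euc n) 1, ψ η • g (z - τ • horiz i η)

theorem IsTest.setIntegral_smul {ψ : Euc n → ℝ} (hψ : IsTest ψ) (f : Euc n → F) :
    ∫ η in Metric.closedBall (0 : Euc n) 1, ψ η • f η = ∫ η, ψ η • f η :=
  setIntegral_eq_integral_of_forall_compl_eq_zero fun x hx => by rw [hψ.eq_zero hx, zero_smul]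

theorem IsTest.integrable_smul {ψ : Euc n → ℝ} (hψ : IsTest ψ) {f : Euc n → F}
    (hf : Continuous f) : Integrable fun η => ψ η • f η :=
  (hψ.contDiff.continuous.smul hf).integrable_of_hasCompactSupport hψ.hasCompactSupport.smul_right

theorem IsTest.integral_smul_fderiv {ψ : Euc n → ℝ} (hψ : IsTest ψ) {f : Euc n → F}
    (hf : ContDiff ℝ 1 f) (b : Euc n) :
    ∫ η, ψ η • fderiv ℝ f η b = -∫ η, fderiv ℝ ψ η b • f η :=
  integral_smul_fderiv_eq_neg_fderiv_smul_of_integrable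
    ((hψ.fderiv_apply b).integrable_smul hf.continuous)
    (hψ.integrable_smul ((hf.continuous_fderiv (by simp)).clm_apply continuous_const))
    (hψ.integrable_smul hf.continuous)
    (fun x _ => (hψ.contDiff.differentiable (by simp)) x)
    (fun x _ => (hf.differentiable (by simp)) x)

theorem IsTest.integral_fderiv {ψ : Euc n → ℝ} (hψ : IsTest ψ) (b : Euc n) :
    ∫ η, fderiv ℝ ψ η b = 0 := by
  have := hψ.integral_smul_fderiv (contDiff_const (c := (1 : ℝ))) b
  simpa using this

theorem smul_sliceAvg_fderiv (i : Fin n) {ψ : Euc n → ℝ} (hψ : IsTest ψ) {g : Euc n → F}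
    (hg : ContDiff ℝ 1 g) (b z : Euc n) (τ : ℝ) :
    τ • sliceAvg i ψ (fun y => fderiv ℝ g y (horiz i b)) z τ =
      sliceAvg i (fun η => fderiv ℝ ψ η b) g z τ := by
  have hy : ∀ η, HasFDerivAt (fun η => z - τ • horiz i η) (-(τ • horiz i)) η := fun η =>
    ((horiz i).hasFDerivAt.const_smul τ).const_sub z
  have hf : ContDiff ℝ 1 fun η => g (z - τ • horiz i η) :=
    hg.comp (contDiff_const.sub ((horiz i).contDiff.const_smul τ))
  have hd : ∀ η, fderiv ℝ (fun η => g (z - τ • horiz i η)) η b =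
      -(τ • fderiv ℝ g (z - τ • horiz i η) (horiz i b)) := by
    intro η
    have := ((hg.differentiable (by simp) _).hasFDerivAt.comp η (hy η)).fderiv
    rw [Function.comp_def] at this
    rw [this]
    simp
  have h := hψ.integral_smul_fderiv hf b
  simp only [hd] at h
  rw [sliceAvg, sliceAvg, hψ.setIntegral_smul, (hψ.fderiv_apply b).setIntegral_smul,
    ← neg_neg (∫ η, fderiv ℝ ψ η b • _), ← h, ← integral_smul, ← integral_neg]
  congr 1
  ext1 η
  module

theorem sliceAvg_continuous (i : Fin n) {ψ : Euc n → ℝ} (hψ : Continuous ψ) {g : Euc n → F}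
    (hg : Continuous g) : Continuous fun p : Euc n × ℝ => sliceAvg i ψ g p.1 p.2 := by
  refine continuous_parametric_integral_of_continuous (f := fun (p : Euc n × ℝ) (η : Euc n) =>
    ψ η • g (p.1 - p.2 • horiz i η)) ?_ (isCompact_closedBall _ _)
  simp only [Function.uncurry_def]
  fun_prop

/-- Hölder continuity on the closed upper half space. -/
def HalfHolder (i : Fin n) (α M : ℝ) (g : Euc n → F) : Prop :=
  ∀ x y, 0 ≤ hgt i x → 0 ≤ hgt i y → ‖g x - g y‖ ≤ M * ‖x - y‖ ^ α

theorem norm_sliceAvg_fderiv_le (i : Fin n) {ψ : Euc n → ℝ} (hψ : IsTest ψ) (a : Euc n) {α : ℝ}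
    (hα : α ∈ Ioo (0 : ℝ) 1) : ∃ C : ℝ, 0 ≤ C ∧ ∀ {F : Type} [NormedAddCommGroup F]
      [NormedSpace ℝ F] [CompleteSpace F] {g : Euc n → F} {M : ℝ}, ContDiff ℝ 1 g → 0 ≤ M →
      HalfHolder i α M g → ∀ z τ, 0 ≤ hgt i z → 0 < τ →
      ‖sliceAvg i ψ (fun y => fderiv ℝ g y (horiz i a)) z τ‖ ≤ C * M * τ ^ (α - 1) := by
  refine ⟨2 * ∫ η in Metric.closedBall (0 : Euc n) 1, |fderiv ℝ ψ η a|, by positivity, ?_⟩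
  intro F _ _ _ g M hg hM hH z τ hz hτ
  have h1 := smul_sliceAvg_fderiv i hψ hg a z τ
  have h2 : sliceAvg i (fun η => fderiv ℝ ψ η a) g z τ =
      ∫ η in Metric.closedBall (0 : Euc n) 1,
        fderiv ℝ ψ η a • (g (z - τ • horiz i η) - g z) := by
    have hψ' := hψ.fderiv_apply a
    rw [sliceAvg, hψ'.setIntegral_smul, hψ'.setIntegral_smul]
    simp_rw [smul_sub]
    rw [integral_sub, integral_smul_const, hψ.integral_fderiv, zero_smul, sub_zero]
    · exact hψ'.integrable_smul (f := fun η => g (z - τ • horiz i η))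
        (hg.continuous.comp (by fun_prop))
    · exact hψ'.integrable_smul continuous_const
  have h3 : ‖sliceAvg i (fun η => fderiv ℝ ψ η a) g z τ‖ ≤
      (∫ η in Metric.closedBall (0 : Euc n) 1, |fderiv ℝ ψ η a|) * (M * (2 * τ ^ α)) := by
    rw [h2, ← integral_mul_const]
    refine norm_integral_le_of_norm_le ?_ ?_
    · exact ((hψ.fderiv_apply a).contDiff.continuous.abs.mul
        continuous_const).continuousOn.integrableOn_compact' (isCompact_closedBall _ _)
        measurableSet_closedBall
    · filter_upwards [ae_restrict_mem measurableSet_closedBall] with η hη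
      rw [norm_smul, Real.norm_eq_abs]
      refine mul_le_mul_of_nonneg_left ?_ (abs_nonneg _)
      refine (hH _ _ (by simpa using hz) hz).trans ?_
      refine mul_le_mul_of_nonneg_left ?_ hM
      have hη' : ‖η‖ ≤ 1 := by simpa using hη
      have h4 : ‖z - τ • horiz i η - z‖ ≤ 2 * τ := by
        rw [sub_sub_cancel_left, norm_neg, norm_smul, Real.norm_eq_abs, abs_of_pos hτ]
        nlinarith [norm_horiz_le i η]
      refine (Real.rpow_le_rpow (norm_nonneg _) h4 hα.1.le).trans ?_
      rw [Real.mul_rpow (by norm_num) hτ.le]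
      have h4 : (2 : ℝ) ^ α ≤ 2 := by
        simpa using Real.rpow_le_rpow_of_exponent_le (show (1 : ℝ) ≤ 2 by norm_num) hα.2.le
      have := Real.rpow_nonneg hτ.le α
      gcongr
  rw [← h1, norm_smul, Real.norm_eq_abs, abs_of_pos hτ] at h3
  rw [Real.rpow_sub_one hτ.ne', ← mul_div_assoc, le_div_iff₀ hτ]
  linarith

theorem norm_sliceAvg_fderiv_fderiv_le (i : Fin n) {ψ : Euc n → ℝ} (hψ : IsTest ψ) (a b : Euc n)
    {α : ℝ} (hα : α ∈ Ioo (0 : ℝ) 1) : ∃ C : ℝ, 0 ≤ C ∧ ∀ {F : Type} [NormedAddCommGroup F]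
      [NormedSpace ℝ F] [CompleteSpace F] {g : Euc n → F} {M : ℝ}, ContDiff ℝ 2 g → 0 ≤ M →
      HalfHolder i α M g → ∀ z τ, 0 ≤ hgt i z → 0 < τ →
      ‖sliceAvg i ψ (fun y => fderiv ℝ (fun y => fderiv ℝ g y (horiz i a)) y (horiz i b)) z τ‖ ≤
        C * M * τ ^ (α - 2) := by
  obtain ⟨C, hC, h⟩ := norm_sliceAvg_fderiv_le i (hψ.fderiv_apply b) a hα
  refine ⟨C, hC, fun {F} _ _ _ g M hg hM hH z τ hz hτ => ?_⟩
  have h1 := h (hg.of_le (by norm_num)) hM hH z τ hz hτ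
  have hg1 : ContDiff ℝ 1 fun y => fderiv ℝ g y (horiz i a) :=
    (hg.fderiv_right (m := 1) (by norm_num)).clm_apply contDiff_const
  rw [← smul_sliceAvg_fderiv i hψ hg1, norm_smul, Real.norm_eq_abs, abs_of_pos hτ] at h1
  rw [show α - 2 = α - 1 - 1 by ring, Real.rpow_sub_one hτ.ne' (α - 1), ← mul_div_assoc,
    le_div_iff₀ hτ]
  linarith

theorem hasDerivAt_sliceAvg_line (i : Fin n) {ψ : Euc n → ℝ} (hψ : Continuous ψ) [CompleteSpace F]
    {f : Euc n → F} (hf : ContDiff ℝ 1 f) (z w : Euc n) (hw : hgt i w = 0) (τ κ s : ℝ) :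
    HasDerivAt (fun s => sliceAvg i ψ f (z + s • w) (τ + s * κ))
      (∑ b, (hgt b w • sliceAvg i ψ (fun y => fderiv ℝ f y (horiz i (vert b)))
          (z + s • w) (τ + s * κ) -
        κ • sliceAvg i (fun η => hgt b η * ψ η) (fun y => fderiv ℝ f y (horiz i (vert b)))
          (z + s • w) (τ + s * κ))) s := by
  have hf'c : Continuous (fderiv ℝ f) := hf.continuous_fderiv (by simp)
  have hfc := hf.continuous
  set y : ℝ → Euc n → Euc n := fun s η => z + s • w - (τ + s * κ) • horiz i η with hy
  have hyc : Continuous (Function.uncurry y) := by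
    simp only [hy, Function.uncurry_def]
    fun_prop
  have hyd : ∀ s η, HasDerivAt (fun s => y s η) (w - κ • horiz i η) s := by
    intro s η
    have h1 := ((hasDerivAt_id s).smul_const w).const_add z
    have h2 := (((hasDerivAt_id s).mul_const κ).const_add τ).smul_const (horiz i η)
    simpa using h1.fun_sub h2
  set q' : ℝ → Euc n → ℝ →L[ℝ] F := fun s η =>
    ContinuousLinearMap.toSpanSingleton ℝ (ψ η • fderiv ℝ f (y s η) (w - κ • horiz i η)) with hq'
  have hq'c : Continuous (Function.uncurry q') := by
    simp only [hq', Function.uncurry_def]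
    refine (ContinuousLinearMap.toSpanSingletonCLE (𝕜 := ℝ) (E := F)).continuous.comp ?_
    exact (hψ.comp continuous_snd).smul ((hf'c.comp hyc).clm_apply (by fun_prop))
  have hD := hasFDerivAt_setIntegral_of_continuous (μ := volume)
    (isCompact_closedBall (0 : Euc n) 1) measurableSet_closedBall (q := fun s η => ψ η • f (y s η))
    ((hψ.comp continuous_snd).smul (hfc.comp hyc)) hq'c (fun s η =>
      (((hf.differentiable (by simp) _).hasFDerivAt.comp_hasDerivAt s
        (hyd s η)).const_smul (ψ η)).hasFDerivAt) s
  have hintg : ∀ {G : Type} [NormedAddCommGroup G] {q : Euc n → G}, Continuous q →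
      IntegrableOn q (Metric.closedBall (0 : Euc n) 1) := fun hq =>
    hq.continuousOn.integrableOn_compact' (isCompact_closedBall _ _) measurableSet_closedBall
  refine hD.hasDerivAt.congr_deriv ?_
  have hq's : Continuous (q' s) := hq'c.comp (Continuous.prodMk_right s)
  rw [ContinuousLinearMap.integral_apply (hintg hq's)]
  have hys : Continuous (y s) := hyc.comp (Continuous.prodMk_right s)
  have hc : ∀ {ψ : Euc n → ℝ}, Continuous ψ → ∀ b, Continuous fun η =>
      ψ η • fderiv ℝ f (y s η) (horiz i (vert b)) := fun hψ b =>
    hψ.smul ((hf'c.comp hys).clm_apply continuous_const)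
  have e : ∀ b, (hgt b w • sliceAvg i ψ (fun y => fderiv ℝ f y (horiz i (vert b)))
          (z + s • w) (τ + s * κ) -
        κ • sliceAvg i (fun η => hgt b η * ψ η) (fun y => fderiv ℝ f y (horiz i (vert b)))
          (z + s • w) (τ + s * κ)) = ∫ η in Metric.closedBall (0 : Euc n) 1,
          (hgt b w - κ * hgt b η) • ψ η • fderiv ℝ f (y s η) (horiz i (vert b)) := by
    intro b
    rw [sliceAvg, sliceAvg, ← integral_smul, ← integral_smul, ← integral_sub]
    · congr 1
      ext1 η
      module
    · exact hintg ((hc hψ b).const_smul (hgt b w))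
    · exact hintg ((hc ((hgt b).continuous.mul hψ) b).const_smul κ)
  simp_rw [e]
  rw [← integral_finsetSum]
  · congr 1
    ext1 η
    have h1 : w - κ • horiz i η = ∑ b, (hgt b w - κ * hgt b η) • horiz i (vert b) := by
      simp_rw [← map_smul, ← map_sum, sub_smul, mul_smul, Finset.sum_sub_distrib, ← Finset.smul_sum,
        sum_hgt_smul_vert, map_sub, map_smul]
      rw [horiz_of_hgt_eq_zero hw]
    simp only [hq', ContinuousLinearMap.toSpanSingleton_apply, one_smul, h1, map_sum, map_smul,
      Finset.smul_sum]
    exact Finset.sum_congr rfl fun j _ => smul_comm _ _ _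
  · intro b _
    exact hintg ((continuous_const.sub (continuous_const.mul (hgt b).continuous)).smul (hc hψ b))

theorem norm_sliceAvg_fderiv_sub_le (i : Fin n) {ψ : Euc n → ℝ} (hψ : IsTest ψ) (a : Euc n)
    {α : ℝ} (hα : α ∈ Ioo (0 : ℝ) 1) : ∃ C : ℝ, 0 ≤ C ∧ ∀ {F : Type} [NormedAddCommGroup F]
      [NormedSpace ℝ F] [CompleteSpace F] {g : Euc n → F} {M : ℝ}, ContDiff ℝ 2 g → 0 ≤ M →
      HalfHolder i α M g → ∀ z z' τ τ' r, 0 ≤ hgt i z → hgt i z' = hgt i z → 0 < r → r ≤ τ →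
      r ≤ τ' → ‖sliceAvg i ψ (fun y => fderiv ℝ g y (horiz i a)) z τ -
        sliceAvg i ψ (fun y => fderiv ℝ g y (horiz i a)) z' τ'‖ ≤
        C * M * (‖z - z'‖ + |τ - τ'|) * r ^ (α - 2) := by
  choose C₁ hC₁ h₁ using fun b => norm_sliceAvg_fderiv_fderiv_le i hψ a (vert b) hα
  choose C₂ hC₂ h₂ using fun b => norm_sliceAvg_fderiv_fderiv_le i (hψ.coord_mul b) a (vert b) hα
  refine ⟨∑ b, (C₁ b + C₂ b), Finset.sum_nonneg fun b _ => add_nonneg (hC₁ b) (hC₂ b), ?_⟩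
  intro F _ _ _ g M hg hM hH z z' τ τ' r hz hz' hr hτ hτ'
  have hg1 : ContDiff ℝ 1 fun y => fderiv ℝ g y (horiz i a) :=
    (hg.fderiv_right (m := 1) (by norm_num)).clm_apply contDiff_const
  have hw : hgt i (z - z') = 0 := by simp [hz']
  have hd := hasDerivAt_sliceAvg_line i hψ.contDiff.continuous hg1 z' (z - z') hw τ' (τ - τ')
  have key := norm_image_sub_le_of_norm_deriv_le_segment_01'
    (C := (∑ b, (C₁ b + C₂ b)) * M * (‖z - z'‖ + |τ - τ'|) * r ^ (α - 2))
    (fun s _ => (hd s).hasDerivWithinAt) ?_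
  · simpa using key
  · intro s hs
    have hzs : 0 ≤ hgt i (z' + s • (z - z')) := by
      simp [hz', hz]
    have hτs : r ≤ τ' + s * (τ - τ') := by nlinarith [hs.1, hs.2.le]
    have hτs0 := hr.trans_le hτs
    have hpow : (τ' + s * (τ - τ')) ^ (α - 2) ≤ r ^ (α - 2) :=
      Real.rpow_le_rpow_of_nonpos hr hτs (by linarith [hα.2])
    rw [Finset.sum_mul, Finset.sum_mul, Finset.sum_mul]
    refine norm_sum_le_of_le _ fun b _ => (norm_sub_le _ _).trans ?_
    rw [norm_smul, norm_smul, Real.norm_eq_abs, Real.norm_eq_abs]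
    have e1 := (h₁ b hg hM hH _ _ hzs hτs0).trans
      (mul_le_mul_of_nonneg_left hpow (mul_nonneg (hC₁ b) hM))
    have e2 := (h₂ b hg hM hH _ _ hzs hτs0).trans
      (mul_le_mul_of_nonneg_left hpow (mul_nonneg (hC₂ b) hM))
    have e3 := abs_hgt_le b (z - z')
    have hr0 : 0 ≤ r ^ (α - 2) := Real.rpow_nonneg hr.le _
    have hCM₁ := mul_nonneg (mul_nonneg (hC₁ b) hM) hr0
    have hCM₂ := mul_nonneg (mul_nonneg (hC₂ b) hM) hr0
    have e4 := mul_le_mul e3 e1 (norm_nonneg _) (norm_nonneg _)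
    have e5 := mul_le_mul_of_nonneg_left e2 (abs_nonneg (τ - τ'))
    have e6 := mul_nonneg (abs_nonneg (τ - τ')) hCM₁
    have e7 := mul_nonneg (norm_nonneg (z - z')) hCM₂
    linarith

end SliceAverage

section Gain

theorem HolderBound.zero_of_convex {E F : Type} [NormedAddCommGroup E] [NormedSpace ℝ E]
    [NormedAddCommGroup F] [NormedSpace ℝ F] {α M N : ℝ} (hα : α ∈ Ioo (0 : ℝ) 1) {A : Set E}
    (hA : Convex ℝ A) {u : E → F} (hu : Differentiable ℝ u) (hM : 0 ≤ M) (hN : 0 ≤ N)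
    (h0 : ∀ x ∈ A, ‖u x‖ ≤ M) (h1 : ∀ x ∈ A, ‖fderiv ℝ u x‖ ≤ N) :
    HolderBound 0 α (2 * M + N) A u := by
  refine holderBound_zero_iff.2 ⟨fun x hx => (h0 x hx).trans (by linarith), fun x hx y hy => ?_⟩
  rcases le_total ‖x - y‖ 1 with hxy | hxy
  · have h2 := hA.norm_image_sub_le_of_norm_fderiv_le (fun z _ => hu z) h1 hy hx
    have h3 := HolderBound.lipschitz_le_rpow hα hN (norm_nonneg (x - y)) hxy h2
    rw [Real.one_rpow, mul_one] at h3
    refine h3.trans ?_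
    gcongr
    linarith
  · have h2 : 1 ≤ ‖x - y‖ ^ α := Real.one_le_rpow hxy hα.1.le
    have h3 := norm_sub_le (u x) (u y)
    have h4 := h0 x hx
    have h5 := h0 y hy
    nlinarith

variable {n : ℕ}

/-- A horizontal slab above the hyperplane. -/
def slab (i : Fin n) (L : ℝ) : Set (Euc n) := {x | 0 ≤ hgt i x ∧ hgt i x ≤ L}

theorem convex_slab (i : Fin n) (L : ℝ) : Convex ℝ (slab i L) :=
  (convex_Icc (0 : ℝ) L).linear_preimage (hgt i).toLinearMap

/-- The closed upper half space. -/
def upperHalf (i : Fin n) : Set (Euc n) := {x | 0 ≤ hgt i x}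

theorem HolderBound.halfHolder {F : Type} [NormedAddCommGroup F] [NormedSpace ℝ F] {k : ℕ}
    {i : Fin n} {α M : ℝ} {g : Euc n → F} (h : HolderBound k α M (upperHalf i) g) :
    HalfHolder i α M g := fun x y hx hy =>
  (holderBound_zero_iff.1 (h.of_le (Nat.zero_le k))).2 x hx y hy

theorem coneTan_eq_integral {F : Type} [NormedAddCommGroup F] [NormedSpace ℝ F]
    (i : Fin n) {ψ : Euc n → ℝ} (hψ : Continuous ψ) (j : Fin n) {g : Euc n → F}
    (hg : ContDiff ℝ 1 g) (x : Euc n) :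
    coneTan i ψ j g x = ∫ s in (0 : ℝ)..hgt i x,
      sliceAvg i ψ (fun y => fderiv ℝ g y (horiz i (vert j))) (x - (hgt i x - s) • vert i)
        (hgt i x - s) := by
  have hc : Continuous fun y => fderiv ℝ g y (horiz i (vert j)) :=
    (hg.continuous_fderiv (by simp)).clm_apply continuous_const
  rw [coneTan_eq i hψ j hg, conePrim, setIntegral_conePar (continuous_conePrim_integrand i hψ hc x)]
  have := intervalIntegral.smul_integral_comp_mul_right (a := 0) (b := 1) (fun s =>
    sliceAvg i ψ (fun y => fderiv ℝ g y (horiz i (vert j))) (x - s • vert i) s) (hgt i x)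
  rw [intervalIntegral.integral_comp_sub_left (fun s => sliceAvg i ψ
    (fun y => fderiv ℝ g y (horiz i (vert j))) (x - s • vert i) s), sub_self, sub_zero]
  rw [zero_mul, one_mul] at this
  rw [← this]
  simp only [sliceAvg, coneDir, smul_add, sub_sub]

theorem holderBound_zero_coneTan (i : Fin n) {α : ℝ} (hα : α ∈ Ioo (0 : ℝ) 1) {L : ℝ} (hL : 0 ≤ L)
    {ψ : Euc n → ℝ} (hψ : IsTest ψ) (j : Fin n) : ∃ C : ℝ, 0 ≤ C ∧
    ∀ {F : Type} [NormedAddCommGroup F] [NormedSpace ℝ F] [CompleteSpace F] {g : Euc n → F} {M : ℝ},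
      ContDiff ℝ 2 g → 0 ≤ M → HalfHolder i α M g →
      HolderBound 0 α (C * M) (slab i L) (coneTan i ψ j g) := by
  obtain ⟨C₁, hC₁, h₁⟩ := norm_sliceAvg_fderiv_le i hψ (vert j) hα
  obtain ⟨C₂, hC₂, h₂⟩ := norm_sliceAvg_fderiv_sub_le i hψ (vert j) hα
  have hα0 := hα.1
  have hα1 : 0 < 1 - α := by linarith [hα.2]
  have hLα : 0 ≤ L ^ α := Real.rpow_nonneg hL α
  refine ⟨C₁ * L ^ α / α + (C₁ + 3 * C₂) * (1 / (1 - α) + 3 / α), by positivity, ?_⟩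
  intro F _ _ _ g M hg hM hH
  have hg1 : ContDiff ℝ 1 g := hg.of_le (by norm_num)
  have hc : Continuous fun y => fderiv ℝ g y (horiz i (vert j)) :=
    (hg1.continuous_fderiv (by simp)).clm_apply continuous_const
  have hpc : ∀ x, Continuous fun s => sliceAvg i ψ (fun y => fderiv ℝ g y (horiz i (vert j)))
      (x - (hgt i x - s) • vert i) (hgt i x - s) := fun x =>
    (sliceAvg_continuous i hψ.contDiff.continuous hc).comp
      (f := fun s : ℝ => (x - (hgt i x - s) • vert i, hgt i x - s)) (by fun_prop)
  have hp : ∀ x, ∀ s ∈ Ico 0 (hgt i x), ‖sliceAvg i ψ (fun y => fderiv ℝ g y (horiz i (vert j)))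
      (x - (hgt i x - s) • vert i) (hgt i x - s)‖ ≤ C₁ * M * (hgt i x - s) ^ (α - 1) :=
    fun x s hs => h₁ hg1 hM hH _ _ (by simpa using hs.1) (by linarith [hs.2])
  have hmain : ∀ x ∈ slab i L, ∀ y ∈ slab i L, hgt i x ≤ hgt i y → x ≠ y →
      ‖coneTan i ψ j g x - coneTan i ψ j g y‖ ≤
        (C₁ + 3 * C₂) * M * (1 / (1 - α) + 3 / α) * ‖x - y‖ ^ α := by
    intro x hx y hy hxy hne
    rw [coneTan_eq_integral i hψ.contDiff.continuous j hg1,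
      coneTan_eq_integral i hψ.contDiff.continuous j hg1]
    have hd : 0 < ‖x - y‖ := norm_pos_iff.2 (sub_ne_zero.2 hne)
    have hxy' : |hgt i x - hgt i y| ≤ ‖x - y‖ := by simpa using abs_hgt_le i (x - y)
    refine norm_integral_sub_integral_le hα (by positivity) hd hx.1 hxy
      ((neg_sub (hgt i x) (hgt i y) ▸ neg_le_abs _).trans hxy') (hpc x) (hpc y)
      (fun s hs => (hp x s hs).trans ?_) (fun s hs => (hp y s hs).trans ?_) fun s hs => ?_
    · have := Real.rpow_nonneg (show 0 ≤ hgt i x - s by linarith [hs.2]) (α - 1)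
      gcongr
      linarith
    · have := Real.rpow_nonneg (show 0 ≤ hgt i y - s by linarith [hs.2]) (α - 1)
      gcongr
      linarith
    · have hr : 0 < hgt i x - s := by linarith [hs.2]
      refine (h₂ hg hM hH _ _ _ _ (hgt i x - s) (by simpa using hs.1) (by simp) hr le_rfl
        (by linarith)).trans ?_
      have h3 : x - (hgt i x - s) • vert i - (y - (hgt i y - s) • vert i) = horiz i (x - y) := by
        rw [horiz_apply, map_sub]
        module
      have h4 := norm_horiz_le i (x - y)
      have h5 : |hgt i x - s - (hgt i y - s)| ≤ ‖x - y‖ := by simpa using hxy'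
      rw [h3]
      have h6 := Real.rpow_nonneg hr.le (α - 2)
      have h7 : C₂ * M * (‖horiz i (x - y)‖ + |hgt i x - s - (hgt i y - s)|) ≤
          (C₁ + 3 * C₂) * M * ‖x - y‖ := by
        calc _ ≤ C₂ * M * (2 * ‖x - y‖ + ‖x - y‖) := by gcongr
          _ ≤ C₂ * M * (2 * ‖x - y‖ + ‖x - y‖) + C₁ * M * ‖x - y‖ := by
            have : 0 ≤ C₁ * M * ‖x - y‖ := by positivity
            linarith
          _ = _ := by ring
      exact mul_le_mul_of_nonneg_right h7 h6
  refine holderBound_zero_iff.2 ⟨fun x hx => ?_, fun x hx y hy => ?_⟩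
  · rw [coneTan_eq_integral i hψ.contDiff.continuous j hg1]
    refine (norm_integral_le_rpow hα hx.1 (hp x)).trans ?_
    rw [sub_zero]
    have h1 := Real.rpow_le_rpow hx.1 hx.2 hα0.le
    have h2 : 0 ≤ (C₁ + 3 * C₂) * (1 / (1 - α) + 3 / α) * M := by positivity
    calc C₁ * M * hgt i x ^ α / α ≤ C₁ * M * L ^ α / α := by gcongr
      _ ≤ C₁ * M * L ^ α / α + (C₁ + 3 * C₂) * (1 / (1 - α) + 3 / α) * M := by linarith
      _ = _ := by ring
  · rcases eq_or_ne x y with rfl | hne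
    · rw [sub_self, norm_zero]
      positivity
    · have h1 : ‖coneTan i ψ j g x - coneTan i ψ j g y‖ ≤
          (C₁ + 3 * C₂) * M * (1 / (1 - α) + 3 / α) * ‖x - y‖ ^ α := by
        rcases le_total (hgt i x) (hgt i y) with h | h
        · exact hmain x hx y hy h hne
        · rw [norm_sub_rev, norm_sub_rev x]
          exact hmain y hy x hx h hne.symm
      refine h1.trans ?_
      have h2 : 0 ≤ ‖x - y‖ ^ α := Real.rpow_nonneg (norm_nonneg _) α
      refine mul_le_mul_of_nonneg_right ?_ h2
      have h3 : 0 ≤ C₁ * L ^ α / α * M := by positivity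
      linarith

theorem HolderBound.smulRight_const {E F : Type} [NormedAddCommGroup E] [NormedSpace ℝ E]
    [NormedAddCommGroup F] [NormedSpace ℝ F] {k : ℕ} {α M : ℝ} {A : Set E} {u : E → F}
    (f : E →L[ℝ] ℝ) (hf : ‖f‖ ≤ 1) (hM : 0 ≤ M) (hu : ContDiff ℝ k u)
    (h : HolderBound k α M A u) :
    HolderBound k α M A fun x => (f.smulRight (u x) : E →L[ℝ] F) := by
  refine (h.clm_comp (ContinuousLinearMap.smulRightL ℝ E F f) hu).mono_const ?_
  refine mul_le_of_le_one_left hM (ContinuousLinearMap.opNorm_le_bound _ zero_le_one fun v => ?_)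
  change ‖f.smulRight v‖ ≤ _
  rw [ContinuousLinearMap.norm_smulRight_apply]
  gcongr

theorem norm_hgt_le (i : Fin n) : ‖hgt i‖ ≤ 1 :=
  ContinuousLinearMap.opNorm_le_bound _ zero_le_one fun x => by
    rw [one_mul]
    exact abs_hgt_le i x

theorem norm_conePrim_le {F : Type} [NormedAddCommGroup F] [NormedSpace ℝ F] (i : Fin n)
    {ψ : Euc n → ℝ} (hψ : Continuous ψ) {g : Euc n → F} {M : ℝ}
    (hg : ∀ x ∈ upperHalf i, ‖g x‖ ≤ M) {x : Euc n} (hx : 0 ≤ hgt i x) :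
    ‖conePrim i ψ g x‖ ≤ hgt i x * ((∫ p in conePar n, |ψ p.2|) * M) := by
  rw [conePrim, norm_smul, Real.norm_eq_abs, abs_of_nonneg hx]
  refine mul_le_mul_of_nonneg_left ?_ hx
  rw [← integral_mul_const]
  refine norm_integral_le_of_norm_le ?_ ?_
  · exact integrableOn_conePar (q := fun p => |ψ p.2| * M) (by fun_prop)
  · filter_upwards [ae_restrict_mem measurableSet_conePar] with p hp
    rw [norm_smul, Real.norm_eq_abs]
    refine mul_le_mul_of_nonneg_left (hg _ ?_) (abs_nonneg _)
    simp only [upperHalf, mem_ofPred_eq, map_sub, map_smul, coneDir, map_add, hgt_vert, hgt_horiz,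
      smul_eq_mul, add_zero, mul_one]
    nlinarith [hp.1.2]

theorem holderBound_conePrim_of_coneTan (i : Fin n) {α : ℝ} (hα : α ∈ Ioo (0 : ℝ) 1) {L : ℝ}
    (hL : 0 ≤ L) (k : ℕ) (htan : ∀ {ψ : Euc n → ℝ}, IsTest ψ → ∀ j, ∃ C : ℝ, 0 ≤ C ∧
      ∀ {F : Type} [NormedAddCommGroup F] [NormedSpace ℝ F] [CompleteSpace F] {g : Euc n → F}
      {M : ℝ}, ContDiff ℝ ∞ g → 0 ≤ M → HolderBound k α M (upperHalf i) g →
      HolderBound k α (C * M) (slab i L) (coneTan i ψ j g))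
    {ψ : Euc n → ℝ} (hψ : IsTest ψ) : ∃ C : ℝ, 0 ≤ C ∧
    ∀ {F : Type} [NormedAddCommGroup F] [NormedSpace ℝ F] [CompleteSpace F] {g : Euc n → F} {M : ℝ},
      ContDiff ℝ ∞ g → 0 ≤ M → HolderBound k α M (upperHalf i) g →
      HolderBound (k + 1) α (C * M) (slab i L) (conePrim i ψ g) := by
  choose C₁ hC₁ h₁ using fun j => htan hψ j
  choose C₂ hC₂ h₂ using fun j => htan (hψ.coord_mul j) j
  set c := |∫ η in Metric.closedBall (0 : Euc n) 1, ψ η| with hc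
  set D := c + ∑ j, (C₁ j + C₂ j) with hD
  have hD0 : 0 ≤ D :=
    add_nonneg (abs_nonneg _) (Finset.sum_nonneg fun j _ => add_nonneg (hC₁ j) (hC₂ j))
  set I := ∫ p in conePar n, |ψ p.2| with hI
  have hI0 : 0 ≤ I := by positivity
  refine ⟨2 * (L * I) + D, by positivity, fun {F} _ _ _ g M hg hM h => ?_⟩
  have hψc := hψ.contDiff.continuous
  have hg1 : ContDiff ℝ 1 g := hg.of_le (by simp)
  have hgk : ContDiff ℝ k g := hg.of_le (by exact_mod_cast le_top)
  have htk : ∀ {ψ : Euc n → ℝ}, IsTest ψ → ∀ j, ContDiff ℝ k (coneTan i ψ j g) := fun hψ j =>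
    (contDiff_conePrim i k hψ (hg.fderiv_right (by simp))).clm_apply contDiff_const
  have hsub : slab i L ⊆ upperHalf i := fun x hx => hx.1
  have hder : HolderBound k α (D * M) (slab i L) (fderiv ℝ (conePrim i ψ g)) := by
    rw [fderiv_conePrim i hψc hg1]
    have e1 : HolderBound k α (c * M) (slab i L) fun x =>
        (hgt i).smulRight ((∫ η in Metric.closedBall (0 : Euc n) 1, ψ η) • g x) := by
      refine HolderBound.smulRight_const _ (norm_hgt_le i) (by positivity) (hgk.const_smul _) ?_
      refine ((h.mono_set hsub).clm_comp ((∫ η in Metric.closedBall (0 : Euc n) 1, ψ η) •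
        ContinuousLinearMap.id ℝ F) hgk).mono_const ?_
      refine mul_le_mul_of_nonneg_right ?_ hM
      rw [norm_smul, Real.norm_eq_abs]
      exact mul_le_of_le_one_right (abs_nonneg _) ContinuousLinearMap.norm_id_le
    have e2 : ∀ j, HolderBound k α ((C₁ j + C₂ j) * M) (slab i L) fun x =>
        ((hgt j).smulRight (coneTan i ψ j g x) -
          (hgt i).smulRight (coneTan i (fun η => hgt j η * ψ η) j g x)) := by
      intro j
      have a1 := HolderBound.smulRight_const _ (norm_hgt_le j) (mul_nonneg (hC₁ j) hM) (htk hψ j)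
        (h₁ j hg hM h)
      have a2 := HolderBound.smulRight_const _ (norm_hgt_le i) (mul_nonneg (hC₂ j) hM)
        (htk (hψ.coord_mul j) j) (h₂ j hg hM h)
      have c2 := ContDiff.smulRight_const (hgt i) (htk (hψ.coord_mul j) j)
      have a3 := (a2.clm_comp (-ContinuousLinearMap.id ℝ _) c2).mono_const
        (mul_le_of_le_one_left (mul_nonneg (hC₂ j) hM)
          ((norm_neg _).trans_le ContinuousLinearMap.norm_id_le))
      have a4 := a1.add (ContDiff.smulRight_const (hgt j) (htk hψ j)) (by simpa using c2.neg) a3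
      rw [add_mul]
      simpa [sub_eq_add_neg] using a4
    have e3 := HolderBound.sum Finset.univ (fun j _ => (ContDiff.smulRight_const (hgt j)
      (htk hψ j)).sub (ContDiff.smulRight_const (hgt i) (htk (hψ.coord_mul j) j)))
      (fun j _ => e2 j)
    have e4 := e1.add (ContDiff.smulRight_const _ (hgk.const_smul _))
      (ContDiff.sum fun j _ => (ContDiff.smulRight_const (hgt j)
      (htk hψ j)).sub (ContDiff.smulRight_const (hgt i) (htk (hψ.coord_mul j) j))) e3
    rw [hD, add_mul, Finset.sum_mul]
    exact e4
  have hgb : ∀ x ∈ upperHalf i, ‖g x‖ ≤ M :=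
    (holderBound_zero_iff.1 (h.of_le (Nat.zero_le k))).1
  refine holderBound_succ_iff.2 ⟨?_, hder.mono_const ?_⟩
  · have h0 : HolderBound 0 α (2 * (L * (I * M)) + D * M) (slab i L) (conePrim i ψ g) := by
      refine HolderBound.zero_of_convex hα (convex_slab i L)
        (fun x => (hasFDerivAt_conePrim i hψc hg1 x).differentiableAt) (by positivity)
        (by positivity) (fun x hx => ?_)
        (holderBound_zero_iff.1 (hder.of_le (Nat.zero_le k))).1
      exact (norm_conePrim_le i hψc hgb hx.1).trans
        (mul_le_mul_of_nonneg_right hx.2 (by positivity))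
    exact h0.mono_const (by linarith)
  · have : 0 ≤ 2 * (L * I) * M := by positivity
    linarith

theorem holderBound_coneTan (i : Fin n) {α : ℝ} (hα : α ∈ Ioo (0 : ℝ) 1) {L : ℝ}
    (hL : 0 ≤ L) (k : ℕ) : ∀ {ψ : Euc n → ℝ}, IsTest ψ → ∀ j, ∃ C : ℝ, 0 ≤ C ∧
      ∀ {F : Type} [NormedAddCommGroup F] [NormedSpace ℝ F] [CompleteSpace F] {g : Euc n → F}
      {M : ℝ}, ContDiff ℝ ∞ g → 0 ≤ M → HolderBound k α M (upperHalf i) g →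
      HolderBound k α (C * M) (slab i L) (coneTan i ψ j g) := by
  induction k with
  | zero =>
    intro ψ hψ j
    obtain ⟨C, hC, h⟩ := holderBound_zero_coneTan i hα hL hψ j
    exact ⟨C, hC, fun hg hM hb => h (mod_cast contDiff_infty.1 hg 2) hM hb.halfHolder⟩
  | succ k ih =>
    intro ψ hψ j
    obtain ⟨C, hC, h⟩ := holderBound_conePrim_of_coneTan i hα hL k (fun hψ j => ih hψ j) hψ
    refine ⟨2 * C, by positivity, fun {F} _ _ _ g M hg hM hb => ?_⟩
    have hg' : ContDiff ℝ ∞ (fderiv ℝ g) := hg.fderiv_right (by simp)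
    have h1 := h hg' hM (holderBound_succ_iff.1 hb).2
    have h2 := h1.clm_comp (ContinuousLinearMap.apply ℝ F (horiz i (vert j)))
      (contDiff_conePrim i (k + 1) hψ hg')
    refine h2.mono_const ?_
    rw [mul_assoc]
    refine mul_le_mul_of_nonneg_right ?_ (by positivity)
    refine ContinuousLinearMap.opNorm_le_bound _ (by norm_num) fun T => ?_
    rw [ContinuousLinearMap.apply_apply, mul_comm]
    refine (T.le_opNorm _).trans (mul_le_mul_of_nonneg_left ?_ (norm_nonneg _))
    refine (norm_horiz_le i _).trans ?_
    rw [norm_vert, mul_one]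

/-- The averaged primitive gains one derivative in Hölder spaces, up to the hyperplane. -/
theorem holderBound_conePrim (i : Fin n) {α : ℝ} (hα : α ∈ Ioo (0 : ℝ) 1) {L : ℝ} (hL : 0 ≤ L)
    (k : ℕ) {ψ : Euc n → ℝ} (hψ : IsTest ψ) : ∃ C : ℝ, 0 ≤ C ∧
    ∀ {F : Type} [NormedAddCommGroup F] [NormedSpace ℝ F] [CompleteSpace F] {g : Euc n → F} {M : ℝ},
      ContDiff ℝ ∞ g → 0 ≤ M → HolderBound k α M (upperHalf i) g →
      HolderBound (k + 1) α (C * M) (slab i L) (conePrim i ψ g) :=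
  holderBound_conePrim_of_coneTan i hα hL k (holderBound_coneTan i hα hL k) hψ

end Gain

section ConeField

variable {n : ℕ}

/-- The vector field assembled from averaged primitives; its divergence recovers `g`. -/
def coneField (i : Fin n) (ψ : Euc n → ℝ) (g : Euc n → ℝ) (x : Euc n) : Euc n :=
  conePrim i ψ g x • vert i + ∑ j, conePrim i (fun η => hgt j η * ψ η) g x • horiz i (vert j)

theorem contDiff_coneField (i : Fin n) {ψ : Euc n → ℝ} (hψ : IsTest ψ) {g : Euc n → ℝ}
    (hg : ContDiff ℝ ∞ g) : ContDiff ℝ ∞ (coneField i ψ g) := by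
  refine contDiff_infty.2 fun k => ?_
  exact ((contDiff_conePrim i k hψ hg).smul contDiff_const).add
    (ContDiff.sum fun j _ => (contDiff_conePrim i k (hψ.coord_mul j) hg).smul contDiff_const)

theorem coneDeriv_apply_of_hgt_eq_zero (i : Fin n) (ψ : Euc n → ℝ) (g : Euc n → ℝ) (x : Euc n)
    {v : Euc n} (hv : hgt i v = 0) :
    coneDeriv i ψ g x v = conePrim i ψ (fderiv ℝ g) x v := by
  simp only [coneDeriv, add_apply, ContinuousLinearMap.smulRight_apply, hv, sum_apply, zero_smul,
    sub_apply, sub_zero, zero_add, coneTan]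
  simp_rw [← map_smul, ← map_sum, sum_hgt_smul_vert]
  rw [horiz_of_hgt_eq_zero hv]

theorem coneDeriv_apply_vert (i : Fin n) (ψ : Euc n → ℝ) (g : Euc n → ℝ) (x : Euc n) :
    coneDeriv i ψ g x (vert i) = (∫ η in Metric.closedBall (0 : Euc n) 1, ψ η) * g x -
      ∑ j, coneTan i (fun η => hgt j η * ψ η) j g x := by
  have h : ∑ j, hgt j (vert i) • coneTan i ψ j g x = 0 := by
    simp only [coneTan]
    simp_rw [← map_smul, ← map_sum, sum_hgt_smul_vert, horiz_vert, map_zero]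
  simp only [coneDeriv, add_apply, ContinuousLinearMap.smulRight_apply, hgt_vert, sum_apply,
    sub_apply, Finset.sum_sub_distrib, h, one_smul]
  simp [sub_eq_add_neg]

theorem diver_coneField (i : Fin n) {ψ : Euc n → ℝ} (hψ : IsTest ψ) {g : Euc n → ℝ}
    (hg : ContDiff ℝ ∞ g) (x : Euc n) :
    diver (coneField i ψ g) x = (∫ η in Metric.closedBall (0 : Euc n) 1, ψ η) * g x := by
  have hg1 : ContDiff ℝ 1 g := hg.of_le (by simp)
  have h1 := (hasFDerivAt_conePrim i hψ.contDiff.continuous hg1 x).smul_const (vert i)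
  have h2 : ∀ j ∈ Finset.univ, HasFDerivAt (fun x => conePrim i (fun η => hgt j η * ψ η) g x •
      horiz i (vert j)) ((coneDeriv i (fun η => hgt j η * ψ η) g x).smulRight
      (horiz i (vert j))) x := fun j _ =>
    (hasFDerivAt_conePrim i (hψ.coord_mul j).contDiff.continuous hg1 x).smul_const _
  have h3 : HasFDerivAt (coneField i ψ g) _ x := h1.fun_add (HasFDerivAt.fun_sum h2)
  rw [diver_eq_traceCLM, h3.fderiv, map_add, map_sum, traceCLM_smulRight, coneDeriv_apply_vert]
  simp_rw [traceCLM_smulRight, coneDeriv_apply_of_hgt_eq_zero i _ g x (hgt_horiz i _), coneTan]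
  ring

theorem conePrim_sub (i : Fin n) {ψ : Euc n → ℝ} (hψ : Continuous ψ) {g h : Euc n → ℝ}
    (hg : Continuous g) (hh : Continuous h) (x : Euc n) :
    conePrim i ψ (fun y => g y - h y) x = conePrim i ψ g x - conePrim i ψ h x := by
  rw [conePrim, conePrim, conePrim, ← smul_sub, ← integral_sub]
  · simp only [smul_sub]
  · exact integrableOn_conePar (continuous_conePrim_integrand i hψ hg x)
  · exact integrableOn_conePar (continuous_conePrim_integrand i hψ hh x)

theorem coneField_sub (i : Fin n) {ψ : Euc n → ℝ} (hψ : Continuous ψ) {g h : Euc n → ℝ}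
    (hg : Continuous g) (hh : Continuous h) (x : Euc n) :
    coneField i ψ (fun y => g y - h y) x = coneField i ψ g x - coneField i ψ h x := by
  have hψj : ∀ j, Continuous fun η => hgt j η * ψ η := fun j => (hgt j).continuous.mul hψ
  simp only [coneField]
  rw [conePrim_sub i hψ hg hh]
  simp_rw [conePrim_sub i (hψj _) hg hh, sub_smul, Finset.sum_sub_distrib]
  abel

theorem norm_coneField_le (i : Fin n) {ψ : Euc n → ℝ} (hψ : Continuous ψ) : ∃ C : ℝ, 0 ≤ C ∧
    ∀ {g : Euc n → ℝ} {M : ℝ}, (∀ x ∈ upperHalf i, ‖g x‖ ≤ M) → ∀ x, 0 ≤ hgt i x →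
    ‖coneField i ψ g x‖ ≤ C * M * hgt i x := by
  have hψj : ∀ j, Continuous fun η => hgt j η * ψ η := fun j => (hgt j).continuous.mul hψ
  refine ⟨(∫ p in conePar n, |ψ p.2|) + ∑ j, (∫ p in conePar n, |hgt j p.2 * ψ p.2|) * 2,
    add_nonneg (by positivity) (Finset.sum_nonneg fun j _ => by positivity), ?_⟩
  intro g M hg x hx
  have h1 : ∀ j, ‖conePrim i (fun η => hgt j η * ψ η) g x • horiz i (vert j)‖ ≤
      (∫ p in conePar n, |hgt j p.2 * ψ p.2|) * 2 * M * hgt i x := by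
    intro j
    have h2 := norm_conePrim_le i (hψj j) hg hx
    have h3 : ‖horiz i (vert j)‖ ≤ 2 := by simpa [norm_vert] using norm_horiz_le i (vert j)
    rw [norm_smul]
    have := mul_le_mul h2 h3 (norm_nonneg _) ((norm_nonneg _).trans h2)
    linarith
  refine (norm_add_le _ _).trans ?_
  have h0 := norm_conePrim_le i hψ hg hx
  rw [norm_smul, norm_vert, mul_one, add_mul, add_mul, Finset.sum_mul, Finset.sum_mul]
  exact add_le_add (by linarith) (norm_sum_le_of_le _ fun j _ => h1 j)

theorem coneField_ne_zero (i : Fin n) (ψ : Euc n → ℝ) {g : Euc n → ℝ} {x : Euc n}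
    (h : coneField i ψ g x ≠ 0) : ∃ p ∈ conePar n, g (x - (p.1 * hgt i x) • coneDir i p.2) ≠ 0 := by
  by_contra! hcon
  refine h ?_
  have h0 : ∀ ψ : Euc n → ℝ, conePrim i ψ g x = 0 := fun ψ => by
    rw [conePrim, setIntegral_eq_zero_of_forall_eq_zero, smul_zero]
    intro p hp
    rw [hcon p hp, smul_zero]
  simp [coneField, h0]

theorem holderBound_coneField (i : Fin n) {α : ℝ} (hα : α ∈ Ioo (0 : ℝ) 1) {L : ℝ} (hL : 0 ≤ L)
    (k : ℕ) {ψ : Euc n → ℝ} (hψ : IsTest ψ) : ∃ C : ℝ, 0 ≤ C ∧ ∀ {g : Euc n → ℝ} {M : ℝ},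
      ContDiff ℝ ∞ g → 0 ≤ M → HolderBound k α M (upperHalf i) g →
      HolderBound (k + 1) α (C * M) (slab i L) (coneField i ψ g) := by
  obtain ⟨C₀, hC₀, h₀⟩ := holderBound_conePrim i hα hL k hψ
  choose C hC h using fun j => holderBound_conePrim i hα hL k (hψ.coord_mul j)
  set N : Euc n → ℝ := fun v => ‖ContinuousLinearMap.toSpanSingleton ℝ v‖
  refine ⟨N (vert i) * C₀ + ∑ j, N (horiz i (vert j)) * C j, add_nonneg (by positivity)
    (Finset.sum_nonneg fun j _ => mul_nonneg (norm_nonneg _) (hC j)), fun {g M} hg hM hb => ?_⟩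
  have e0 := (h₀ hg hM hb).clm_comp (ContinuousLinearMap.toSpanSingleton ℝ (vert i))
    (contDiff_conePrim i (k + 1) hψ hg)
  have e1 := fun j => (h j hg hM hb).clm_comp
    (ContinuousLinearMap.toSpanSingleton ℝ (horiz i (vert j)))
    (contDiff_conePrim i (k + 1) (hψ.coord_mul j) hg)
  have c1 := fun j => (ContinuousLinearMap.toSpanSingleton ℝ (horiz i (vert j))).contDiff.comp
    (contDiff_conePrim i (k + 1) (hψ.coord_mul j) hg)
  have e2 := HolderBound.sum Finset.univ (fun j _ => c1 j) fun j _ => e1 j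
  have e3 := e0.add ((ContinuousLinearMap.toSpanSingleton ℝ (vert i)).contDiff.comp
    (contDiff_conePrim i (k + 1) hψ hg)) (ContDiff.sum fun j _ => c1 j) e2
  rw [add_mul, Finset.sum_mul, mul_assoc]
  simp_rw [mul_assoc]
  exact e3

end ConeField

section Reflection

variable {n : ℕ} {F : Type} [NormedAddCommGroup F] [NormedSpace ℝ F]

/-- The restriction of `w` to the open lower half space, extended by zero. -/
def lowerPart (i : Fin n) (w : Euc n → F) (x : Euc n) : F :=
  if hgt i x < 0 then w x else 0

theorem hasFDerivAt_lowerPart (i : Fin n) {w : Euc n → F} (hw : Differentiable ℝ w)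
    (h0 : ∀ x, hgt i x = 0 → w x = 0) (h1 : ∀ x, hgt i x = 0 → fderiv ℝ w x = 0) (x : Euc n) :
    HasFDerivAt (lowerPart i w) (lowerPart i (fderiv ℝ w) x) x := by
  rcases lt_trichotomy (hgt i x) 0 with hx | hx | hx
  · have e : lowerPart i w =ᶠ[𝓝 x] w := by
      filter_upwards [(hgt i).continuous.continuousAt.eventually_lt_const hx] with y hy
      simp [lowerPart, hy]
    have e' : lowerPart i (fderiv ℝ w) x = fderiv ℝ w x := by simp [lowerPart, hx]
    rw [e']
    exact (hw x).hasFDerivAt.congr_of_eventuallyEq e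
  · have e' : lowerPart i (fderiv ℝ w) x = 0 := by simp [lowerPart, hx]
    have h2 := (hw x).hasFDerivAt
    rw [h1 x hx, hasFDerivAt_iff_isLittleO_nhds_zero] at h2
    rw [e', hasFDerivAt_iff_isLittleO_nhds_zero]
    refine (Asymptotics.IsBigO.of_norm_le fun y => ?_).trans_isLittleO h2.norm_left
    simp only [lowerPart, hx, h0 x hx]
    split_ifs <;> simp_all
  · have e : lowerPart i w =ᶠ[𝓝 x] fun _ => 0 := by
      filter_upwards [(hgt i).continuous.continuousAt.eventually_const_lt hx] with y hy
      simp [lowerPart, hy.le]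
    have e' : lowerPart i (fderiv ℝ w) x = 0 := by simp [lowerPart, hx.le]
    rw [e']
    exact (hasFDerivAt_const _ _).congr_of_eventuallyEq e

theorem contDiff_lowerPart (i : Fin n) (m : ℕ) {w : Euc n → F} (hw : ContDiff ℝ m w)
    (h : ∀ j ≤ m, ∀ x, hgt i x = 0 → ‖iteratedFDeriv ℝ j w x‖ = 0) :
    ContDiff ℝ m (lowerPart i w) ∧
      ∀ j ≤ m, ∀ x, 0 ≤ hgt i x → ‖iteratedFDeriv ℝ j (lowerPart i w) x‖ = 0 := by
  induction m generalizing F with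
  | zero =>
    have h0 : ∀ x, hgt i x = 0 → w x = 0 := fun x hx => by simpa using h 0 le_rfl x hx
    constructor
    · refine contDiff_zero.2 (Continuous.if (fun x hx => ?_) hw.continuous continuous_const)
      have : x ∈ {x | hgt i x = 0} := frontier_lt_subset_eq (hgt i).continuous continuous_const hx
      exact h0 x this
    · intro j hj x hx
      obtain rfl : j = 0 := by omega
      simp [lowerPart, hx]
  | succ m ih =>
    have h0 : ∀ x, hgt i x = 0 → w x = 0 := fun x hx => by simpa using h 0 (by omega) x hx
    have h1 : ∀ x, hgt i x = 0 → fderiv ℝ w x = 0 := fun x hx => by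
      have := h 1 (by omega) x hx
      rwa [← norm_iteratedFDeriv_fderiv, norm_iteratedFDeriv_zero, norm_eq_zero] at this
    have hd := hasFDerivAt_lowerPart i (hw.differentiable (by simp)) h0 h1
    have hf : fderiv ℝ (lowerPart i w) = lowerPart i (fderiv ℝ w) := funext fun x => (hd x).fderiv
    obtain ⟨i1, i2⟩ := ih (w := fderiv ℝ w) (hw.fderiv_right (by simp)) (fun j hj x hx => by
      rw [norm_iteratedFDeriv_fderiv]; exact h (j + 1) (by omega) x hx)
    constructor
    · rw [Nat.cast_add, Nat.cast_one, contDiff_succ_iff_fderiv]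
      exact ⟨fun x => (hd x).differentiableAt, by simp, hf ▸ i1⟩
    · intro j hj x hx
      rcases j with _ | j
      · simp [lowerPart, hx]
      · rw [← norm_iteratedFDeriv_fderiv, hf]
        exact i2 j (by omega) x hx

theorem exists_reflection_coeff (m : ℕ) :
    ∃ c : Fin (m + 1) → ℝ, ∀ j ≤ m, ∑ l, c l * (-((l : ℝ) + 1)) ^ j = 1 := by
  let V : Matrix (Fin (m + 1)) (Fin (m + 1)) ℝ :=
    Matrix.vandermonde fun l : Fin (m + 1) => -((l : ℝ) + 1)
  have hV : IsUnit V.det := by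
    rw [isUnit_iff_ne_zero]
    refine Matrix.det_vandermonde_ne_zero_iff.2 fun a b hab => ?_
    have : (a : ℝ) = b := by simpa using hab
    exact Fin.ext (by exact_mod_cast this)
  refine ⟨Matrix.vecMul (fun _ => 1) V⁻¹, fun j hj => ?_⟩
  have h : Matrix.vecMul (Matrix.vecMul (fun _ => 1) V⁻¹) V = fun _ => (1 : ℝ) := by
    rw [Matrix.vecMul_vecMul, Matrix.nonsing_inv_mul V hV, Matrix.vecMul_one]
  have h2 := congrFun h ⟨j, by omega⟩
  rw [Matrix.vecMul, dotProduct] at h2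
  exact h2

/-- The coefficients of the higher order reflection. -/
def reflCoeff (m : ℕ) : Fin (m + 1) → ℝ := (exists_reflection_coeff m).choose

theorem sum_reflCoeff {m j : ℕ} (hj : j ≤ m) :
    ∑ l, reflCoeff m l * (-((l : ℝ) + 1)) ^ j = 1 :=
  (exists_reflection_coeff m).choose_spec j hj

/-- The linear map scaling the `i`-th coordinate by `s`. -/
def stretch (i : Fin n) (s : ℝ) : Euc n →L[ℝ] Euc n :=
  horiz i + s • (hgt i).smulRight (vert i)

theorem stretch_apply (i : Fin n) (s : ℝ) (x : Euc n) :
    stretch i s x = horiz i x + s • (hgt i x • vert i) := by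
  simp [stretch]

theorem stretch_one (i : Fin n) (x : Euc n) : stretch i 1 x = x := by
  simp [stretch_apply, horiz_apply]

theorem hgt_stretch (i : Fin n) (s : ℝ) (x : Euc n) : hgt i (stretch i s x) = s * hgt i x := by
  rw [stretch_apply, map_add, map_smul, map_smul, hgt_vert, hgt_horiz]
  simp

theorem stretch_of_hgt_eq_zero (i : Fin n) (s : ℝ) {x : Euc n} (hx : hgt i x = 0) :
    stretch i s x = x := by
  rw [stretch_apply, hx, horiz_of_hgt_eq_zero hx]
  simp

/-- The reflected values of `u`. -/
def reflSum (i : Fin n) (m : ℕ) (u : Euc n → F) (x : Euc n) : F :=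
  ∑ l : Fin (m + 1), reflCoeff m l • u (stretch i (-((l : ℝ) + 1)) x)

/-- The extension by higher order reflection of the restriction of `u` to the upper half space. -/
def reflExt (i : Fin n) (m : ℕ) (u : Euc n → F) (x : Euc n) : F :=
  u x + lowerPart i (fun y => reflSum i m u y - u y) x

theorem reflExt_sub (i : Fin n) (m : ℕ) (u v : Euc n → F) :
    reflExt i m (fun y => u y - v y) = fun y => reflExt i m u y - reflExt i m v y := by
  funext y
  simp only [reflExt, lowerPart, reflSum, smul_sub, Finset.sum_sub_distrib]
  split_ifs <;> abel

theorem contDiff_reflSum (i : Fin n) (m : ℕ) {N : WithTop ℕ∞} {u : Euc n → F} (hu : ContDiff ℝ N u) :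
    ContDiff ℝ N (reflSum i m u) :=
  ContDiff.sum fun _ _ => (hu.comp (stretch i _).contDiff).const_smul _

theorem iteratedFDeriv_reflSum (i : Fin n) (m : ℕ) {u : Euc n → F} (hu : ContDiff ℝ m u) {j : ℕ}
    (hj : j ≤ m) (x : Euc n) : iteratedFDeriv ℝ j (reflSum i m u) x =
      ∑ l : Fin (m + 1), reflCoeff m l • (iteratedFDeriv ℝ j u
        (stretch i (-((l : ℝ) + 1)) x)).compContinuousLinearMap
          fun _ => stretch i (-((l : ℝ) + 1)) := by
  have hu' : ContDiff ℝ j u := hu.of_le (by exact_mod_cast hj)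
  have e : reflSum i m u = fun x => ∑ l ∈ (Finset.univ : Finset (Fin (m + 1))),
    reflCoeff m l • (u ∘ stretch i (-((l : ℝ) + 1))) x := rfl
  rw [e, iteratedFDeriv_fun_sum_apply (fun l _ => ((hu'.comp (stretch i _).contDiff).const_smul _).contDiffAt)]
  refine Finset.sum_congr rfl fun l _ => ?_
  rw [iteratedFDeriv_const_smul_apply' (hu'.comp (stretch i _).contDiff).contDiffAt]
  rw [(stretch i _).iteratedFDeriv_comp_right hu' x le_rfl]

theorem iteratedFDeriv_reflSum_of_hgt_eq_zero (i : Fin n) (m : ℕ) {u : Euc n → F}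
    (hu : ContDiff ℝ m u) {j : ℕ} (hj : j ≤ m) {x : Euc n} (hx : hgt i x = 0) :
    iteratedFDeriv ℝ j (reflSum i m u) x = iteratedFDeriv ℝ j u x := by
  rw [iteratedFDeriv_reflSum i m hu hj]
  ext v
  simp only [stretch_of_hgt_eq_zero i _ hx, sum_apply,
    smul_apply, ContinuousMultilinearMap.compContinuousLinearMap_apply]
  have key : ∀ s : ℝ, iteratedFDeriv ℝ j u x (fun a => stretch i s (v a)) =
      ∑ S : Finset (Fin j), s ^ S.card • iteratedFDeriv ℝ j u x
        (S.piecewise (fun a => hgt i (v a) • vert i) fun a => horiz i (v a)) := by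
    intro s
    have e : (fun a => stretch i s (v a)) =
        (fun a => s • (hgt i (v a) • vert i)) + fun a => horiz i (v a) := by
      funext a
      rw [stretch_apply, Pi.add_apply, add_comm]
    rw [e, ContinuousMultilinearMap.map_add_univ]
    refine Finset.sum_congr rfl fun S _ => ?_
    have := (iteratedFDeriv ℝ j u x).toMultilinearMap.map_piecewise_smul (fun _ => s)
      (S.piecewise (fun a => hgt i (v a) • vert i) fun a => horiz i (v a)) S
    simp only [Finset.prod_const, ContinuousMultilinearMap.coe_coe] at this
    rw [← this]
    congr 1
    funext a
    by_cases ha : a ∈ S <;> simp [ha]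
  have h1 : iteratedFDeriv ℝ j u x v = iteratedFDeriv ℝ j u x fun a => stretch i 1 (v a) := by
    simp only [stretch_one]
  rw [h1, key]
  simp only [key, Finset.smul_sum, smul_smul]
  rw [Finset.sum_comm]
  refine Finset.sum_congr rfl fun S _ => ?_
  rw [← Finset.sum_smul, sum_reflCoeff, one_pow]
  exact (Finset.card_le_univ S).trans (by simpa using hj)

theorem contDiff_lowerPart_reflSum (i : Fin n) (m : ℕ) {u : Euc n → F} (hu : ContDiff ℝ m u) :
    ContDiff ℝ m (lowerPart i fun y => reflSum i m u y - u y) ∧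
      ∀ j ≤ m, ∀ x, 0 ≤ hgt i x →
        ‖iteratedFDeriv ℝ j (lowerPart i fun y => reflSum i m u y - u y) x‖ = 0 := by
  refine contDiff_lowerPart i m ((contDiff_reflSum i m hu).sub hu) fun j hj x hx => ?_
  have hj' : (j : WithTop ℕ∞) ≤ m := by exact_mod_cast hj
  rw [fun_iteratedFDeriv_sub_apply ((contDiff_reflSum i m hu).of_le hj').contDiffAt
    (hu.of_le hj').contDiffAt, iteratedFDeriv_reflSum_of_hgt_eq_zero i m hu hj hx, sub_self,
    norm_zero]

theorem contDiff_reflExt (i : Fin n) (m : ℕ) {u : Euc n → F} (hu : ContDiff ℝ m u) :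
    ContDiff ℝ m (reflExt i m u) :=
  hu.add (contDiff_lowerPart_reflSum i m hu).1

theorem iteratedFDeriv_reflExt_of_nonneg (i : Fin n) (m : ℕ) {u : Euc n → F} (hu : ContDiff ℝ m u)
    {j : ℕ} (hj : j ≤ m) {x : Euc n} (hx : 0 ≤ hgt i x) :
    iteratedFDeriv ℝ j (reflExt i m u) x = iteratedFDeriv ℝ j u x := by
  have h := contDiff_lowerPart_reflSum i m hu
  have hj' : (j : WithTop ℕ∞) ≤ m := by exact_mod_cast hj
  have e : reflExt i m u = fun x => u x + lowerPart i (fun y => reflSum i m u y - u y) x := rfl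
  rw [e, fun_iteratedFDeriv_add_apply (hu.of_le hj').contDiffAt (h.1.of_le hj').contDiffAt,
    norm_eq_zero.1 (h.2 j hj x hx), add_zero]

theorem norm_iteratedFDeriv_reflExt_le (i : Fin n) (m : ℕ) : ∃ C : ℝ, 0 ≤ C ∧
    ∀ {u : Euc n → F} {N : ℝ}, ContDiff ℝ m u → 0 ≤ N →
      (∀ j ≤ m, ∀ x ∈ upperHalf i, ‖iteratedFDeriv ℝ j u x‖ ≤ N) →
      ∀ j ≤ m, ∀ x, ‖iteratedFDeriv ℝ j (reflExt i m u) x‖ ≤ C * N := by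
  refine ⟨1 + ∑ l : Fin (m + 1), |reflCoeff m l| * (1 + ‖stretch i (-((l : ℝ) + 1))‖) ^ m,
    by positivity, ?_⟩
  intro u N hu hN h j hj x
  rcases le_or_gt 0 (hgt i x) with hx | hx
  · rw [iteratedFDeriv_reflExt_of_nonneg i m hu hj hx]
    refine (h j hj x hx).trans (le_mul_of_one_le_left hN (le_add_of_nonneg_right (by positivity)))
  · have e : reflExt i m u =ᶠ[𝓝 x] reflSum i m u := by
      filter_upwards [(hgt i).continuous.continuousAt.eventually_lt_const hx] with y hy
      simp [reflExt, lowerPart, hy]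
    rw [(e.iteratedFDeriv ℝ j).eq_of_nhds, iteratedFDeriv_reflSum i m hu hj]
    refine (norm_sum_le _ _).trans ?_
    rw [add_mul, Finset.sum_mul]
    refine le_add_of_nonneg_of_le (by positivity) (Finset.sum_le_sum fun l _ => ?_)
    rw [norm_smul, Real.norm_eq_abs, mul_assoc]
    refine mul_le_mul_of_nonneg_left ?_ (abs_nonneg _)
    refine (ContinuousMultilinearMap.norm_compContinuousLinearMap_le _ _).trans ?_
    rw [mul_comm]
    have h1 : ‖stretch i (-((l : ℝ) + 1))‖ ^ j ≤ (1 + ‖stretch i (-((l : ℝ) + 1))‖) ^ m :=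
      (pow_le_pow_left₀ (norm_nonneg _) (by simp) j).trans (pow_le_pow_right₀ (by simp) hj)
    simp only [Finset.prod_const, Finset.card_univ, Fintype.card_fin]
    refine mul_le_mul h1 (h j hj _ ?_) (norm_nonneg _) (by positivity)
    change 0 ≤ hgt i _
    rw [hgt_stretch]
    nlinarith [(l : ℕ).cast_nonneg (α := ℝ)]

end Reflection

section Mollify

theorem HolderBound.sub {E F : Type} [NormedAddCommGroup E] [NormedSpace ℝ E]
    [NormedAddCommGroup F] [NormedSpace ℝ F] {k : ℕ} {α M N : ℝ} {A : Set E} {u v : E → F}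
    (hN : 0 ≤ N) (hu : ContDiff ℝ k u) (hv : ContDiff ℝ k v)
    (h : HolderBound k α M A u) (h' : HolderBound k α N A v) :
    HolderBound k α (M + N) A (fun x => u x - v x) := by
  have h1 := h'.clm_comp (-ContinuousLinearMap.id ℝ F) hv
  have h2 := (h.add hu hv.neg (h1.mono_const (N := N) ?_)).congr (v := fun x => u x - v x)
    fun x _ => Eventually.of_forall fun y => sub_eq_add_neg _ _
  · exact h2
  · rw [norm_neg]
    exact mul_le_of_le_one_left hN ContinuousLinearMap.norm_id_le

theorem HolderBound.of_small {E F : Type} [NormedAddCommGroup E] [NormedSpace ℝ E]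
    [NormedAddCommGroup F] [NormedSpace ℝ F] {k : ℕ} {α M s : ℝ} {A : Set E} {u : E → F}
    (hα : 0 < α) (hM : 0 ≤ M) (hs : 0 < s) (hs1 : s ≤ 1) (h : HolderBound k α M A u)
    (h' : ∀ j ≤ k, ∀ x ∈ A, ‖iteratedFDeriv ℝ j u x‖ ≤ M * s ^ α) :
    HolderBound k (α / 2) (2 * M * s ^ (α / 2)) A u := by
  have e : ∀ t : ℝ, 0 ≤ t → t ^ α = t ^ (α / 2) * t ^ (α / 2) := fun t ht => by
    rw [← Real.rpow_add_of_nonneg ht (by positivity) (by positivity), add_halves]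
  have hs2 : s ^ (α / 2) ≤ 1 := Real.rpow_le_one hs.le hs1 (by positivity)
  have hs3 : 0 ≤ s ^ (α / 2) := by positivity
  have hb : ∀ j ≤ k, ∀ x ∈ A, ‖iteratedFDeriv ℝ j u x‖ ≤ M * (s ^ (α / 2) * s ^ (α / 2)) := by
    rw [← e s hs.le]; exact h'
  refine ⟨fun j hj x hx => (hb j hj x hx).trans ?_, fun j hj x hx y hy => ?_⟩
  · have := mul_nonneg hM hs3
    nlinarith
  · have ht : 0 ≤ ‖x - y‖ ^ (α / 2) := by positivity
    have hM3 := mul_nonneg hM hs3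
    rcases le_total ‖x - y‖ s with hxy | hxy
    · have h1 := h.holder j hj x hx y hy
      rw [e _ (norm_nonneg _)] at h1
      have h2 : ‖x - y‖ ^ (α / 2) ≤ s ^ (α / 2) := by gcongr
      have h3 := mul_le_mul_of_nonneg_left h2 (mul_nonneg hM ht)
      have h4 := mul_nonneg hM3 ht
      nlinarith
    · have h2 : s ^ (α / 2) ≤ ‖x - y‖ ^ (α / 2) := by gcongr
      have h1 := (norm_sub_le _ _).trans (add_le_add (hb j hj x hx) (hb j hj y hy))
      have h3 := mul_le_mul_of_nonneg_left h2 hM3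
      nlinarith

variable {n : ℕ} {F : Type} [NormedAddCommGroup F] [NormedSpace ℝ F]

/-- The average of `u` over a small ball shifted upwards. -/
def mollify (i : Fin n) (φ : ContDiffBump (0 : Euc n)) (u : Euc n → F) : Euc n → F :=
  translateAverage volume (φ.normed volume) (fun p => p - φ.rOut • vert i)
    (ContinuousLinearMap.lsmul ℝ ℝ).flip u

theorem norm_shift_le (φ : ContDiffBump (0 : Euc n)) {p : Euc n}
    (hp : φ.normed volume p ≠ 0) : ‖p‖ ≤ φ.rOut := by
  have : p ∈ Function.support (φ.normed volume) := hp
  rw [φ.support_normed_eq] at this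
  exact (mem_ball_zero_iff.1 this).le

theorem shift_mem_upperHalf (i : Fin n) (φ : ContDiffBump (0 : Euc n)) {p : Euc n}
    (hp : φ.normed volume p ≠ 0) {x : Euc n} (hx : x ∈ upperHalf i) :
    x - (p - φ.rOut • vert i) ∈ upperHalf i := by
  have h1 := (abs_le.1 ((abs_hgt_le i p).trans (norm_shift_le φ hp))).2
  have hx' : 0 ≤ hgt i x := hx
  change 0 ≤ hgt i _
  rw [map_sub, map_sub, map_smul, hgt_vert]
  simp only [smul_eq_mul, mul_one]
  linarith

theorem integrable_normed (φ : ContDiffBump (0 : Euc n)) : Integrable (φ.normed volume) volume :=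
  φ.integrable_normed

theorem integral_norm_normed (φ : ContDiffBump (0 : Euc n)) :
    ∫ p, ‖φ.normed volume p‖ = 1 := by
  rw [← φ.integral_normed (μ := volume)]
  refine integral_congr_ae (Eventually.of_forall fun p => ?_)
  exact Real.norm_of_nonneg (φ.nonneg_normed p)

theorem aestronglyMeasurable_shift (i : Fin n) (r : ℝ) :
    AEStronglyMeasurable (fun p : Euc n => p - r • vert i) volume :=
  Continuous.aestronglyMeasurable (by fun_prop)

theorem contDiff_mollify [CompleteSpace F] (i : Fin n) (φ : ContDiffBump (0 : Euc n))
    {u : Euc n → F} (hu : Continuous u) : ContDiff ℝ ∞ (mollify i φ u) := by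
  have h := (φ.hasCompactSupport_normed (μ := volume)).contDiff_convolution_left (μ := volume) (n := ⊤)
    (ContinuousLinearMap.lsmul ℝ ℝ) φ.contDiff_normed (hu.locallyIntegrable (μ := volume))
  have e : mollify i φ u = fun x => (convolution (φ.normed volume) u
      (ContinuousLinearMap.lsmul ℝ ℝ) volume) (x + φ.rOut • vert i) := by
    funext x
    refine integral_congr_ae (Eventually.of_forall fun p => ?_)
    change φ.normed volume p • u _ = φ.normed volume p • u _
    congr 2
    exact (sub_sub_eq_add_sub _ _ _)
  rw [e]
  exact h.comp (contDiff_id.add contDiff_const)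

theorem holderBound_mollify (i : Fin n) (φ : ContDiffBump (0 : Euc n)) {k : ℕ} {α M M' : ℝ}
    {u : Euc n → F} (hu : ContDiff ℝ k u) (hM' : ∀ j ≤ k, ∀ x, ‖iteratedFDeriv ℝ j u x‖ ≤ M')
    (hM : 0 ≤ M) (h : HolderBound k α M (upperHalf i) u) :
    HolderBound k α M (upperHalf i) (mollify i φ u) := by
  have h1 := (translateAverage_holderBound (α := α) (integrable_normed φ)
    (aestronglyMeasurable_shift i φ.rOut) (fun p hp x hx => shift_mem_upperHalf i φ hp hx) k
    (ContinuousLinearMap.lsmul ℝ ℝ).flip u hu hM').2 M hM h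
  refine h1.mono_const ?_
  rw [integral_norm_normed, mul_one, ContinuousLinearMap.opNorm_flip]
  exact mul_le_of_le_one_left hM (ContinuousLinearMap.opNorm_lsmul_le)

theorem norm_mollify_sub_le [CompleteSpace F] (i : Fin n) (φ : ContDiffBump (0 : Euc n)) {α M M' : ℝ}
    (hα : 0 ≤ α) (hM : 0 ≤ M)
    {u : Euc n → F} (hu : Continuous u) (hM' : ∀ x, ‖u x‖ ≤ M') (h : HalfHolder i α M u) {x : Euc n}
    (hx : x ∈ upperHalf i) : ‖mollify i φ u x - u x‖ ≤ M * (2 * φ.rOut) ^ α := by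
  have hintg := translateAverage_integrable (integrable_normed φ)
    (aestronglyMeasurable_shift i φ.rOut) (ContinuousLinearMap.lsmul ℝ ℝ).flip hu hM' x
  have e : u x = ∫ p, φ.normed volume p • u x := by
    rw [integral_smul_const, φ.integral_normed, one_smul]
  have hr := φ.rOut_pos
  rw [e, mollify, translateAverage, ← integral_sub hintg ((integrable_normed φ).smul_const _)]
  calc _ ≤ ∫ p, φ.normed volume p * (M * (2 * φ.rOut) ^ α) := by
        refine norm_integral_le_of_norm_le ((integrable_normed φ).mul_const _)
          (Eventually.of_forall fun p => ?_)
        change ‖φ.normed volume p • u _ - φ.normed volume p • u _‖ ≤ _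
        rw [← smul_sub, norm_smul, Real.norm_of_nonneg (φ.nonneg_normed p)]
        by_cases hp : φ.normed volume p = 0
        · simp [hp]
        refine mul_le_mul_of_nonneg_left ?_ (φ.nonneg_normed p)
        refine (h _ _ (shift_mem_upperHalf i φ hp hx) hx).trans ?_
        refine mul_le_mul_of_nonneg_left (Real.rpow_le_rpow (norm_nonneg _) ?_ hα) hM
        have : x - (p - φ.rOut • vert i) - x = φ.rOut • vert i - p := by abel
        rw [this]
        refine (norm_sub_le _ _).trans ?_
        rw [norm_smul, norm_vert, Real.norm_of_nonneg hr.le]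
        linarith [norm_shift_le φ hp]
    _ = _ := by rw [integral_mul_const, φ.integral_normed, one_mul]

theorem fderiv_mollify (i : Fin n) (φ : ContDiffBump (0 : Euc n)) {M' : ℝ} {u : Euc n → F}
    (hu : ContDiff ℝ 1 u) (hM' : ∀ j ≤ 1, ∀ x, ‖iteratedFDeriv ℝ j u x‖ ≤ M') :
    fderiv ℝ (mollify i φ u) = mollify i φ (fderiv ℝ u) := by
  funext x
  have h := hasFDerivAt_translateAverage (integrable_normed φ)
    (aestronglyMeasurable_shift i φ.rOut) (ContinuousLinearMap.lsmul ℝ ℝ).flip hu (M := M')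
    (fun x => by simpa using hM' 0 (by omega) x) (M' := M') (fun x => by
      have := hM' 1 (by omega) x
      rwa [← norm_iteratedFDeriv_fderiv, norm_iteratedFDeriv_zero] at this) x
  rw [mollify, h.fderiv, mollify]
  congr 1

theorem norm_iteratedFDeriv_mollify_sub_le [CompleteSpace F] (i : Fin n)
    (φ : ContDiffBump (0 : Euc n)) {α M M' : ℝ} (hα : 0 ≤ α) (hM : 0 ≤ M) (k : ℕ)
    {u : Euc n → F} (hu : ContDiff ℝ k u) (hM' : ∀ j ≤ k, ∀ x, ‖iteratedFDeriv ℝ j u x‖ ≤ M')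
    (h : HolderBound k α M (upperHalf i) u) : ∀ j ≤ k, ∀ x ∈ upperHalf i,
      ‖iteratedFDeriv ℝ j (mollify i φ u) x - iteratedFDeriv ℝ j u x‖ ≤ M * (2 * φ.rOut) ^ α := by
  intro j
  induction j generalizing F k with
  | zero =>
    intro _ x hx
    simp only [iteratedFDeriv_zero_eq_comp, Function.comp_apply, ← map_sub,
      LinearIsometryEquiv.norm_map]
    exact norm_mollify_sub_le i φ hα hM hu.continuous
      (fun x => by simpa using hM' 0 (by omega) x) h.halfHolder hx
  | succ j ih =>
    intro hj x hx
    obtain ⟨k, rfl⟩ : ∃ k', k = k' + 1 := ⟨k - 1, by omega⟩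
    have hf := fderiv_mollify i φ (hu.of_le (by exact_mod_cast (by omega : 1 ≤ k + 1)))
      (fun j hj => hM' j (by omega))
    simp only [iteratedFDeriv_succ_eq_comp_right, Function.comp_apply]
    rw [← dist_eq_norm, LinearIsometryEquiv.dist_map, dist_eq_norm, hf]
    exact ih k (u := fderiv ℝ u) (hu.fderiv_right (by simp)) (fun j hj x => by
      rw [norm_iteratedFDeriv_fderiv]; exact hM' (j + 1) (by omega) x)
      (holderBound_succ_iff.1 h).2 (by omega) x hx

end Mollify

section Limits

variable {E F : Type} [NormedAddCommGroup E] [NormedSpace ℝ E]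
  [NormedAddCommGroup F] [NormedSpace ℝ F]

theorem exists_contDiff_limit [CompleteSpace F] (N : ℕ) {u : ℕ → E → F}
    (hu : ∀ m, ContDiff ℝ N (u m)) {B r : ℝ} (hr0 : 0 ≤ r) (hr1 : r < 1)
    (hB : ∀ j ≤ N, ∀ m x, ‖iteratedFDeriv ℝ j (fun y => u (m + 1) y - u m y) x‖ ≤ B * r ^ m) :
    ∃ w : E → F, ContDiff ℝ N w ∧ ∀ j ≤ N, ∀ x,
      Tendsto (fun m => iteratedFDeriv ℝ j (u m) x) atTop (𝓝 (iteratedFDeriv ℝ j w x)) := by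
  have hf : ∀ m, ContDiff ℝ ((N : ℕ∞) : WithTop ℕ∞) fun y => u (m + 1) y - u m y :=
    fun m => (hu (m + 1)).sub (hu m)
  have hv : ∀ k : ℕ, (k : ℕ∞) ≤ (N : ℕ∞) → Summable fun m : ℕ => B * r ^ m :=
    fun _ _ => (summable_geometric_of_lt_one hr0 hr1).mul_left B
  have h'f : ∀ (k m : ℕ) (x : E), (k : ℕ∞) ≤ (N : ℕ∞) →
      ‖iteratedFDeriv ℝ k (fun y => u (m + 1) y - u m y) x‖ ≤ B * r ^ m :=
    fun k m x hk => hB k (by exact_mod_cast hk) m x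
  have hs := contDiff_tsum (v := fun _ m => B * r ^ m) hf hv h'f
  refine ⟨fun x => u 0 x + ∑' m, (u (m + 1) x - u m x), (hu 0).add hs, fun j hj x => ?_⟩
  have hj' : (j : WithTop ℕ∞) ≤ N := by exact_mod_cast hj
  have e1 : iteratedFDeriv ℝ j (fun x => u 0 x + ∑' m, (u (m + 1) x - u m x)) x =
      iteratedFDeriv ℝ j (u 0) x +
        ∑' m, iteratedFDeriv ℝ j (fun y => u (m + 1) y - u m y) x := by
    have := fun_iteratedFDeriv_add_apply (x := x) ((hu 0).of_le hj').contDiffAt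
      (hs.of_le hj').contDiffAt
    rw [this, iteratedFDeriv_tsum (v := fun _ m => B * r ^ m) hf hv h'f (by exact_mod_cast hj)]
  have e2 : ∀ m, iteratedFDeriv ℝ j (fun y => u (m + 1) y - u m y) x =
      iteratedFDeriv ℝ j (u (m + 1)) x - iteratedFDeriv ℝ j (u m) x := fun m =>
    fun_iteratedFDeriv_sub_apply ((hu (m + 1)).of_le hj').contDiffAt ((hu m).of_le hj').contDiffAt
  have hsum : Summable fun m => iteratedFDeriv ℝ j (fun y => u (m + 1) y - u m y) x :=
    (hv 0 (by simp)).of_norm_bounded fun m => hB j hj m x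
  rw [e1]
  have := hsum.hasSum.tendsto_sum_nat.const_add (iteratedFDeriv ℝ j (u 0) x)
  refine this.congr fun m => ?_
  simp only [e2]
  rw [Finset.sum_range_sub fun m => iteratedFDeriv ℝ j (u m) x]
  abel

theorem HolderBound.of_tendsto {k : ℕ} {α M : ℝ} {A : Set E} {u : ℕ → E → F} {w : E → F}
    (h : ∀ m, HolderBound k α M A (u m))
    (hw : ∀ j ≤ k, ∀ x ∈ A,
      Tendsto (fun m => iteratedFDeriv ℝ j (u m) x) atTop (𝓝 (iteratedFDeriv ℝ j w x))) :
    HolderBound k α M A w :=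
  ⟨fun j hj x hx => le_of_tendsto (hw j hj x hx).norm
      (Eventually.of_forall fun m => (h m).bound j hj x hx),
    fun j hj x hx y hy => le_of_tendsto ((hw j hj x hx).sub (hw j hj y hy)).norm
      (Eventually.of_forall fun m => (h m).holder j hj x hx y hy)⟩

theorem tendsto_of_tendsto_iteratedFDeriv_zero {u : ℕ → E → F} {w : E → F} {x : E}
    (h : Tendsto (fun m => iteratedFDeriv ℝ 0 (u m) x) atTop (𝓝 (iteratedFDeriv ℝ 0 w x))) :
    Tendsto (fun m => u m x) atTop (𝓝 (w x)) := by
  rw [tendsto_iff_norm_sub_tendsto_zero] at h ⊢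
  refine h.congr fun m => ?_
  simp only [iteratedFDeriv_zero_eq_comp, Function.comp_apply, ← map_sub,
    LinearIsometryEquiv.norm_map]

theorem tendsto_fderiv_of_tendsto_iteratedFDeriv_one {u : ℕ → E → F} {w : E → F} {x : E}
    (h : Tendsto (fun m => iteratedFDeriv ℝ 1 (u m) x) atTop (𝓝 (iteratedFDeriv ℝ 1 w x))) :
    Tendsto (fun m => fderiv ℝ (u m) x) atTop (𝓝 (fderiv ℝ w x)) := by
  refine tendsto_of_tendsto_iteratedFDeriv_zero (u := fun m => fderiv ℝ (u m)) ?_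
  rw [tendsto_iff_norm_sub_tendsto_zero] at h ⊢
  refine h.congr fun m => ?_
  simp only [iteratedFDeriv_succ_eq_comp_right, Function.comp_apply]
  rw [← dist_eq_norm, LinearIsometryEquiv.dist_map, dist_eq_norm]

end Limits

section FlatField

variable {n : ℕ}

theorem diver_smul {χ : Euc n → ℝ} {V : Euc n → Euc n} {x : Euc n} (hχ : DifferentiableAt ℝ χ x)
    (hV : DifferentiableAt ℝ V x) :
    diver (fun y => χ y • V y) x = χ x * diver V x + fderiv ℝ χ x (V x) := by
  simp only [diver_eq_traceCLM]
  rw [fderiv_fun_smul hχ hV, map_add, map_smul, traceCLM_smulRight, smul_eq_mul]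

theorem holderBound_smul_coneField (i : Fin n) {α : ℝ} (hα : α ∈ Ioo (0 : ℝ) 1) (k : ℕ)
    {ψ : Euc n → ℝ} (hψ : IsTest ψ) {χ : Euc n → ℝ} (hχ : ContDiff ℝ ∞ χ)
    (hc : HasCompactSupport χ) : ∃ C : ℝ, 0 ≤ C ∧ ∀ {g : Euc n → ℝ} {M : ℝ}, ContDiff ℝ ∞ g →
      0 ≤ M → HolderBound k α M (upperHalf i) g →
      HolderBound (k + 1) α (C * M) (upperHalf i) fun x => χ x • coneField i ψ g x := by
  obtain ⟨r, hr, hsub⟩ := hc.isCompact.isBounded.subset_closedBall_lt 0 0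
  obtain ⟨K, hK, hχK⟩ := HolderBound.of_hasCompactSupport (k + 1) hα hχ hc
  obtain ⟨C, hC, h⟩ := holderBound_coneField i hα (L := 2 * r) (by positivity) k hψ
  refine ⟨(1 + (r ^ α)⁻¹) * (2 ^ (k + 1 + 1) * ‖ContinuousLinearMap.lsmul ℝ ℝ (E := Euc n)‖ * K * C),
    by positivity, fun {g M} hg hM hgM => ?_⟩
  have hle : ((k + 1 : ℕ) : WithTop ℕ∞) ≤ ∞ := by exact_mod_cast le_top
  have h1 := (hχK.mono_set (subset_univ (slab i (2 * r)))).bilinear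
    (ContinuousLinearMap.lsmul ℝ ℝ) hK (by positivity) (hχ.of_le hle)
    ((contDiff_coneField i hψ hg).of_le hle) (h hg hM hgM)
  have h2 : HolderBound (k + 1) α (2 ^ (k + 1 + 1) * ‖ContinuousLinearMap.lsmul ℝ ℝ (E := Euc n)‖ *
      K * (C * M)) (upperHalf i ∩ Metric.ball 0 (2 * r)) fun x => χ x • coneField i ψ g x := by
    refine h1.mono_set fun x hx => ⟨hx.1, ?_⟩
    exact (le_abs_self _).trans ((abs_hgt_le i x).trans (mem_ball_zero_iff.1 hx.2).le)
  have h3 := h2.of_tsupport_subset hr hα.1.le (by positivity)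
    ((closure_mono (Function.support_smul_subset_left _ _)).trans hsub)
  refine h3.mono_const (le_of_eq ?_)
  ring

theorem exists_flat_field (i : Fin n) {α : ℝ} (hα : α ∈ Ioo (0 : ℝ) 1) (k : ℕ)
    {ψ : Euc n → ℝ} (hψ : IsTest ψ) {χ : Euc n → ℝ} (hχ : ContDiff ℝ ∞ χ)
    (hc : HasCompactSupport χ) : ∃ C : ℝ, 0 ≤ C ∧ ∀ {G : Euc n → ℝ} {M : ℝ}, ContDiff ℝ k G →
      HasCompactSupport G → 0 ≤ M → HolderBound k α M (upperHalf i) G →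
      ∃ w : Euc n → Euc n, ContDiff ℝ (k + 1) w ∧
        (∀ x ∈ upperHalf i, w x = χ x • coneField i ψ G x) ∧
        (∀ x ∈ upperHalf i, diver w x =
          χ x * ((∫ η in Metric.closedBall (0 : Euc n) 1, ψ η) * G x) +
            fderiv ℝ χ x (coneField i ψ G x)) ∧
        HolderBound (k + 1) α (C * M) (upperHalf i) w ∧ (ContDiff ℝ ∞ G → ContDiff ℝ ∞ w) := by
  have hα2 : α / 2 ∈ Ioo (0 : ℝ) 1 := ⟨by linarith [hα.1], by linarith [hα.1, hα.2]⟩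
  obtain ⟨C, hC, h⟩ := holderBound_smul_coneField i hα k hψ hχ hc
  obtain ⟨C₂, hC₂, h₂⟩ := holderBound_smul_coneField i hα2 k hψ hχ hc
  refine ⟨C, hC, fun {G M} hG hGc hM hGM => ?_⟩
  have hψc := hψ.contDiff.continuous
  have hdiv : ∀ {g : Euc n → ℝ}, ContDiff ℝ ∞ g → ∀ x,
      diver (fun y => χ y • coneField i ψ g y) x =
        χ x * ((∫ η in Metric.closedBall (0 : Euc n) 1, ψ η) * g x) +
          fderiv ℝ χ x (coneField i ψ g x) := by
    intro g hg x
    rw [diver_smul (hχ.differentiable (by simp) x)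
      ((contDiff_coneField i hψ hg).differentiable (by simp) x), diver_coneField i hψ hg]
  by_cases hsm : ContDiff ℝ ∞ G
  · have hw : ContDiff ℝ ∞ fun x => χ x • coneField i ψ G x := hχ.smul (contDiff_coneField i hψ hsm)
    exact ⟨_, hw.of_le (by exact_mod_cast le_top), fun x _ => rfl, fun x _ => hdiv hsm x,
      h hsm hM hGM, fun _ => hw⟩
  obtain ⟨M', hM'0, hM'⟩ := exists_bound_iteratedFDeriv_of_hasCompactSupport hG hGc
  have hle : ((k + 1 : ℕ) : WithTop ℕ∞) ≤ ∞ := by exact_mod_cast le_top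
  let s : ℕ → ℝ := fun m => (1 / 4) ^ m
  have hs0 : ∀ m, 0 < s m := fun m => by positivity
  have hs1 : ∀ m, s m ≤ 1 := fun m => pow_le_one₀ (by norm_num) (by norm_num)
  have hsm' : ∀ m, s (m + 1) ≤ s m := fun m =>
    pow_le_pow_of_le_one (by norm_num) (by norm_num) (by omega)
  let φ : ℕ → ContDiffBump (0 : Euc n) := fun m =>
    ⟨s m / 4, s m / 2, by have := hs0 m; positivity, by linarith [hs0 m]⟩
  have hφ : ∀ m, 2 * (φ m).rOut = s m := fun m => mul_div_cancel₀ _ two_ne_zero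
  let g : ℕ → Euc n → ℝ := fun m => mollify i (φ m) G
  have hg : ∀ m, ContDiff ℝ ∞ (g m) := fun m => contDiff_mollify i (φ m) hG.continuous
  have hgk : ∀ m, ContDiff ℝ k (g m) := fun m => (hg m).of_le (by exact_mod_cast le_top)
  have hgM : ∀ m, HolderBound k α M (upperHalf i) (g m) := fun m =>
    holderBound_mollify i (φ m) hG hM' hM hGM
  have hgd : ∀ m, ∀ j ≤ k, ∀ x ∈ upperHalf i,
      ‖iteratedFDeriv ℝ j (g m) x - iteratedFDeriv ℝ j G x‖ ≤ M * s m ^ α := fun m j hj x hx => by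
    rw [← hφ m]
    exact norm_iteratedFDeriv_mollify_sub_le i (φ m) hα.1.le hM k hG hM' hGM j hj x hx
  have hgg : ∀ m, HolderBound k (α / 2) (2 * (M + M) * s m ^ (α / 2)) (upperHalf i)
      fun x => g (m + 1) x - g m x := by
    intro m
    refine HolderBound.of_small hα.1 (by positivity) (hs0 m) (hs1 m)
      ((hgM (m + 1)).sub hM (hgk _) (hgk _) (hgM m)) fun j hj x hx => ?_
    have hj' : (j : WithTop ℕ∞) ≤ k := by exact_mod_cast hj
    rw [fun_iteratedFDeriv_sub_apply ((hgk (m + 1)).of_le hj').contDiffAt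
      ((hgk m).of_le hj').contDiffAt]
    have h1 := hgd (m + 1) j hj x hx
    have h2 := hgd m j hj x hx
    have h3 : s (m + 1) ^ α ≤ s m ^ α := Real.rpow_le_rpow (hs0 _).le (hsm' m) hα.1.le
    have h4 := norm_sub_le_norm_sub_add_norm_sub (iteratedFDeriv ℝ j (g (m + 1)) x)
      (iteratedFDeriv ℝ j G x) (iteratedFDeriv ℝ j (g m) x)
    rw [norm_sub_rev (iteratedFDeriv ℝ j G x)] at h4
    nlinarith [mul_le_mul_of_nonneg_left h3 hM]
  let V : ℕ → Euc n → Euc n := fun m x => χ x • coneField i ψ (g m) x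
  have hV : ∀ m, ContDiff ℝ ∞ (V m) := fun m => hχ.smul (contDiff_coneField i hψ (hg m))
  have hVk : ∀ m, ContDiff ℝ ((k + 1 : ℕ) : WithTop ℕ∞) (V m) := fun m => (hV m).of_le hle
  have hVV : ∀ m, HolderBound (k + 1) (α / 2) (C₂ * (2 * (M + M) * s m ^ (α / 2))) (upperHalf i)
      fun x => V (m + 1) x - V m x := by
    intro m
    have h1 := h₂ ((hg (m + 1)).sub (hg m)) (by have := hs0 m; positivity) (hgg m)
    refine h1.congr fun x _ => Eventually.of_forall fun y => ?_
    change χ y • _ - χ y • _ = χ y • coneField i ψ (fun y => g (m + 1) y - g m y) y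
    rw [coneField_sub i hψc (hg _).continuous (hg _).continuous, smul_sub]
  obtain ⟨C₃, hC₃, h₃⟩ := norm_iteratedFDeriv_reflExt_le (F := Euc n) i (k + 1)
  have hss : ∀ m, s m ^ (α / 2) = ((1 / 4 : ℝ) ^ (α / 2)) ^ m := fun m => by
    rw [← Real.rpow_natCast, ← Real.rpow_mul (by norm_num), mul_comm, Real.rpow_mul (by norm_num),
      Real.rpow_natCast]
  obtain ⟨w, hw, hlim⟩ := exists_contDiff_limit (k + 1) (u := fun m => reflExt i (k + 1) (V m))
    (B := C₃ * (C₂ * (2 * (M + M)))) (r := (1 / 4 : ℝ) ^ (α / 2))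
    (fun m => contDiff_reflExt i (k + 1) (hVk m)) (by positivity)
    (Real.rpow_lt_one (by norm_num) (by norm_num) hα2.1) (fun j hj m x => by
      rw [← reflExt_sub]
      refine (h₃ ((hVk (m + 1)).sub (hVk m)) (by have := hs0 m; positivity)
        (hVV m).bound j hj x).trans (le_of_eq ?_)
      rw [hss]; ring)
  have hlim' : ∀ j ≤ k + 1, ∀ x ∈ upperHalf i,
      Tendsto (fun m => iteratedFDeriv ℝ j (V m) x) atTop (𝓝 (iteratedFDeriv ℝ j w x)) := by
    intro j hj x hx
    refine (hlim j hj x).congr fun m => ?_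
    exact iteratedFDeriv_reflExt_of_nonneg i (k + 1) (hVk m) hj hx
  have hst : Tendsto (fun m => M * s m ^ α) atTop (𝓝 0) := by
    have h1 : Tendsto s atTop (𝓝 0) :=
      tendsto_pow_atTop_nhds_zero_of_lt_one (by norm_num) (by norm_num)
    have h2 := (h1.rpow_const (p := α) (Or.inr hα.1.le)).const_mul M
    rwa [Real.zero_rpow hα.1.ne', mul_zero] at h2
  have hgd0 : ∀ m, ∀ x ∈ upperHalf i, ‖g m x - G x‖ ≤ M * s m ^ α := fun m x hx => by
    have := hgd m 0 (Nat.zero_le k) x hx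
    simpa only [iteratedFDeriv_zero_eq_comp, Function.comp_apply, ← map_sub,
      LinearIsometryEquiv.norm_map] using this
  have hgt' : ∀ x ∈ upperHalf i, Tendsto (fun m => g m x) atTop (𝓝 (G x)) := fun x hx =>
    tendsto_iff_norm_sub_tendsto_zero.2 (squeeze_zero (fun _ => norm_nonneg _)
      (fun m => hgd0 m x hx) hst)
  obtain ⟨C₄, hC₄, h₄⟩ := norm_coneField_le i hψc
  have hct : ∀ x ∈ upperHalf i,
      Tendsto (fun m => coneField i ψ (g m) x) atTop (𝓝 (coneField i ψ G x)) := fun x hx => by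
    refine tendsto_iff_norm_sub_tendsto_zero.2 (squeeze_zero (fun _ => norm_nonneg _)
      (g := fun m => C₄ * (M * s m ^ α) * hgt i x) (fun m => ?_) ?_)
    · rw [← coneField_sub i hψc (hg m).continuous hG.continuous]
      exact h₄ (fun y hy => hgd0 m y hy) x hx
    · simpa using (hst.const_mul C₄).mul_const (hgt i x)
  refine ⟨w, by exact_mod_cast hw, fun x hx => ?_, fun x hx => ?_,
    HolderBound.of_tendsto (fun m => h (hg m) hM (hgM m)) hlim', fun h => absurd h hsm⟩
  · exact tendsto_nhds_unique (tendsto_of_tendsto_iteratedFDeriv_zero (hlim' 0 (by omega) x hx))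
      ((hct x hx).const_smul (χ x))
  · have h1 := tendsto_fderiv_of_tendsto_iteratedFDeriv_one (hlim' 1 (by omega) x hx)
    have h2 := ((traceCLM n).continuous.tendsto _).comp h1
    refine tendsto_nhds_unique h2 (Tendsto.congr (fun m => (hdiv (hg m) x).symm) ?_)
    exact (((hgt' x hx).const_mul _).const_mul _).add
      (((fderiv ℝ χ x).continuous.tendsto _).comp (hct x hx))

end FlatField

section FlatSolver

variable {n : ℕ}

theorem exists_isTest (n : ℕ) : ∃ ψ : Euc n → ℝ, IsTest ψ ∧
    ∫ η in Metric.closedBall (0 : Euc n) 1, ψ η = 1 := by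
  let φ : ContDiffBump (0 : Euc n) := ⟨1 / 2, 1, by norm_num, by norm_num⟩
  refine ⟨φ.normed volume, ⟨φ.contDiff_normed, ?_⟩, ?_⟩
  · rw [φ.tsupport_normed_eq]
  · rw [setIntegral_eq_integral_of_forall_compl_eq_zero, φ.integral_normed]
    intro x hx
    by_contra h
    have : x ∈ Function.support (φ.normed volume) := h
    rw [φ.support_normed_eq] at this
    exact hx (Metric.ball_subset_closedBall this)

theorem HolderBound.univ_of_upperHalf {F : Type} [NormedAddCommGroup F] [NormedSpace ℝ F]
    {i : Fin n} {k : ℕ} {α M r : ℝ} (hα : α ∈ Ioo (0 : ℝ) 1) (hM : 0 ≤ M) (hr : 0 < r)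
    {u : Euc n → F} (hu : ∀ x, hgt i x < r → u x = 0) (h : HolderBound k α M (upperHalf i) u) :
    HolderBound k α (2 * M) univ u := by
  have hz : ∀ j x, hgt i x ≤ 0 → iteratedFDeriv ℝ j u x = 0 := by
    intro j x hx
    have e : u =ᶠ[𝓝 x] fun _ => 0 := by
      filter_upwards [(hgt i).continuous.continuousAt.eventually_lt_const (hx.trans_lt hr)] with y hy
      exact hu y hy
    rw [(e.iteratedFDeriv ℝ j).eq_of_nhds]
    simp
  have key : ∀ j ≤ k, ∀ x y, hgt i x ≤ 0 → 0 ≤ hgt i y →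
      ‖iteratedFDeriv ℝ j u x - iteratedFDeriv ℝ j u y‖ ≤ 2 * M * ‖x - y‖ ^ α := by
    intro j hj x y hx hy
    have hz0 : hgt i (horiz i x) = 0 := hgt_horiz _ _
    have h1 := h.holder j hj (horiz i x) hz0.ge y hy
    rw [hz j _ hz0.le] at h1
    rw [hz j x hx]
    have h2 : ‖horiz i x - y‖ ≤ 2 * ‖x - y‖ := by
      have h3 : horiz i x - y = x - y - hgt i x • vert i := by rw [horiz_apply]; abel
      have h4 := abs_hgt_le i (x - y)
      rw [map_sub] at h4
      rw [h3]
      refine (norm_sub_le _ _).trans ?_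
      rw [norm_smul, norm_vert, mul_one, Real.norm_eq_abs, abs_of_nonpos hx]
      have := neg_abs_le (hgt i x - hgt i y)
      linarith
    calc _ ≤ M * ‖horiz i x - y‖ ^ α := h1
      _ ≤ M * (2 ^ α * ‖x - y‖ ^ α) := by
        rw [← Real.mul_rpow (by norm_num) (norm_nonneg _)]
        exact mul_le_mul_of_nonneg_left (Real.rpow_le_rpow (norm_nonneg _) h2 hα.1.le) hM
      _ ≤ M * (2 * ‖x - y‖ ^ α) := by
        refine mul_le_mul_of_nonneg_left (mul_le_mul_of_nonneg_right ?_ (by positivity)) hM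
        simpa using Real.rpow_le_rpow_of_exponent_le (x := 2) (by norm_num) hα.2.le
      _ = _ := by ring
  refine ⟨fun j hj x _ => ?_, fun j hj x _ y _ => ?_⟩
  · rcases le_total (hgt i x) 0 with hx | hx
    · rw [hz j x hx, norm_zero]; positivity
    · linarith [h.bound j hj x hx]
  · rcases le_total (hgt i x) 0 with hx | hx <;> rcases le_total (hgt i y) 0 with hy | hy
    · rw [hz j x hx, hz j y hy, sub_zero, norm_zero]; positivity
    · exact key j hj x y hx hy
    · rw [norm_sub_rev, norm_sub_rev x]
      exact key j hj y x hy hx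
    · refine (h.holder j hj x hx y hy).trans (mul_le_mul_of_nonneg_right (by linarith) ?_)
      positivity

theorem coneField_support (i : Fin n) {ψ : Euc n → ℝ} {G : Euc n → ℝ} {q : Euc n} {r : ℝ}
    (hG : ∀ x ∈ upperHalf i, G x ≠ 0 → ‖x - q‖ ≤ r) {x : Euc n} (hx : x ∈ upperHalf i)
    (h : coneField i ψ G x ≠ 0) : ‖x - q‖ ≤ 4 * r + 3 * hgt i (x - q) := by
  obtain ⟨p, hp, hp0⟩ := coneField_ne_zero i ψ h
  have hx' : 0 ≤ hgt i x := hx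
  obtain ⟨hp1, hp2⟩ := hp
  rw [mem_closedBall_zero_iff] at hp2
  set y := x - (p.1 * hgt i x) • coneDir i p.2 with hy
  have hd : hgt i (coneDir i p.2) = 1 := by
    rw [coneDir, map_add, hgt_vert, hgt_horiz, add_zero]
  have hyt : hgt i y = hgt i x - p.1 * hgt i x := by
    rw [hy, map_sub, map_smul, hd, smul_eq_mul, mul_one]
  have hyu : y ∈ upperHalf i := by
    change 0 ≤ hgt i y
    rw [hyt]
    nlinarith [hp1.2]
  have hyq := hG y hyu hp0
  have h1 : |hgt i (y - q)| ≤ r := (abs_hgt_le i _).trans hyq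
  rw [map_sub, hyt] at h1
  have h2 := (abs_le.1 h1).1
  have hdn : ‖coneDir i p.2‖ ≤ 3 := by
    refine (norm_add_le _ _).trans ?_
    linarith [norm_vert i, norm_horiz_le i p.2]
  have e : x - q = (y - q) + (p.1 * hgt i x) • coneDir i p.2 := by rw [hy]; abel
  have h3 : 0 ≤ p.1 * hgt i x := mul_nonneg hp1.1 hx'
  rw [map_sub]
  calc ‖x - q‖ ≤ ‖y - q‖ + ‖(p.1 * hgt i x) • coneDir i p.2‖ := by rw [e]; exact norm_add_le _ _
    _ ≤ r + p.1 * hgt i x * 3 := by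
      rw [norm_smul, Real.norm_of_nonneg h3]
      gcongr
    _ ≤ _ := by linarith

theorem exists_bump (q : Euc n) {r R : ℝ} (hr : 0 < r) (hR : r < R) :
    ∃ b : Euc n → ℝ, ContDiff ℝ ∞ b ∧ HasCompactSupport b ∧ (∀ x, ‖x - q‖ ≤ r → b x = 1) ∧
      (∀ x, b x ≠ 0 → ‖x - q‖ < R) ∧ ∀ x, 0 ≤ b x ∧ b x ≤ 1 := by
  let b : ContDiffBump q := ⟨r, R, hr, hR⟩
  refine ⟨b, b.contDiff, b.hasCompactSupport,
    fun x hx => b.one_of_mem_closedBall (mem_closedBall_iff_norm.2 hx), fun x hx => ?_,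
    fun x => ⟨b.nonneg, b.le_one⟩⟩
  have : x ∈ Function.support b := hx
  rw [b.support_eq] at this
  exact mem_ball_iff_norm.1 this

theorem exists_slab_cutoff (i : Fin n) (q : Euc n) {r : ℝ} (hr : 0 < r) :
    ∃ χ : Euc n → ℝ, ContDiff ℝ ∞ χ ∧ HasCompactSupport χ ∧
      (∀ x, hgt i (x - q) ≤ r → ‖x - q‖ ≤ 11 * r → χ x = 1) ∧
      (∀ x, χ x ≠ 0 → hgt i (x - q) < 2 * r ∧ ‖x - q‖ < 16 * r) ∧ (∀ x, ‖χ x‖ ≤ 1) ∧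
      (∀ x, hgt i (x - q) < r → ‖x - q‖ < 11 * r → fderiv ℝ χ x = 0) ∧
      (∀ x, fderiv ℝ χ x ≠ 0 → hgt i (x - q) ≤ 2 * r ∧ ‖x - q‖ ≤ 16 * r) := by
  obtain ⟨b, hb, hbc, hb1, hb0, hbb⟩ :=
    exists_bump q (by positivity : 0 < 11 * r) (by linarith : 11 * r < 16 * r)
  let χ : Euc n → ℝ := fun x => Real.smoothTransition ((2 * r - hgt i (x - q)) / r) * b x
  have hχ : ContDiff ℝ ∞ χ := (Real.smoothTransition.contDiff.comp (by fun_prop)).mul hb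
  have hχc : HasCompactSupport χ := hbc.mul_left
  have hχ1 : ∀ x, hgt i (x - q) ≤ r → ‖x - q‖ ≤ 11 * r → χ x = 1 := by
    intro x h1 h2
    have e1 : b x = 1 := hb1 x h2
    have e2 : Real.smoothTransition ((2 * r - hgt i (x - q)) / r) = 1 :=
      Real.smoothTransition.one_of_one_le (by rw [le_div_iff₀ hr]; linarith)
    simp only [χ, e1, e2, mul_one]
  have hχ0 : ∀ x, χ x ≠ 0 → hgt i (x - q) < 2 * r ∧ ‖x - q‖ < 16 * r := by
    intro x hx
    constructor
    · by_contra! h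
      refine hx ?_
      have e2 : Real.smoothTransition ((2 * r - hgt i (x - q)) / r) = 0 :=
        Real.smoothTransition.zero_of_nonpos (div_nonpos_of_nonpos_of_nonneg (by linarith) hr.le)
      simp only [χ, e2, zero_mul]
    · exact hb0 x (right_ne_zero_of_mul hx)
  have hcont : Continuous fun x => hgt i (x - q) := by fun_prop
  have hdχ1 : ∀ x, hgt i (x - q) < r → ‖x - q‖ < 11 * r → fderiv ℝ χ x = 0 := by
    intro x h1 h2
    have e : χ =ᶠ[𝓝 x] fun _ => 1 := by
      have hn : Continuous fun x : Euc n => ‖x - q‖ := by fun_prop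
      filter_upwards [hcont.continuousAt.eventually_lt_const h1,
        hn.continuousAt.eventually_lt_const h2] with y hy hy2
      exact hχ1 y hy.le hy2.le
    rw [e.fderiv_eq, fderiv_fun_const]; rfl
  have hdχ0 : ∀ x, fderiv ℝ χ x ≠ 0 → hgt i (x - q) ≤ 2 * r ∧ ‖x - q‖ ≤ 16 * r := by
    intro x hx
    have h1 : x ∈ tsupport χ := support_fderiv_subset ℝ hx
    have h2 : closure (Function.support χ) ⊆ {x | hgt i (x - q) ≤ 2 * r ∧ ‖x - q‖ ≤ 16 * r} :=
      closure_minimal (fun y hy => ⟨(hχ0 y hy).1.le, (hχ0 y hy).2.le⟩)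
        ((isClosed_le hcont continuous_const).inter
          (isClosed_le (by fun_prop : Continuous fun x : Euc n => ‖x - q‖) continuous_const))
    exact h2 h1
  refine ⟨χ, hχ, hχc, hχ1, hχ0, fun x => ?_, hdχ1, hdχ0⟩
  rw [Real.norm_of_nonneg (mul_nonneg (Real.smoothTransition.nonneg _) (hbb x).1)]
  exact mul_le_one₀ (Real.smoothTransition.le_one _) (hbb x).1 (hbb x).2

theorem exists_flat_solver (i : Fin n) {α : ℝ} (hα : α ∈ Ioo (0 : ℝ) 1) (k : ℕ) {q : Euc n}
    (hq : 0 ≤ hgt i q) {r : ℝ} (hr : 0 < r) :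
    ∃ ρ : Euc n → ℝ, ContDiff ℝ ∞ ρ ∧ (∀ x, ρ x ≠ 0 → r ≤ hgt i x ∧ ‖x - q‖ ≤ 16 * r) ∧
    ∃ C : ℝ, 0 ≤ C ∧ ∀ {G : Euc n → ℝ} {M : ℝ}, ContDiff ℝ k G → HasCompactSupport G → 0 ≤ M →
      (∀ x ∈ upperHalf i, G x ≠ 0 → ‖x - q‖ ≤ r) → HolderBound k α M (upperHalf i) G →
      ∃ (w : Euc n → Euc n) (m : ℝ), ContDiff ℝ (k + 1) w ∧ |m| ≤ C * M ∧
        (∀ x ∈ upperHalf i, diver w x = G x + m * ρ x) ∧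
        (∀ x ∈ upperHalf i, ‖w x‖ ≤ C * M * hgt i x) ∧
        (∀ x ∈ upperHalf i, w x ≠ 0 → ‖x - q‖ ≤ 16 * r) ∧
        HolderBound (k + 1) α (C * M) (upperHalf i) w ∧ (ContDiff ℝ ∞ G → ContDiff ℝ ∞ w) := by
  obtain ⟨ψ, hψ, hψ1⟩ := exists_isTest n
  have hψc := hψ.contDiff.continuous
  obtain ⟨χ, hχ, hχc, hχ1, hχ0, hχn, hdχ1, hdχ0⟩ := exists_slab_cutoff i q hr
  obtain ⟨b₂, hb₂, hb₂c, hb₂1, -⟩ :=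
    exists_bump q (by positivity : 0 < 16 * r) (by linarith : 16 * r < 17 * r)
  obtain ⟨θ, hθ, hθ1, hθ0⟩ : ∃ θ : Euc n → ℝ, ContDiff ℝ ∞ θ ∧
      (∀ x, r / 2 ≤ hgt i x → θ x = 1) ∧ ∀ x, hgt i x < r / 4 → θ x = 0 := by
    refine ⟨fun x => Real.smoothTransition (4 * hgt i x / r - 1),
      Real.smoothTransition.contDiff.comp (by fun_prop), fun x hx => ?_, fun x hx => ?_⟩
    · refine Real.smoothTransition.one_of_one_le ?_
      rw [le_sub_iff_add_le, le_div_iff₀ hr]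
      linarith
    · refine Real.smoothTransition.zero_of_nonpos ?_
      rw [sub_nonpos, div_le_one hr]
      linarith
  obtain ⟨C₁, hC₁, h₁⟩ := exists_flat_field i hα k hψ hχ hχc
  obtain ⟨C₂, hC₂, h₂⟩ := exists_flat_field i hα k hψ hb₂ hb₂c
  obtain ⟨C₃, hC₃, h₃⟩ := norm_coneField_le i hψc
  have hdχs : ContDiff ℝ ∞ (fderiv ℝ χ) := hχ.fderiv_right (by simp)
  have hηs : ContDiff ℝ ∞ fun x => θ x • fderiv ℝ χ x := hθ.smul hdχs
  have hdχc : HasCompactSupport (fderiv ℝ χ) := hχc.fderiv (𝕜 := ℝ)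
  have hηc : HasCompactSupport fun x => θ x • fderiv ℝ χ x :=
    hdχc.mono fun x hx h0 => hx (by change θ x • fderiv ℝ χ x = 0; rw [h0, smul_zero])
  obtain ⟨K, hK, hηK⟩ := HolderBound.of_hasCompactSupport (k + 1) hα hηs hηc
  have hconv : Convex ℝ ({x | r ≤ hgt i (x - q) ∧ hgt i (x - q) ≤ 2 * r} ∩
      Metric.closedBall q (10 * r)) := by
    refine Convex.inter ?_ (convex_closedBall _ _)
    have : {x : Euc n | r ≤ hgt i (x - q) ∧ hgt i (x - q) ≤ 2 * r} =
        hgt i ⁻¹' Icc (r + hgt i q) (2 * r + hgt i q) := by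
      ext x
      simp only [map_sub, mem_preimage, mem_Icc, Set.mem_ofPred_eq]
      constructor <;> rintro ⟨h1, h2⟩ <;> constructor <;> linarith
    rw [this]
    exact (convex_Icc _ _).linear_preimage (hgt i).toLinearMap
  have hcv : hgt i (q + (3 / 2 * r) • vert i - q) = 3 / 2 * r := by
    rw [add_sub_cancel_left, map_smul, hgt_vert, smul_eq_mul, mul_one]
  have hcn : ‖(3 / 2 * r) • vert i‖ = 3 / 2 * r := by
    rw [norm_smul, norm_vert, mul_one, Real.norm_of_nonneg (by positivity)]
  have hcK : q + (3 / 2 * r) • vert i ∈ {x | r ≤ hgt i (x - q) ∧ hgt i (x - q) ≤ 2 * r} ∩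
      Metric.closedBall q (10 * r) := by
    refine ⟨⟨by rw [hcv]; linarith, by rw [hcv]; linarith⟩, mem_closedBall_iff_norm.2 ?_⟩
    rw [add_sub_cancel_left, hcn]
    linarith
  obtain ⟨ρ, hρ, hρs, C₄, hC₄, h₄⟩ := exists_diver_eq_sub_bump hα (half_pos hr) k hconv
    (Metric.isBounded_closedBall.subset inter_subset_right) hcK
  obtain ⟨N, hNe⟩ : ∃ N : ℝ, N = 2 * (2 ^ (k + 1 + 1) * ‖(ContinuousLinearMap.apply ℝ ℝ (E := Euc n)).flip‖ * K * C₂) := ⟨_, rfl⟩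
  have hN : 0 ≤ N := by rw [hNe]; positivity
  refine ⟨ρ, hρ, fun x hx => ?_, C₁ + C₄ * N + C₃ + C₄ * N * (2 / r), by positivity,
    fun {G M} hG hGc hM hGs hGM => ?_⟩
  · have h1 := hρs x hx
    have h2 := (abs_le.1 ((abs_hgt_le i _).trans h1)).1
    have e : x - q = (x - (q + (3 / 2 * r) • vert i)) + (3 / 2 * r) • vert i := by abel
    constructor
    · rw [map_sub, map_add, map_smul, hgt_vert, smul_eq_mul, mul_one] at h2
      linarith
    · rw [e]
      refine (norm_add_le _ _).trans ?_
      rw [hcn]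
      linarith
  obtain ⟨w₁, w₁k, w₁e, w₁d, w₁h, w₁s⟩ := h₁ hG hGc hM hGM
  obtain ⟨w₂, w₂k, w₂e, -, w₂h, w₂s⟩ := h₂ hG hGc hM hGM
  let h : Euc n → ℝ := fun x => (θ x • fderiv ℝ χ x) (w₂ x)
  have hcs : ∀ x ∈ upperHalf i, fderiv ℝ χ x (coneField i ψ G x) ≠ 0 →
      (r ≤ hgt i (x - q) ∧ hgt i (x - q) ≤ 2 * r) ∧ x ∈ Metric.closedBall q (10 * r) := by
    intro x hx hne
    have n1 : coneField i ψ G x ≠ 0 := fun h0 => hne (by rw [h0, map_zero])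
    have n2 : fderiv ℝ χ x ≠ 0 := fun h0 => hne (by rw [h0]; rfl)
    have s1 := coneField_support i hGs hx n1
    have s2 := hdχ0 x n2
    refine ⟨⟨?_, s2.1⟩, mem_closedBall_iff_norm.2 (by linarith)⟩
    by_contra! hlt
    exact n2 (hdχ1 x hlt (by linarith))
  have hh : ∀ x ∈ upperHalf i, h x = fderiv ℝ χ x (coneField i ψ G x) := by
    intro x hx
    change θ x * fderiv ℝ χ x (w₂ x) = _
    rw [w₂e x hx, map_smul, smul_eq_mul]
    by_cases hne : fderiv ℝ χ x (coneField i ψ G x) = 0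
    · rw [hne, mul_zero, mul_zero]
    have s1 := hcs x hx hne
    have e1 : b₂ x = 1 := hb₂1 x (by
      linarith [mem_closedBall_iff_norm.1 s1.2])
    have e2 : θ x = 1 := by
      have := s1.1.1
      rw [map_sub] at this
      exact hθ1 x (by linarith)
    rw [e1, e2, one_mul, one_mul]
  have hh0 : ∀ x, hgt i x < r / 4 → h x = 0 := by
    intro x hx
    simp only [h, hθ0 x hx, zero_smul]
    rfl
  have w₂k' : ContDiff ℝ ((k + 1 : ℕ) : WithTop ℕ∞) w₂ := by exact_mod_cast w₂k
  have hηk : ContDiff ℝ ((k + 1 : ℕ) : WithTop ℕ∞) fun x => θ x • fderiv ℝ χ x :=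
    hηs.of_le (by exact_mod_cast le_top)
  have hhk : ContDiff ℝ ((k + 1 : ℕ) : WithTop ℕ∞) h := hηk.clm_apply w₂k'
  have hhM : HolderBound (k + 1) α (N * M) univ h := by
    have a1 := (hηK.mono_set (subset_univ (upperHalf i))).bilinear
      (ContinuousLinearMap.apply ℝ ℝ (E := Euc n)).flip hK (by positivity) hηk w₂k' w₂h
    refine (HolderBound.univ_of_upperHalf hα (by positivity) (by positivity : 0 < r / 4) hh0
      a1).mono_const (le_of_eq ?_)
    rw [hNe]
    ring
  have hhs : ∀ x, h x ≠ 0 → x ∈ {x | r ≤ hgt i (x - q) ∧ hgt i (x - q) ≤ 2 * r} ∩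
      Metric.closedBall q (10 * r) := by
    intro x hne
    have hx : x ∈ upperHalf i := by
      by_contra hx
      have hx' : ¬ 0 ≤ hgt i x := hx
      exact hne (hh0 x (by linarith))
    rw [hh x hx] at hne
    exact hcs x hx hne
  obtain ⟨z, m, zk, zd, zs, zM, zsm⟩ := h₄ h hhk hhs
  obtain ⟨zm, zh⟩ := zM (N * M) (by positivity) hhM
  have w₁k' : ContDiff ℝ ((k + 1 : ℕ) : WithTop ℕ∞) w₁ := by exact_mod_cast w₁k
  have zt : ∀ x, z x ≠ 0 → r / 2 ≤ hgt i x ∧ ‖x - q‖ ≤ 16 * r := by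
    intro x hx
    obtain ⟨y, ⟨⟨y1, y2⟩, y3⟩, y4⟩ := zs x hx
    have h2 := (abs_le.1 ((abs_hgt_le i _).trans y4)).1
    have y3' := mem_closedBall_iff_norm.1 y3
    constructor
    · rw [map_sub] at h2 y1
      linarith
    · linarith [norm_sub_le_norm_sub_add_norm_sub x y q]
  have hC₃' : 0 ≤ C₃ * M := by positivity
  have hC₁' : 0 ≤ C₁ * M := by positivity
  have hC₄' : 0 ≤ C₄ * N * M := by positivity
  have hC₅' : 0 ≤ C₄ * N * (2 / r) * M := by positivity
  refine ⟨fun x => w₁ x - z x, m, by exact_mod_cast w₁k'.sub zk, ?_, fun x hx => ?_, fun x hx => ?_,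
    fun x hx hne => ?_, ?_, fun hs => (w₁s hs).sub (zsm (hηs.clm_apply (w₂s hs)))⟩
  · refine zm.trans ?_
    nlinarith
  · have e : diver (fun x => w₁ x - z x) x = diver w₁ x - diver z x := by
      simp only [diver_eq_traceCLM]
      rw [fderiv_fun_sub (w₁k'.differentiable (by simp) x) (zk.differentiable (by simp) x), map_sub]
    rw [e, w₁d x hx, zd, hh x hx, hψ1, one_mul]
    have e2 : χ x * G x = G x := by
      by_cases hGx : G x = 0
      · rw [hGx, mul_zero]
      · have h1 := hGs x hx hGx
        rw [hχ1 x ((le_abs_self _).trans ((abs_hgt_le i _).trans h1)) (by linarith), one_mul]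
    rw [e2]
    ring
  · have hx' : 0 ≤ hgt i x := hx
    have a1 : ‖w₁ x‖ ≤ C₃ * M * hgt i x := by
      rw [w₁e x hx, norm_smul]
      have c1 := h₃ (fun x hx => by simpa using hGM.bound 0 (Nat.zero_le k) x hx) x hx'
      have c2 := hχn x
      calc _ ≤ 1 * ‖coneField i ψ G x‖ := by gcongr
        _ ≤ _ := by linarith
    have a2 : ‖z x‖ ≤ C₄ * N * (2 / r) * M * hgt i x := by
      by_cases hz : z x = 0
      · rw [hz, norm_zero]
        positivity
      · have c1 : ‖z x‖ ≤ C₄ * (N * M) := by simpa using zh.bound 0 (by omega) x (mem_univ x)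
        have c2 := (zt x hz).1
        have c3 : 1 ≤ 2 / r * hgt i x := by
          rw [div_mul_eq_mul_div, le_div_iff₀ hr]; linarith
        calc ‖z x‖ ≤ C₄ * N * M * 1 := by linarith
          _ ≤ C₄ * N * M * (2 / r * hgt i x) := by gcongr
          _ = _ := by ring
    refine (norm_sub_le _ _).trans ?_
    have a3 := mul_nonneg hC₁' hx'
    have a4 := mul_nonneg hC₄' hx'
    linarith
  · by_cases hz : z x = 0
    · have : w₁ x ≠ 0 := fun h0 => hne (by simp [h0, hz])
      rw [w₁e x hx] at this
      exact (hχ0 x (left_ne_zero_of_smul this)).2.le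
    · exact (zt x hz).2
  · refine (w₁h.sub (by positivity) w₁k' zk (zh.mono_set (subset_univ _))).mono_const ?_
    linarith

end FlatSolver

section DivergenceTheorem

variable {n : ℕ}

theorem traceCLM_eq_sum (A : Euc n →L[ℝ] Euc n) :
    traceCLM n A = ∑ i, hgt i (A (vert i)) := by
  have e : A = ∑ i, (hgt i).smulRight (A (vert i)) := by
    ext1 u
    conv_lhs => rw [← sum_hgt_smul_vert u]
    simp only [map_sum, map_smul, sum_apply, ContinuousLinearMap.smulRight_apply]
  conv_lhs => rw [e]
  simp only [map_sum, traceCLM_smulRight]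

theorem integral_diver_eq_zero {v : Euc n → Euc n} (hv : ContDiff ℝ 1 v)
    (hc : HasCompactSupport v) : ∫ x, diver v x = 0 := by
  have hd : Continuous (fderiv ℝ v) := hv.continuous_fderiv (by simp)
  have hdc : HasCompactSupport (fderiv ℝ v) := hc.fderiv (𝕜 := ℝ)
  have hi : ∀ i, Integrable fun x => hgt i (fderiv ℝ v x (vert i)) := by
    intro i
    refine Continuous.integrable_of_hasCompactSupport (by fun_prop) ?_
    refine hdc.mono fun x hx h0 => hx ?_
    change hgt i (fderiv ℝ v x (vert i)) = 0
    rw [h0]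
    simp
  simp only [diver_eq_traceCLM, traceCLM_eq_sum]
  rw [integral_finsetSum _ fun i _ => hi i]
  refine Finset.sum_eq_zero fun i _ => ?_
  have hcomp : ∀ x, fderiv ℝ (fun x => hgt i (v x)) x = (hgt i).comp (fderiv ℝ v x) := fun x =>
    ((hgt i).hasFDerivAt.comp x (hv.differentiable (by simp) x).hasFDerivAt).fderiv
  have hvi : Integrable fun x => hgt i (v x) := by
    refine Continuous.integrable_of_hasCompactSupport (by fun_prop) ?_
    refine hc.mono fun x hx h0 => hx ?_
    change hgt i (v x) = 0
    rw [h0, map_zero]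
  have := integral_mul_fderiv_eq_neg_fderiv_mul_of_integrable (μ := (volume : Measure (Euc n)))
    (f := fun _ : Euc n => (1 : ℝ)) (g := fun x => hgt i (v x)) (v := vert i)
    (by simp) (by simpa [hcomp] using hi i) (by simpa using hvi) (by fun_prop)
    (by have := hv.differentiable (by simp); fun_prop)
  simpa [hcomp] using this

theorem exists_bound_deriv_smoothTransition :
    ∃ S : ℝ, 0 ≤ S ∧ ∀ t, |deriv Real.smoothTransition t| ≤ S := by
  have hc : Continuous (deriv Real.smoothTransition) :=
    (Real.smoothTransition.contDiff (n := 1)).continuous_deriv le_rfl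
  obtain ⟨S, hS⟩ := (isCompact_Icc (a := (0 : ℝ)) (b := 1)).exists_bound_of_continuousOn
    hc.continuousOn
  refine ⟨S, (norm_nonneg _).trans (hS 0 (by simp)), fun t => ?_⟩
  have hS0 : 0 ≤ S := (norm_nonneg _).trans (hS 0 (by simp))
  rcases lt_or_ge t 0 with h | h
  · have e : Real.smoothTransition =ᶠ[𝓝 t] fun _ => 0 := by
      filter_upwards [Iio_mem_nhds h] with s hs
      exact Real.smoothTransition.zero_of_nonpos (le_of_lt hs)
    rw [e.deriv_eq]
    simpa using hS0
  rcases lt_or_ge 1 t with h' | h'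
  · have e : Real.smoothTransition =ᶠ[𝓝 t] fun _ => 1 := by
      filter_upwards [Ioi_mem_nhds h'] with s hs
      exact Real.smoothTransition.one_of_one_le (le_of_lt hs)
    rw [e.deriv_eq]
    simpa using hS0
  · exact hS t ⟨h, h'⟩

theorem deriv_smoothTransition_of_one_lt {t : ℝ} (h : 1 < t) :
    deriv Real.smoothTransition t = 0 := by
  have e : Real.smoothTransition =ᶠ[𝓝 t] fun _ => 1 := by
    filter_upwards [Ioi_mem_nhds h] with s hs
    exact Real.smoothTransition.one_of_one_le (le_of_lt hs)
  rw [e.deriv_eq]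
  simp

theorem setIntegral_diver_eq_zero {Ω : Set (Euc n)} {Φ : Euc n → ℝ} {v : Euc n → Euc n} {C : ℝ}
    (hb : Bornology.IsBounded Ω) (hΦ : ContDiff ℝ ∞ Φ) (hΩ : Ω = {x | Φ x < 0})
    (hv : ContDiff ℝ 1 v) (hvΦ : ∀ x ∈ Ω, ‖v x‖ ≤ C * |Φ x|) :
    ∫ x in Ω, diver v x = 0 := by
  obtain ⟨S, hS0, hS⟩ := exists_bound_deriv_smoothTransition
  have hK : IsCompact (closure Ω) := hb.isCompact_closure
  have hΩo : IsOpen Ω := by rw [hΩ]; exact isOpen_lt hΦ.continuous continuous_const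
  have hneg : ∀ {x}, x ∈ Ω ↔ Φ x < 0 := by intro x; rw [hΩ]; rfl
  have hd : Continuous (fderiv ℝ v) := hv.continuous_fderiv (by simp)
  have hdΦ : Continuous (fderiv ℝ Φ) := hΦ.continuous_fderiv (by simp)
  have hdiv : Continuous (diver v) := (traceCLM n).continuous.comp hd
  obtain ⟨B, hB⟩ := hK.exists_bound_of_continuousOn hdiv.continuousOn
  obtain ⟨L, hL⟩ := hK.exists_bound_of_continuousOn hdΦ.continuousOn
  let s : ℕ → ℝ → ℝ := fun j t => Real.smoothTransition (-(j + 1) * t - 1)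
  let κ : ℕ → Euc n → ℝ := fun j x => s j (Φ x)
  have hsd : ∀ j t, HasDerivAt (s j) (-(j + 1) * deriv Real.smoothTransition (-(j + 1) * t - 1)) t := by
    intro j t
    have h1 : HasDerivAt (fun t : ℝ => -((j : ℝ) + 1) * t - 1) (-((j : ℝ) + 1)) t := by
      simpa using ((hasDerivAt_id t).const_mul (-((j : ℝ) + 1))).sub_const 1
    have h2 := ((Real.smoothTransition.contDiff (n := 1)).differentiable (by simp)
      (-((j : ℝ) + 1) * t - 1)).hasDerivAt
    refine (h2.comp t h1).congr_deriv ?_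
    ring
  have hκ : ∀ j, ContDiff ℝ 1 (κ j) := fun j =>
    (Real.smoothTransition.contDiff.comp (by fun_prop : ContDiff ℝ 1 fun t : ℝ =>
      -((j : ℝ) + 1) * t - 1)).comp (hΦ.of_le (by simp))
  have hκd : ∀ j x, fderiv ℝ (κ j) x =
      (-(j + 1) * deriv Real.smoothTransition (-(j + 1) * Φ x - 1)) • fderiv ℝ Φ x := by
    intro j x
    exact ((hsd j (Φ x)).comp_hasFDerivAt x (hΦ.differentiable (by simp) x).hasFDerivAt).fderiv
  have hκ0 : ∀ j x, κ j x ≠ 0 → Φ x ≤ -(1 / (j + 1)) := by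
    intro j x hx
    by_contra! h
    refine hx (Real.smoothTransition.zero_of_nonpos ?_)
    have hj : (0 : ℝ) < j + 1 := by positivity
    have : -(1 / ((j : ℝ) + 1)) * (j + 1) < Φ x * (j + 1) := by gcongr
    rw [neg_mul, one_div_mul_cancel hj.ne'] at this
    nlinarith
  let w : ℕ → Euc n → Euc n := fun j x => κ j x • v x
  have hws : ∀ j, tsupport (w j) ⊆ Ω ∧ HasCompactSupport (w j) := by
    intro j
    have h1 : tsupport (w j) ⊆ {x | Φ x ≤ -(1 / ((j : ℝ) + 1))} := by
      refine closure_minimal (fun x hx => hκ0 j x (left_ne_zero_of_smul hx)) ?_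
      exact isClosed_le hΦ.continuous continuous_const
    have h2 : tsupport (w j) ⊆ Ω := fun x hx => hneg.2 <| by
      have h3 : Φ x ≤ -(1 / ((j : ℝ) + 1)) := h1 hx
      have : (0 : ℝ) < 1 / (j + 1) := by positivity
      linarith
    exact ⟨h2, hK.of_isClosed_subset (isClosed_tsupport _) (h2.trans subset_closure)⟩
  have hwd : ∀ j x, diver (w j) x = κ j x * diver v x + fderiv ℝ (κ j) x (v x) := fun j x =>
    diver_smul ((hκ j).differentiable (by simp) x) (hv.differentiable (by simp) x)
  have hw0 : ∀ j, ∫ x in Ω, diver (w j) x = 0 := by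
    intro j
    rw [setIntegral_eq_integral_of_forall_compl_eq_zero,
      integral_diver_eq_zero (v := w j) ((hκ j).smul hv) (hws j).2]
    intro x hx
    have : fderiv ℝ (w j) x = 0 := by
      by_contra h
      exact hx ((hws j).1 (support_fderiv_subset ℝ h))
    rw [diver_eq_traceCLM, this, map_zero]
  have hC : ∀ x ∈ Ω, 0 ≤ C := by
    intro x hx
    by_contra! h
    have := (norm_nonneg _).trans (hvΦ x hx)
    nlinarith [abs_pos.2 (hneg.1 hx).ne]
  have hlim : Tendsto (fun j => ∫ x in Ω, diver (w j) x) atTop (𝓝 (∫ x in Ω, diver v x)) := by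
    refine tendsto_integral_of_dominated_convergence (fun _ => B + 2 * S * L * C) ?_ ?_ ?_ ?_
    · intro j
      have : Continuous (diver (w j)) :=
        (traceCLM n).continuous.comp (((hκ j).smul hv).continuous_fderiv (by simp))
      exact this.aestronglyMeasurable
    · refine integrableOn_const ?_
      exact hb.measure_lt_top.ne
    · refine fun j => (ae_restrict_iff' hΩo.measurableSet).2 (Eventually.of_forall fun x hx => ?_)
      have hxK := subset_closure hx
      rw [hwd, hκd]
      refine (norm_add_le _ _).trans (add_le_add ?_ ?_)
      · rw [norm_mul, Real.norm_of_nonneg (Real.smoothTransition.nonneg _)]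
        calc _ ≤ 1 * B := mul_le_mul (Real.smoothTransition.le_one _) (hB x hxK) (norm_nonneg _)
              zero_le_one
          _ = B := one_mul B
      · have hL0 : 0 ≤ L := (norm_nonneg _).trans (hL x hxK)
        have hj : (0 : ℝ) < j + 1 := by positivity
        rw [smul_apply, smul_eq_mul, norm_mul]
        rcases lt_or_ge 1 (-((j : ℝ) + 1) * Φ x - 1) with h1 | h1
        · rw [deriv_smoothTransition_of_one_lt h1]
          have := hC x hx
          simp only [mul_zero, norm_zero, zero_mul]
          positivity
        · rw [norm_mul, norm_neg, Real.norm_of_nonneg hj.le]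
          have h2 : ((j : ℝ) + 1) * |Φ x| ≤ 2 := by
            rw [abs_of_neg (hneg.1 hx)]
            linarith
          have hC' := hC x hx
          calc _ ≤ (((j : ℝ) + 1) * S) * (L * (C * |Φ x|)) := by
                gcongr
                · exact hS _
                · exact ((fderiv ℝ Φ x).le_opNorm _).trans (mul_le_mul (hL x hxK) (hvΦ x hx)
                    (norm_nonneg _) hL0)
            _ = (((j : ℝ) + 1) * |Φ x|) * (S * L * C) := by ring
            _ ≤ 2 * (S * L * C) := by gcongr
            _ = _ := by ring
    · refine (ae_restrict_iff' hΩo.measurableSet).2 (Eventually.of_forall fun x hx => ?_)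
      refine tendsto_const_nhds.congr' ?_
      obtain ⟨N, hN⟩ := exists_nat_gt (2 / -Φ x)
      filter_upwards [eventually_ge_atTop N] with j hj
      have hΦx : 0 < -Φ x := neg_pos.2 (hneg.1 hx)
      have h1 : 1 < -((j : ℝ) + 1) * Φ x - 1 := by
        rw [div_lt_iff₀ hΦx] at hN
        have : (N : ℝ) ≤ j := by exact_mod_cast hj
        nlinarith
      rw [hwd, hκd, deriv_smoothTransition_of_one_lt h1]
      have : κ j x = 1 := Real.smoothTransition.one_of_one_le h1.le
      rw [this]
      simp
  simp only [hw0] at hlim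
  exact (tendsto_nhds_unique hlim tendsto_const_nhds)

end DivergenceTheorem

section Connectivity

open scoped Manifold in
theorem exists_finite_partition {n : ℕ} {K : Set (Euc n)} (hK : IsCompact K)
    {U : Euc n → Set (Euc n)} (hU : ∀ x ∈ K, IsOpen (U x) ∧ x ∈ U x) :
    ∃ (t : Finset K) (χ : K → Euc n → ℝ),
      (∀ x, ContDiff ℝ ∞ (χ x)) ∧ (∀ x ∈ t, tsupport (χ x) ⊆ U x) ∧
      ∀ y ∈ K, ∑ x ∈ t, χ x y = 1 := by
  classical
  obtain ⟨t, ht⟩ := hK.elim_finite_subcover (fun x : K => U x) (fun x => (hU x x.2).1)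
    (fun x hx => mem_iUnion.2 ⟨⟨x, hx⟩, (hU x hx).2⟩)
  obtain ⟨f, hf⟩ := SmoothPartitionOfUnity.exists_isSubordinate 𝓘(ℝ, Euc n) hK.isClosed
    (fun x : t => U x.1) (fun x => (hU x.1 x.1.2).1) (by
      intro y hy
      obtain ⟨x, hx, hxy⟩ := mem_iUnion₂.1 (ht hy)
      exact mem_iUnion.2 ⟨⟨x, hx⟩, hxy⟩)
  refine ⟨t, fun x y => if h : x ∈ t then f ⟨x, h⟩ y else 0, fun x => ?_, fun x hx => ?_,
    fun y hy => ?_⟩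
  · by_cases h : x ∈ t
    · simpa only [h, dif_pos] using (f ⟨x, h⟩).contMDiff.contDiff
    · simpa only [h, dif_neg, not_false_eq_true] using contDiff_const
  · simpa only [hx, dif_pos] using hf ⟨x, hx⟩
  · have := f.sum_eq_one hy
    rw [finsum_eq_sum_of_fintype] at this
    rw [← Finset.sum_attach, ← this]
    refine Finset.sum_congr rfl fun x _ => ?_
    simp only [x.2, dif_pos]

/-- The function `h` is, up to a multiple of `ρ`, the divergence of a test field in `Ω`. -/
def IsDivMod {n : ℕ} (Ω : Set (Euc n)) (ρ h : Euc n → ℝ) : Prop :=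
  ∃ (V : Euc n → Euc n) (c : ℝ), ContDiff ℝ ∞ V ∧ HasCompactSupport V ∧ tsupport V ⊆ Ω ∧
    ∀ x, diver V x = h x - c * ρ x

variable {n : ℕ} {Ω : Set (Euc n)} {ρ h : Euc n → ℝ}

theorem diver_add {v w : Euc n → Euc n} {x : Euc n} (hv : DifferentiableAt ℝ v x)
    (hw : DifferentiableAt ℝ w x) : diver (fun x => v x + w x) x = diver v x + diver w x := by
  simp only [diver_eq_traceCLM, fderiv_fun_add hv hw, map_add]

theorem diver_const_smul {v : Euc n → Euc n} {x : Euc n} (hv : DifferentiableAt ℝ v x) (c : ℝ) :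
    diver (fun x => c • v x) x = c * diver v x := by
  simp only [diver_eq_traceCLM, fderiv_fun_const_smul hv c, map_smul, smul_eq_mul]

theorem diver_sum {ι : Type*} {t : Finset ι} {v : ι → Euc n → Euc n} {x : Euc n}
    (hv : ∀ i ∈ t, DifferentiableAt ℝ (v i) x) :
    diver (fun x => ∑ i ∈ t, v i x) x = ∑ i ∈ t, diver (v i) x := by
  simp only [diver_eq_traceCLM, fderiv_fun_sum hv, map_sum]

theorem IsDivMod.sum {ι : Type*} {t : Finset ι} {h : ι → Euc n → ℝ}
    (hh : ∀ i ∈ t, IsDivMod Ω ρ (h i)) : IsDivMod Ω ρ (fun x => ∑ i ∈ t, h i x) := by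
  classical
  induction t using Finset.induction_on with
  | empty =>
    refine ⟨fun _ => 0, 0, contDiff_const, HasCompactSupport.zero, ?_, fun x => ?_⟩
    · simp [tsupport]
    · simp [diver_eq_traceCLM]
  | insert i t hi ih =>
    obtain ⟨V, c, hV, hVc, hVs, hVd⟩ := hh i (Finset.mem_insert_self i t)
    obtain ⟨W, d, hW, hWc, hWs, hWd⟩ := ih fun j hj => hh j (Finset.mem_insert_of_mem hj)
    refine ⟨fun x => V x + W x, c + d, hV.add hW, hVc.add hWc,
      (tsupport_add V W).trans (union_subset hVs hWs), fun x => ?_⟩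
    rw [diver_add (hV.differentiable (by simp) x) (hW.differentiable (by simp) x), hVd, hWd]
    simp only [Finset.sum_insert hi]
    ring

theorem tsupport_subset_of_bounded {F : Type*} [NormedAddCommGroup F] {K : Set (Euc n)}
    (hK : IsCompact K) {z : Euc n → F} (hz : ∀ x, z x ≠ 0 → x ∈ K) :
    HasCompactSupport z ∧ tsupport z ⊆ K := by
  have h : tsupport z ⊆ K := closure_minimal (fun x hx => hz x hx) hK.isClosed
  exact ⟨hK.of_isClosed_subset (isClosed_tsupport _) h, h⟩

theorem exists_isDivMod_of_isConnected (hΩ : IsOpen Ω) (hc : IsConnected Ω) :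
    ∃ ρ : Euc n → ℝ, ContDiff ℝ ∞ ρ ∧ HasCompactSupport ρ ∧ tsupport ρ ⊆ Ω ∧
      ∀ h : Euc n → ℝ, ContDiff ℝ ∞ h → HasCompactSupport h → tsupport h ⊆ Ω →
        IsDivMod Ω ρ h := by
  have hα : (1 / 2 : ℝ) ∈ Ioo (0 : ℝ) 1 := by norm_num
  have hball : ∀ x ∈ Ω, ∃ R > 0, Metric.closedBall x (2 * R) ⊆ Ω := by
    intro x hx
    obtain ⟨ε, hε, h⟩ := Metric.nhds_basis_closedBall.mem_iff.1 (hΩ.mem_nhds hx)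
    exact ⟨ε / 2, half_pos hε, by rwa [mul_div_cancel₀ _ (two_ne_zero' ℝ)]⟩
  have step : ∀ x R, 0 < R → Metric.closedBall x (2 * R) ⊆ Ω → ∀ a ∈ Metric.closedBall x R, ∀ δ > 0,
      δ ≤ R → ∃ ρ : Euc n → ℝ, ContDiff ℝ ∞ ρ ∧ (∀ y, ρ y ≠ 0 → ‖y - a‖ ≤ δ) ∧
      ∀ h : Euc n → ℝ, ContDiff ℝ ∞ h → (∀ y, h y ≠ 0 → ‖y - x‖ ≤ R) → IsDivMod Ω ρ h := by
    intro x R hR hRΩ a ha δ hδ hδR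
    obtain ⟨ρ, hρ, hρs, C, -, H⟩ := exists_diver_eq_sub_bump hα hδ 0 (convex_closedBall x R)
      Metric.isBounded_closedBall ha
    refine ⟨ρ, hρ, hρs, fun h hh hhs => ?_⟩
    obtain ⟨z, m, -, zd, zs, -, zsm⟩ := H h (hh.of_le (by exact_mod_cast le_top))
      fun y hy => mem_closedBall_iff_norm.2 (hhs y hy)
    obtain ⟨z1, z2⟩ := tsupport_subset_of_bounded (isCompact_closedBall x (2 * R)) (z := z) (by
      intro y hy
      obtain ⟨y', h1, h2⟩ := zs y hy
      rw [mem_closedBall_iff_norm] at h1 ⊢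
      linarith [norm_sub_le_norm_sub_add_norm_sub y y' x])
    exact ⟨z, m, zsm hh, z1, z2.trans hRΩ, zd⟩
  obtain ⟨x₀, hx₀⟩ := hc.nonempty
  obtain ⟨R₀, hR₀, hR₀Ω⟩ := hball x₀ hx₀
  obtain ⟨ρ, hρ, hρs, hρ0⟩ := step x₀ R₀ hR₀ hR₀Ω x₀ (Metric.mem_closedBall_self hR₀.le) R₀ hR₀ le_rfl
  obtain ⟨hρc, hρt⟩ := tsupport_subset_of_bounded (isCompact_closedBall x₀ R₀)
    (fun y hy => mem_closedBall_iff_norm.2 (hρs y hy))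
  refine ⟨ρ, hρ, hρc, hρt.trans ((Metric.closedBall_subset_closedBall (by linarith)).trans hR₀Ω), ?_⟩
  let A : Set (Euc n) := {x | ∃ r > 0, ∀ h : Euc n → ℝ, ContDiff ℝ ∞ h →
    (∀ y, h y ≠ 0 → ‖y - x‖ ≤ r) → IsDivMod Ω ρ h}
  have hAo : IsOpen A := by
    refine Metric.isOpen_iff.2 fun x hx => ?_
    obtain ⟨r, hr, hx⟩ := hx
    refine ⟨r / 2, half_pos hr, fun x' hx' => ⟨r / 2, half_pos hr, fun h hh hhs => hx h hh ?_⟩⟩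
    intro y hy
    rw [mem_ball_iff_norm] at hx'
    linarith [hhs y hy, norm_sub_le_norm_sub_add_norm_sub y x' x]
  have hAΩ : Ω ⊆ A := by
    refine hc.isPreconnected.subset_of_closure_inter_subset hAo ⟨x₀, hx₀, R₀, hR₀, hρ0⟩ ?_
    rintro x ⟨hxA, hx⟩
    obtain ⟨R, hR, hRΩ⟩ := hball x hx
    obtain ⟨a, ⟨r, hr, ha⟩, hax⟩ := Metric.mem_closure_iff.1 hxA R hR
    obtain ⟨ρ', hρ', hρs', H⟩ := step x R hR hRΩ a
      (by rw [Metric.mem_closedBall, dist_comm]; exact hax.le) (min r R) (lt_min hr hR)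
      (min_le_right _ _)
    obtain ⟨V', c', hV', hVc', hVs', hVd'⟩ := ha ρ' hρ' fun y hy =>
      (hρs' y hy).trans (min_le_left _ _)
    refine ⟨R, hR, fun h hh hhs => ?_⟩
    obtain ⟨V, c, hV, hVc, hVs, hVd⟩ := H h hh hhs
    have hsub : Function.support (fun x => c • V' x) ⊆ Function.support V' := fun x hx h0 =>
      hx (by simp only [h0, smul_zero])
    refine ⟨fun x => V x + c • V' x, c * c', hV.add (hV'.const_smul c), hVc.add (hVc'.mono hsub),
      (tsupport_add _ _).trans (union_subset hVs ((closure_mono hsub).trans hVs')), fun y => ?_⟩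
    rw [diver_add (hV.differentiable (by simp) y) ((hV'.const_smul c).differentiable (by simp) y),
      diver_const_smul (hV'.differentiable (by simp) y), hVd, hVd']
    ring
  intro h hh hhc hhΩ
  have hA : ∀ x ∈ tsupport h, ∃ r > 0, ∀ h : Euc n → ℝ, ContDiff ℝ ∞ h →
    (∀ y, h y ≠ 0 → ‖y - x‖ ≤ r) → IsDivMod Ω ρ h := fun x hx => hAΩ (hhΩ hx)
  choose! r hr hA using hA
  obtain ⟨t, χ, hχ, hχs, hχ1⟩ := exists_finite_partition (K := tsupport h) hhc
    (U := fun x => Metric.ball x (r x))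
    fun x hx => ⟨Metric.isOpen_ball, Metric.mem_ball_self (hr x hx)⟩
  have e : h = fun y => ∑ x ∈ t, χ x y * h y := by
    ext y
    rw [← Finset.sum_mul]
    by_cases hy : h y = 0
    · rw [hy, mul_zero]
    · rw [hχ1 y (subset_tsupport h hy), one_mul]
  rw [e]
  refine IsDivMod.sum fun x hx => hA x x.2 _ ((hχ x).mul hh) fun y hy => ?_
  exact (mem_ball_iff_norm.1 (hχs x hx (subset_tsupport _ (left_ne_zero_of_mul hy)))).le

end Connectivity

theorem contDiff_of_forall_tsupport {E F : Type*} [NormedAddCommGroup E] [NormedSpace ℝ E]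
    [NormedAddCommGroup F] [NormedSpace ℝ F] {m : WithTop ℕ∞} {u : E → F}
    (h : ∀ x ∈ tsupport u, ContDiffAt ℝ m u x) : ContDiff ℝ m u := by
  refine contDiff_iff_contDiffAt.2 fun x => ?_
  by_cases hx : x ∈ tsupport u
  · exact h x hx
  · exact contDiffAt_const.congr_of_eventuallyEq (notMem_tsupport_iff_eventuallyEq.1 hx)

section Chart

variable {n : ℕ} (i : Fin n) (f : Euc n → ℝ)

/-- The map replacing the `i`-th coordinate by `f`. -/
def chartMap (x : Euc n) : Euc n := x + (f x - hgt i x) • vert i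

/-- The linear form measuring the deviation of the derivative of `chartMap` from the identity. -/
def chartForm (x : Euc n) : Euc n →L[ℝ] ℝ := fderiv ℝ f x - hgt i

/-- The cofactor matrix of `chartMap`. -/
def chartCof (x : Euc n) : Euc n →L[ℝ] Euc n :=
  fderiv ℝ f x (vert i) • ContinuousLinearMap.id ℝ (Euc n) - (chartForm i f x).smulRight (vert i)

theorem hgt_chartMap (x : Euc n) : hgt i (chartMap i f x) = f x := by
  simp [chartMap, hgt_vert]

variable {f}

theorem contDiff_chartMap (hf : ContDiff ℝ ∞ f) : ContDiff ℝ ∞ (chartMap i f) := by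
  unfold chartMap
  fun_prop

theorem hasFDerivAt_chartMap (hf : ContDiff ℝ ∞ f) (x : Euc n) :
    HasFDerivAt (chartMap i f)
      (ContinuousLinearMap.id ℝ (Euc n) + (chartForm i f x).smulRight (vert i)) x :=
  (hasFDerivAt_id x).add (((hf.differentiable (by simp) x).hasFDerivAt.sub
    (hgt i).hasFDerivAt).smul_const (vert i))

theorem contDiff_chartCof (hf : ContDiff ℝ ∞ f) : ContDiff ℝ ∞ (chartCof i f) := by
  have hd : ContDiff ℝ ∞ (fderiv ℝ f) := hf.fderiv_right (by simp)
  have h1 : ContDiff ℝ ∞ fun x => fderiv ℝ f x (vert i) := hd.clm_apply contDiff_const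
  have h2 : ContDiff ℝ ∞ fun x => (chartForm i f x).smulRight (vert i) :=
    ((ContinuousLinearMap.smulRightL ℝ (Euc n) (Euc n)).flip (vert i)).contDiff.comp
      (hd.sub contDiff_const)
  exact (h1.smul contDiff_const).sub h2

theorem diver_chartCof_comp (hf : ContDiff ℝ ∞ f) {w : Euc n → Euc n} {x : Euc n}
    (hw : DifferentiableAt ℝ w (chartMap i f x)) :
    diver (fun x => chartCof i f x (w (chartMap i f x))) x =
      fderiv ℝ f x (vert i) * diver w (chartMap i f x) := by
  have hd : ContDiff ℝ ∞ (fderiv ℝ f) := hf.fderiv_right (by simp)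
  have hD : HasFDerivAt (fderiv ℝ f) (fderiv ℝ (fderiv ℝ f) x) x :=
    (hd.differentiable (by simp) x).hasFDerivAt
  have hsymm : ∀ u v, fderiv ℝ (fderiv ℝ f) x u v = fderiv ℝ (fderiv ℝ f) x v u := fun u v =>
    (hf.contDiffAt.isSymmSndFDerivAt (by simp only [minSmoothness_of_isRCLikeNormedField]; exact WithTop.coe_le_coe.2 (le_top : (2 : ℕ∞) ≤ ⊤))).eq u v
  set A := fderiv ℝ w (chartMap i f x) with hA
  set ℓ := chartForm i f x with hℓ
  set e := vert i with he
  have hℓe : ℓ e = fderiv ℝ f x e - 1 := by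
    rw [hℓ, chartForm, sub_apply, he, hgt_vert]
  have hW : HasFDerivAt (fun x => w (chartMap i f x))
      (A.comp (ContinuousLinearMap.id ℝ (Euc n) + ℓ.smulRight e)) x :=
    hw.hasFDerivAt.comp x (hasFDerivAt_chartMap i hf x)
  have hJ : HasFDerivAt (fun x => fderiv ℝ f x e) ((fderiv ℝ (fderiv ℝ f) x).flip e) x :=
    (hD.clm_apply (hasFDerivAt_const e x)).congr_fderiv (by ext1 v; simp)
  have hL : HasFDerivAt (fun x => chartForm i f x) (fderiv ℝ (fderiv ℝ f) x) x :=
    hD.sub_const (hgt i)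
  have key := (hJ.fun_smul hW).fun_sub ((hL.clm_apply hW).smul_const e)
  have ef : (fun x => chartCof i f x (w (chartMap i f x))) = fun x =>
      fderiv ℝ f x e • w (chartMap i f x) - chartForm i f x (w (chartMap i f x)) • e := by
    ext1 y
    simp [chartCof, he]
  have hcomp : A.comp (ContinuousLinearMap.id ℝ (Euc n) + ℓ.smulRight e) =
      A + ℓ.smulRight (A e) := by
    ext1 v; simp
  rw [ef, diver_eq_traceCLM, key.fderiv, diver_eq_traceCLM, ← hA, hcomp]
  simp only [map_sub, map_add, map_smul, traceCLM_smulRight, smul_eq_mul, add_apply,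
    ContinuousLinearMap.comp_apply, ContinuousLinearMap.flip_apply,
    ContinuousLinearMap.smulRight_apply, hℓe, hsymm e (w _), ← hℓ]
  ring

/-- The derivative of `chartMap` as an equivalence where its Jacobian does not vanish. -/
def chartEquiv (f : Euc n → ℝ) (x : Euc n) (hx : fderiv ℝ f x (vert i) ≠ 0) :
    Euc n ≃L[ℝ] Euc n :=
  ContinuousLinearEquiv.equivOfInverse
    (ContinuousLinearMap.id ℝ (Euc n) + (chartForm i f x).smulRight (vert i))
    (ContinuousLinearMap.id ℝ (Euc n) -
      ((fderiv ℝ f x (vert i))⁻¹ • chartForm i f x).smulRight (vert i))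
    (by
      intro u
      have : chartForm i f x (vert i) = fderiv ℝ f x (vert i) - 1 := by
        rw [chartForm, sub_apply, hgt_vert]
      simp only [add_apply, sub_apply, ContinuousLinearMap.smulRight_apply,
        ContinuousLinearMap.id_apply, smul_apply, map_add, map_smul, this, smul_eq_mul]
      match_scalars <;> field_simp
      ring)
    (by
      intro u
      have : chartForm i f x (vert i) = fderiv ℝ f x (vert i) - 1 := by
        rw [chartForm, sub_apply, hgt_vert]
      simp only [add_apply, sub_apply, ContinuousLinearMap.smulRight_apply,
        ContinuousLinearMap.id_apply, smul_apply, map_sub, map_smul, this, smul_eq_mul]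
      match_scalars <;> field_simp
      ring)

theorem hasFDerivAt_chartMap_equiv (hf : ContDiff ℝ ∞ f) {x : Euc n}
    (hx : fderiv ℝ f x (vert i) ≠ 0) :
    HasFDerivAt (chartMap i f) (chartEquiv i f x hx : Euc n →L[ℝ] Euc n) x :=
  hasFDerivAt_chartMap i hf x

/-- Near a point where its Jacobian does not vanish, `chartMap` has a smooth left and right
inverse, defined on the whole space. -/
theorem exists_chart_inverse (hf : ContDiff ℝ ∞ f) {p : Euc n}
    (hp : fderiv ℝ f p (vert i) ≠ 0) :
    ∃ ϑ : Euc n → Euc n, ContDiff ℝ ∞ ϑ ∧ (∀ᶠ x in 𝓝 p, ϑ (chartMap i f x) = x) ∧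
      ∀ᶠ y in 𝓝 (chartMap i f p), chartMap i f (ϑ y) = y := by
  set q := chartMap i f p with hq
  have hφ := contDiff_chartMap i hf
  have hc : ContDiffAt ℝ ∞ (chartMap i f) p := hφ.contDiffAt
  let e := hc.toOpenPartialHomeomorph (chartMap i f) (hasFDerivAt_chartMap_equiv i hf hp) (by simp)
  have he : ∀ x, e x = chartMap i f x := fun x => rfl
  have hps : p ∈ e.source := hc.mem_toOpenPartialHomeomorph_source _ _
  have hqt : q ∈ e.target := hc.image_mem_toOpenPartialHomeomorph_target _ _
  have hsq : e.symm q = p := e.left_inv hps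
  have hJ : Continuous fun x => fderiv ℝ f x (vert i) :=
    ((hf.fderiv_right (m := ∞) (by simp)).clm_apply contDiff_const).continuous
  have hev : ∀ᶠ y in 𝓝 q, y ∈ e.target ∧ fderiv ℝ f (e.symm y) (vert i) ≠ 0 := by
    refine Filter.Eventually.and (e.open_target.mem_nhds hqt) ?_
    have h1 : ContinuousAt (fun y => fderiv ℝ f (e.symm y) (vert i)) q :=
      hJ.continuousAt.comp (e.continuousAt_symm hqt)
    refine h1.eventually_ne ?_
    rwa [hsq]
  obtain ⟨R, hR, hRs⟩ := Metric.nhds_basis_closedBall.mem_iff.1 hev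
  obtain ⟨κ, hκ, -, hκ1, hκ0, -⟩ := exists_bump q (half_pos hR) (half_lt_self hR)
  have hκR : tsupport κ ⊆ Metric.closedBall q R :=
    closure_minimal (fun x hx => mem_closedBall_iff_norm.2 (hκ0 x hx).le) Metric.isClosed_closedBall
  have hsm : ContDiff ℝ ∞ fun y => κ y • (e.symm y - p) := by
    refine contDiff_of_forall_tsupport fun y hy => ?_
    have hy' := hRs (hκR (tsupport_smul_subset_left κ _ hy))
    exact hκ.contDiffAt.smul ((e.contDiffAt_symm hy'.1 (hasFDerivAt_chartMap_equiv i hf hy'.2)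
      hφ.contDiffAt).sub contDiffAt_const)
  have hone : ∀ᶠ y in 𝓝 q, p + κ y • (e.symm y - p) = e.symm y := by
    filter_upwards [Metric.closedBall_mem_nhds q (half_pos hR)] with y hy
    rw [hκ1 y (mem_closedBall_iff_norm.1 hy), one_smul, add_sub_cancel]
  refine ⟨fun y => p + κ y • (e.symm y - p), contDiff_const.add hsm, ?_, ?_⟩
  · filter_upwards [hφ.continuous.continuousAt.eventually hone, e.open_source.mem_nhds hps]
      with x hx hxs
    rw [hx]
    exact e.left_inv hxs
  · filter_upwards [hone, e.open_target.mem_nhds hqt] with y hy hyt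
    rw [hy]
    exact e.right_inv hyt

end Chart

section Transport

variable {E F G H Q : Type} [NormedAddCommGroup E] [NormedSpace ℝ E]
  [NormedAddCommGroup F] [NormedSpace ℝ F] [NormedAddCommGroup G] [NormedSpace ℝ G]
  [NormedAddCommGroup H] [NormedSpace ℝ H] [NormedAddCommGroup Q] [NormedSpace ℝ Q]

/-- Bounds on the derivatives of order at most `k` and on the Hölder seminorm of the `k`-th one. -/
structure TopHolderBound (k : ℕ) (α M : ℝ) (A : Set E) (u : E → F) : Prop where
  bound : ∀ j ≤ k, ∀ x ∈ A, ‖iteratedFDeriv ℝ j u x‖ ≤ M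
  holder : ∀ x ∈ A, ∀ y ∈ A,
    ‖iteratedFDeriv ℝ k u x - iteratedFDeriv ℝ k u y‖ ≤ M * ‖x - y‖ ^ α

theorem exists_bound_fderiv_of_isBounded [FiniteDimensional ℝ E] {φ : E → F} (hφ : ContDiff ℝ ∞ φ) {A : Set E}
    (hA : Bornology.IsBounded A) : ∃ L, 0 ≤ L ∧ ∀ x ∈ A, ‖fderiv ℝ φ x‖ ≤ L := by
  obtain ⟨M, hM, h⟩ := HolderBound.of_contDiff (α := 1 / 2) 0 (by norm_num)
    (hφ.fderiv_right (m := ∞) (by simp)) hA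
  exact ⟨M, hM, fun x hx => by simpa using h.bound 0 le_rfl x hx⟩

theorem exists_lipschitz_of_isBounded [FiniteDimensional ℝ E] {φ : E → F} (hφ : ContDiff ℝ ∞ φ) {A : Set E}
    (hA : Bornology.IsBounded A) :
    ∃ L, 0 ≤ L ∧ ∀ x ∈ A, ∀ y ∈ A, ‖φ x - φ y‖ ≤ L * ‖x - y‖ := by
  obtain ⟨R, hR⟩ := hA.subset_closedBall 0
  obtain ⟨L, hL, h⟩ := exists_bound_fderiv_of_isBounded hφ
    (Metric.isBounded_closedBall (x := (0 : E)) (r := R))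
  exact ⟨L, hL, fun x hx y hy => Convex.norm_image_sub_le_of_norm_fderiv_le
    (fun z _ => hφ.differentiable (by simp) z) h (convex_closedBall 0 R) (hR hy) (hR hx)⟩

theorem TopHolderBound.image {k : ℕ} {α L₁ L₂ M : ℝ} {A : Set E} {ϑ : E → Q}
    (hα : α ∈ Ioo (0 : ℝ) 1) (hA : Convex ℝ A) (hϑ : Differentiable ℝ ϑ) (hL₁ : 0 ≤ L₁)
    (hL₂ : 0 ≤ L₂) (hM : 0 ≤ M) (h1 : ∀ a ∈ A, ‖fderiv ℝ ϑ a‖ ≤ L₁)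
    (h2 : ∀ a ∈ A, ∀ b ∈ A, ‖a - b‖ ≤ L₂ * ‖ϑ a - ϑ b‖) {u : Q → F} (hu : ContDiff ℝ k u)
    (h : TopHolderBound k α M (ϑ '' A) u) :
    HolderBound k α ((2 + L₁ * L₂) * M) (ϑ '' A) u := by
  have hc : M ≤ (2 + L₁ * L₂) * M := by nlinarith [mul_nonneg hL₁ hL₂]
  refine ⟨fun j hj x hx => (h.1 j hj x hx).trans hc, fun j hj x hx y hy => ?_⟩
  rcases hj.eq_or_lt with rfl | hlt
  · exact (h.2 x hx y hy).trans (by gcongr)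
  have hb := fun z hz => h.1 (j + 1) hlt z hz
  have hd : Differentiable ℝ (iteratedFDeriv ℝ j u) :=
    hu.differentiable_iteratedFDeriv (by exact_mod_cast hlt)
  obtain ⟨a, ha, rfl⟩ := hx
  obtain ⟨b, hb', rfl⟩ := hy
  have l1 : ‖iteratedFDeriv ℝ j u (ϑ a) - iteratedFDeriv ℝ j u (ϑ b)‖ ≤ (M * L₁) * ‖a - b‖ := by
    refine Convex.norm_image_sub_le_of_norm_hasFDerivWithin_le
      (f := fun a => iteratedFDeriv ℝ j u (ϑ a)) (s := A)
      (f' := fun a => (fderiv ℝ (iteratedFDeriv ℝ j u) (ϑ a)).comp (fderiv ℝ ϑ a))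
      (fun z hz => ((hd (ϑ z)).hasFDerivAt.comp z (hϑ z).hasFDerivAt).hasFDerivWithinAt)
      (fun z hz => ?_) hA hb' ha
    refine (ContinuousLinearMap.opNorm_comp_le _ _).trans ?_
    rw [norm_fderiv_iteratedFDeriv]
    exact mul_le_mul (hb _ (mem_image_of_mem ϑ hz)) (h1 z hz) (norm_nonneg _) hM
  rcases le_or_gt ‖ϑ a - ϑ b‖ 1 with h3 | h3
  · have h4 : ‖ϑ a - ϑ b‖ ≤ ‖ϑ a - ϑ b‖ ^ α := by
      conv_lhs => rw [← Real.rpow_one ‖ϑ a - ϑ b‖]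
      exact Real.rpow_le_rpow_of_exponent_ge' (norm_nonneg _) h3 hα.1.le hα.2.le
    calc _ ≤ (M * L₁) * (L₂ * ‖ϑ a - ϑ b‖) := l1.trans (by gcongr; exact h2 a ha b hb')
      _ ≤ (M * L₁) * (L₂ * ‖ϑ a - ϑ b‖ ^ α) := by gcongr
      _ = (L₁ * L₂ * M) * ‖ϑ a - ϑ b‖ ^ α := by ring
      _ ≤ _ := by
        gcongr
        linarith
  · have h4 : 1 ≤ ‖ϑ a - ϑ b‖ ^ α := Real.one_le_rpow h3.le hα.1.le
    calc _ ≤ M + M := (norm_sub_le _ _).trans (add_le_add (h.1 j hj _ (mem_image_of_mem ϑ ha))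
          (h.1 j hj _ (mem_image_of_mem ϑ hb')))
      _ = (2 * M) * 1 := by ring
      _ ≤ (2 * M) * ‖ϑ a - ϑ b‖ ^ α := by gcongr
      _ ≤ _ := by
        gcongr
        nlinarith [mul_nonneg (mul_nonneg hL₁ hL₂) hM]

theorem TopHolderBound.mono_set {k : ℕ} {α M : ℝ} {A B : Set E} {u : E → F}
    (h : TopHolderBound k α M A u) (hBA : B ⊆ A) : TopHolderBound k α M B u :=
  ⟨fun j hj x hx => h.1 j hj x (hBA hx), fun x hx y hy => h.2 x (hBA hx) y (hBA hy)⟩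

theorem HolderBound.exists_transport [FiniteDimensional ℝ E] (k : ℕ) {α : ℝ}
    (hα : α ∈ Ioo (0 : ℝ) 1) (B : F →L[ℝ] G →L[ℝ] H)
    {Λ : E → F} (hΛ : ContDiff ℝ ∞ Λ) {φ : E → Q} (hφ : ContDiff ℝ ∞ φ) {p : E} {s : ℝ}
    (hs : 0 < s) (hΛs : ∀ x, Λ x ≠ 0 → ‖x - p‖ ≤ s) {D : Set E} {T : Set Q}
    (hm : MapsTo φ (D ∩ Metric.ball p (2 * s)) T) :
    ∃ C, 0 ≤ C ∧ ∀ (w : Q → G) (M : ℝ), 0 ≤ M → ContDiff ℝ k w → HolderBound k α M T w →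
      HolderBound k α (C * M) D fun x => B (Λ x) (w (φ x)) := by
  have hb : Bornology.IsBounded (D ∩ Metric.ball p (2 * s)) :=
    Metric.isBounded_ball.subset inter_subset_right
  obtain ⟨L, hL, hL'⟩ := exists_lipschitz_of_isBounded hφ hb
  obtain ⟨K, hK, hK'⟩ := HolderBound.of_contDiff k hα (hφ.fderiv_right (m := ∞) (by simp)) hb
  obtain ⟨N, hN, hN'⟩ := HolderBound.of_contDiff k hα hΛ hb
  obtain ⟨C, hC, h⟩ := HolderBound.comp k hα.1.le hL hK
    (hφ.of_le (by exact_mod_cast le_top)) hm hL' hK'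
  have hsα : 0 ≤ (s ^ α)⁻¹ := by positivity
  refine ⟨(1 + (s ^ α)⁻¹) * (2 ^ (k + 1) * ‖B‖ * N * C), by positivity, fun w M hM hw hwM => ?_⟩
  have h1 := hN'.bilinear B hN (by positivity) (hΛ.of_le (by exact_mod_cast le_top))
    (hw.comp (hφ.of_le (by exact_mod_cast le_top))) (h G w M hM hw hwM)
  refine (HolderBound.of_tsupport_subset hs hα.1.le (by positivity) ?_ h1).mono_const
    (le_of_eq (by ring))
  refine closure_minimal (fun x hx => mem_closedBall_iff_norm.2 (hΛs x fun h0 => hx ?_))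
    Metric.isClosed_closedBall
  change B (Λ x) (w (φ x)) = 0
  rw [h0]
  simp

end Transport

section LocalSolver

variable {n : ℕ}

theorem convex_upperHalf (i : Fin n) : Convex ℝ (upperHalf i) :=
  (convex_Ici (0 : ℝ)).linear_preimage (hgt i).toLinearMap

/-- Pulling back a function on `D` to the half space through a chart. -/
theorem exists_holderBound_pullback (i : Fin n) {α : ℝ} (hα : α ∈ Ioo (0 : ℝ) 1) (k : ℕ)
    {φ ϑ : Euc n → Euc n} (hφ : ContDiff ℝ ∞ φ) (hϑ : ContDiff ℝ ∞ ϑ) {q : Euc n} {r : ℝ}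
    (hr : 0 < r) {D : Set (Euc n)} (hm : MapsTo ϑ (upperHalf i ∩ Metric.ball q (2 * r)) D)
    (hinv : ∀ y ∈ Metric.ball q (2 * r), φ (ϑ y) = y) {a : Euc n → ℝ} (ha : ContDiff ℝ ∞ a)
    (has : ∀ y, a y ≠ 0 → ‖y - q‖ ≤ r) :
    ∃ C, 0 ≤ C ∧ ∀ (g : Euc n → ℝ) (M : ℝ), 0 ≤ M → ContDiff ℝ k g → TopHolderBound k α M D g →
      HolderBound k α (C * M) (upperHalf i) fun y => a y * g (ϑ y) := by
  set A := upperHalf i ∩ Metric.ball q (2 * r) with hA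
  have hAb : Bornology.IsBounded A := Metric.isBounded_ball.subset inter_subset_right
  obtain ⟨L₀, -, hL₀⟩ := exists_lipschitz_of_isBounded hϑ hAb
  obtain ⟨L₁, hL₁, hϑL⟩ := exists_bound_fderiv_of_isBounded hϑ hAb
  have hϑb : Bornology.IsBounded (ϑ '' A) := by
    have : Bornology.IsBounded (ϑ '' Metric.closedBall q (2 * r)) :=
      ((isCompact_closedBall q (2 * r)).image hϑ.continuous).isBounded
    exact this.subset (image_mono (inter_subset_right.trans Metric.ball_subset_closedBall))
  obtain ⟨L₂, hL₂, hφL⟩ := exists_lipschitz_of_isBounded hφ hϑb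
  obtain ⟨C, hC, h⟩ := HolderBound.exists_transport k hα (ContinuousLinearMap.mul ℝ ℝ) ha hϑ hr has
    (D := upperHalf i) (T := ϑ '' A) (mapsTo_image ϑ A)
  refine ⟨C * (2 + L₁ * L₂), by positivity, fun g M hM hg hgM => ?_⟩
  have h1 : HolderBound k α ((2 + L₁ * L₂) * M) (ϑ '' A) g := by
    refine TopHolderBound.image hα ((convex_upperHalf i).inter (convex_ball q _))
      (hϑ.differentiable (by simp)) hL₁ hL₂ hM hϑL (fun x hx y hy => ?_) hg
      (hgM.mono_set hm.image_subset)
    have := hφL (ϑ x) (mem_image_of_mem ϑ hx) (ϑ y) (mem_image_of_mem ϑ hy)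
    rwa [hinv x hx.2, hinv y hy.2] at this
  rw [mul_assoc]
  exact h g _ (by positivity) hg h1

theorem exists_local_solver (i : Fin n) {α : ℝ} (hα : α ∈ Ioo (0 : ℝ) 1) (k : ℕ)
    {Ω D : Set (Euc n)} {Φ f : Euc n → ℝ} {p : Euc n} {C₀ : ℝ} (hC₀ : 0 ≤ C₀) (hΩD : Ω ⊆ D)
    (hf : ContDiff ℝ ∞ f) (hJ : fderiv ℝ f p (vert i) ≠ 0) (hp : 0 ≤ f p)
    (hloc : ∀ᶠ x in 𝓝 p, (x ∈ D ↔ 0 ≤ f x) ∧ (0 < f x → x ∈ Ω) ∧ (x ∈ D → f x ≤ C₀ * |Φ x|)) :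
    ∃ U : Set (Euc n), IsOpen U ∧ p ∈ U ∧
    ∃ R : Euc n → ℝ, ContDiff ℝ ∞ R ∧ HasCompactSupport R ∧ tsupport R ⊆ Ω ∧
    ∀ χ : Euc n → ℝ, ContDiff ℝ ∞ χ → tsupport χ ⊆ U →
    ∃ C : ℝ, 0 ≤ C ∧ ∀ (g : Euc n → ℝ) (M : ℝ), ContDiff ℝ k g → 0 ≤ M →
      TopHolderBound k α M D g →
      ∃ (v : Euc n → Euc n) (m C' : ℝ), ContDiff ℝ (k + 1 : ℕ) v ∧ |m| ≤ C * M ∧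
        HolderBound (k + 1) α (C * M) D v ∧ (∀ x ∈ Ω, diver v x = χ x * g x + m * R x) ∧
        (∀ x ∈ D, ‖v x‖ ≤ C' * |Φ x|) ∧ (ContDiff ℝ ∞ g → ContDiff ℝ ∞ v) := by
  have hφ := contDiff_chartMap i hf
  have hφf := hgt_chartMap i f
  have hcof := contDiff_chartCof i hf
  have hdiv := fun (w : Euc n → Euc n) (x : Euc n) (hw : Differentiable ℝ w) =>
    diver_chartCof_comp i hf (hw (chartMap i f x))
  have hJs : ContDiff ℝ ∞ fun x => fderiv ℝ f x (vert i) :=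
    (hf.fderiv_right (m := ∞) (by simp)).clm_apply contDiff_const
  obtain ⟨ϑ, hϑ, hϑφ, hφϑ⟩ := exists_chart_inverse i hf hJ
  generalize chartMap i f = φ at hφ hφf hcof hdiv hϑφ hφϑ
  generalize chartCof i f = Λ at hcof hdiv
  set J : Euc n → ℝ := fun x => fderiv ℝ f x (vert i) with hJdef
  obtain ⟨s₀, hs₀, hs₀'⟩ := Metric.nhds_basis_ball.mem_iff.1
    (hloc.and (hϑφ.and (hJs.continuous.continuousAt.eventually_ne hJ)))
  obtain ⟨s, hs, rfl⟩ : ∃ s > 0, s₀ = 2 * s := ⟨s₀ / 2, half_pos hs₀, by ring⟩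
  have hD : ∀ x, ‖x - p‖ < 2 * s → (x ∈ D ↔ 0 ≤ f x) := fun x hx =>
    (hs₀' (mem_ball_iff_norm.2 hx)).1.1
  have hΩ : ∀ x, ‖x - p‖ < 2 * s → 0 < f x → x ∈ Ω := fun x hx =>
    (hs₀' (mem_ball_iff_norm.2 hx)).1.2.1
  have hΦ : ∀ x, ‖x - p‖ < 2 * s → x ∈ D → f x ≤ C₀ * |Φ x| := fun x hx =>
    (hs₀' (mem_ball_iff_norm.2 hx)).1.2.2
  have hinv : ∀ x, ‖x - p‖ < 2 * s → ϑ (φ x) = x := fun x hx =>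
    (hs₀' (mem_ball_iff_norm.2 hx)).2.1
  have hJ0 : ∀ x, ‖x - p‖ < 2 * s → J x ≠ 0 := fun x hx =>
    (hs₀' (mem_ball_iff_norm.2 hx)).2.2
  have hpp : ‖p - p‖ < 2 * s := by rw [sub_self, norm_zero]; positivity
  have hϑq : ϑ (φ p) = p := hinv p hpp
  obtain ⟨R₁, hR₁, hR₁'⟩ := Metric.nhds_basis_ball.mem_iff.1 hφϑ
  have hφb : Bornology.IsBounded (φ '' Metric.closedBall p (2 * s)) :=
    ((isCompact_closedBall p (2 * s)).image hφ.continuous).isBounded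
  obtain ⟨L, hL, hϑL⟩ := exists_lipschitz_of_isBounded hϑ
    (hφb.union (Metric.isBounded_ball (x := φ p) (r := R₁)))
  obtain ⟨r, hr, hrR, hrs⟩ : ∃ r > 0, 2 * r < R₁ ∧ L * (16 * r) < s / 2 := by
    have hL1 : 0 < L + 1 := by linarith
    refine ⟨min (R₁ / 4) (s / 64 / (L + 1)), by positivity, ?_, ?_⟩
    · linarith [min_le_left (R₁ / 4) (s / 64 / (L + 1))]
    · have h1 := min_le_right (R₁ / 4) (s / 64 / (L + 1))
      rw [le_div_iff₀ hL1] at h1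
      have h2 : 0 < min (R₁ / 4) (s / 64 / (L + 1)) := by positivity
      nlinarith
  have hφp : φ p ∈ φ '' Metric.closedBall p (2 * s) ∪ Metric.ball (φ p) R₁ :=
    Or.inr (Metric.mem_ball_self hR₁)
  have hnear : ∀ x, ‖x - p‖ < 2 * s → ‖φ x - φ p‖ ≤ 16 * r → ‖x - p‖ < s / 2 := by
    intro x hx h
    have h1 := hϑL (φ x) (Or.inl (mem_image_of_mem φ (mem_closedBall_iff_norm.2 hx.le))) (φ p) hφp
    rw [hinv x hx, hϑq] at h1
    exact (h1.trans (mul_le_mul_of_nonneg_left h hL)).trans_lt hrs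
  have hφϑ' : ∀ y ∈ Metric.ball (φ p) (2 * r), φ (ϑ y) = y ∧ ‖ϑ y - p‖ < 2 * s := by
    intro y hy
    have hy' : y ∈ Metric.ball (φ p) R₁ := Metric.ball_subset_ball hrR.le hy
    refine ⟨hR₁' hy', ?_⟩
    have h1 := hϑL y (Or.inr hy') (φ p) hφp
    rw [hϑq] at h1
    have h2 := mem_ball_iff_norm.1 hy
    have h3 : L * ‖y - φ p‖ ≤ L * (16 * r) := by gcongr; linarith
    linarith
  obtain ⟨b, hb, hbc, hb1, hb0, -⟩ := exists_bump (φ p) (half_pos hr) (half_lt_self hr)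
  obtain ⟨η, hη, hηc, hη1, hη0, -⟩ := exists_bump p (half_pos hs) (half_lt_self hs)
  have hdη : ∀ x, fderiv ℝ η x ≠ 0 → s / 2 ≤ ‖x - p‖ ∧ ‖x - p‖ ≤ s := by
    intro x hx
    constructor
    · by_contra! h
      refine hx ?_
      have hn : Continuous fun x : Euc n => ‖x - p‖ := by fun_prop
      have e : η =ᶠ[𝓝 x] fun _ => 1 := by
        filter_upwards [hn.continuousAt.eventually_lt_const h] with y hy
        exact hη1 y hy.le
      rw [e.fderiv_eq, fderiv_fun_const]; rfl
    · have h1 : tsupport η ⊆ Metric.closedBall p s :=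
        closure_minimal (fun y hy => mem_closedBall_iff_norm.2 (hη0 y hy).le)
          Metric.isClosed_closedBall
      exact mem_closedBall_iff_norm.1 (h1 (support_fderiv_subset ℝ hx))
  obtain ⟨ρ, hρ, hρs, C₁, hC₁, hsolve⟩ := exists_flat_solver i hα k (q := φ p) (by rwa [hφf]) hr
  have hR0 : ∀ x, η x * (J x * ρ (φ x)) ≠ 0 → x ∈ {x | r ≤ f x} ∩ Metric.closedBall p s := by
    intro x hx
    have h1 := hρs (φ x) (right_ne_zero_of_mul (right_ne_zero_of_mul hx))
    rw [hφf] at h1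
    exact ⟨h1.1, mem_closedBall_iff_norm.2 (hη0 x (left_ne_zero_of_mul hx)).le⟩
  obtain ⟨hRc, hRs⟩ := tsupport_subset_of_bounded ((isCompact_closedBall p s).inter_left
    (isClosed_le continuous_const hf.continuous : IsClosed {x | r ≤ f x})) hR0
  have hRΩ : tsupport (fun x => η x * (J x * ρ (φ x))) ⊆ Ω := by
    intro x hx
    have h1 := hRs hx
    have h2 : r ≤ f x := h1.1
    exact hΩ x (by linarith [mem_closedBall_iff_norm.1 h1.2]) (by linarith)
  have hRsm : ContDiff ℝ ∞ fun x => η x * (J x * ρ (φ x)) := hη.mul (hJs.mul (hρ.comp hφ))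
  obtain ⟨R, hRdef⟩ : ∃ R : Euc n → ℝ, R = fun x => η x * (J x * ρ (φ x)) := ⟨_, rfl⟩
  have hRx : ∀ x, R x = η x * (J x * ρ (φ x)) := fun x => by rw [hRdef]
  rw [← hRdef] at hRc hRΩ hRsm
  have hUo : IsOpen (Metric.ball p (2 * s) ∩ φ ⁻¹' Metric.ball (φ p) (r / 2)) :=
    Metric.isOpen_ball.inter (Metric.isOpen_ball.preimage hφ.continuous)
  have hpU : p ∈ Metric.ball p (2 * s) ∩ φ ⁻¹' Metric.ball (φ p) (r / 2) :=
    ⟨Metric.mem_ball_self (by positivity), mem_preimage.2 (Metric.mem_ball_self (half_pos hr))⟩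
  refine ⟨_, hUo, hpU, R, hRsm, hRc, hRΩ, ?_⟩
  intro χ hχ hχU
  have hχ' : ContDiff ℝ ∞ fun x => χ x / J x := by
    refine contDiff_of_forall_tsupport fun x hx => ?_
    have h1 : x ∈ tsupport χ := by
      refine closure_mono (fun y hy => ?_) hx
      rw [Function.mem_support] at hy ⊢
      exact fun h0 => hy (by rw [h0, zero_div])
    exact hχ.contDiffAt.div hJs.contDiffAt (hJ0 x (mem_ball_iff_norm.1 (hχU h1).1))
  have ha : ContDiff ℝ ∞ fun y => b y * (χ (ϑ y) / J (ϑ y)) := hb.mul (hχ'.comp hϑ)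
  have has : ∀ y, b y * (χ (ϑ y) / J (ϑ y)) ≠ 0 → ‖y - φ p‖ ≤ r := fun y hy =>
    (hb0 y (left_ne_zero_of_mul hy)).le
  obtain ⟨C₂, hC₂, hpull⟩ := exists_holderBound_pullback i hα k hφ hϑ hr (D := D) (by
    rintro y ⟨hy, hyr⟩
    obtain ⟨h1, h2⟩ := hφϑ' y hyr
    rw [hD _ h2, ← hφf, h1]
    exact hy) (fun y hy => (hφϑ' y hy).1) ha has
  have hηΛ : ContDiff ℝ ∞ fun x => η x • Λ x := hη.smul hcof
  obtain ⟨C₃, hC₃, hpush⟩ := HolderBound.exists_transport (k + 1) hα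
    (ContinuousLinearMap.apply ℝ (Euc n) (E := Euc n)).flip hηΛ hφ (p := p) hs
    (fun x hx => (hη0 x (left_ne_zero_of_smul hx)).le) (D := D) (T := upperHalf i) (by
      rintro x ⟨hx, hxs⟩
      change 0 ≤ hgt i (φ x)
      rw [hφf]
      exact (hD x (mem_ball_iff_norm.1 hxs)).1 hx)
  obtain ⟨N, hN⟩ := (isCompact_closedBall p s).exists_bound_of_continuousOn
    hηΛ.continuous.continuousOn
  refine ⟨(C₁ + C₃ * C₁) * C₂, by positivity, fun g M hg hM hgM => ?_⟩
  have hGk : ContDiff ℝ k fun y => b y * (χ (ϑ y) / J (ϑ y)) * g (ϑ y) :=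
    (ha.of_le (by exact_mod_cast le_top)).mul (hg.comp (hϑ.of_le (by exact_mod_cast le_top)))
  have hGc : HasCompactSupport fun y => b y * (χ (ϑ y) / J (ϑ y)) * g (ϑ y) :=
    hbc.mono fun y hy h0 => hy (by simp only [h0, zero_mul])
  obtain ⟨w, m, hwk, hmM, hwd, hwh, hws, hwM, hwsm⟩ := hsolve hGk hGc (by positivity : 0 ≤ C₂ * M)
    (fun y _ hy => has y (left_ne_zero_of_mul hy)) (hpull g M hM hg hgM)
  have hwk' : ContDiff ℝ ((k + 1 : ℕ) : WithTop ℕ∞) w := by exact_mod_cast hwk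
  have hwD : Differentiable ℝ w := hwk'.differentiable (by simp)
  have hvM := hpush w _ (by positivity) hwk' hwM
  have hev : (fun x => (η x • Λ x) (w (φ x))) = fun x => η x • Λ x (w (φ x)) := by
    ext1 x; rfl
  have hC : C₁ * (C₂ * M) ≤ (C₁ + C₃ * C₁) * C₂ * M := by
    have : 0 ≤ C₃ * C₁ * (C₂ * M) := by positivity
    linarith
  have hC' : C₃ * (C₁ * (C₂ * M)) ≤ (C₁ + C₃ * C₁) * C₂ * M := by
    have : 0 ≤ C₁ * (C₂ * M) := by positivity
    linarith
  have hup : ∀ x, ‖x - p‖ < 2 * s → x ∈ D → φ x ∈ upperHalf i := by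
    intro x hx hxD
    change 0 ≤ hgt i (φ x)
    rw [hφf]
    exact (hD x hx).1 hxD
  have hcof' : Differentiable ℝ Λ := hcof.differentiable (by simp)
  have hφ' : Differentiable ℝ φ := hφ.differentiable (by simp)
  refine ⟨fun x => (η x • Λ x) (w (φ x)), m, N * (C₁ * (C₂ * M) * C₀),
    (hηΛ.of_le (by exact_mod_cast le_top)).clm_apply
      (hwk'.comp (hφ.of_le (by exact_mod_cast le_top))), hmM.trans hC, hvM.mono_const hC',
    fun x hx => ?_, fun x hx => ?_, fun hgs => ?_⟩
  · have hxD := hΩD hx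
    have hdΛ : DifferentiableAt ℝ (fun x => Λ x (w (φ x))) x :=
      (hcof' x).clm_apply ((hwD (φ x)).comp x (hφ' x))
    rw [hev, diver_smul (hη.differentiable (by simp) x) hdΛ, hdiv w x hwD]
    have e1 : fderiv ℝ η x (Λ x (w (φ x))) = 0 := by
      by_contra h
      have n1 : fderiv ℝ η x ≠ 0 := fun h0 => h (by rw [h0]; rfl)
      have n2 : w (φ x) ≠ 0 := fun h0 => h (by rw [h0, map_zero, map_zero])
      obtain ⟨h1, h2⟩ := hdη x n1
      have h3 : ‖x - p‖ < 2 * s := by linarith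
      linarith [hnear x h3 (hws _ (hup x h3 hxD) n2)]
    rw [e1, add_zero, hRx]
    rcases lt_or_ge ‖x - p‖ (2 * s) with h | h
    · rw [hwd _ (hup x h hxD), hinv x h]
      have hJx := hJ0 x h
      by_cases hχx : χ x = 0
      · simp only [hχx, zero_div, mul_zero, zero_mul, zero_add]
        ring
      · have hxU := hχU (subset_tsupport χ hχx)
        have h1 : ‖φ x - φ p‖ < r / 2 := mem_ball_iff_norm.1 hxU.2
        rw [hb1 _ h1.le, hη1 x (hnear x h (by linarith)).le]
        change 1 * (J x * _) = _
        field_simp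
    · have hηx : η x = 0 := by
        by_contra h0
        linarith [hη0 x h0]
      have hχx : χ x = 0 := by
        by_contra h0
        linarith [mem_ball_iff_norm.1 (hχU (subset_tsupport χ h0)).1]
      simp only [hηx, hχx, zero_mul, mul_zero, add_zero]
  · by_cases hηx : η x = 0
    · have h1 := (norm_nonneg _).trans (hN p (Metric.mem_closedBall_self hs.le))
      have h2 : (η x • Λ x) (w (φ x)) = 0 := by
        change η x • Λ x (w (φ x)) = 0
        rw [hηx, zero_smul]
      refine (norm_eq_zero.2 h2).trans_le ?_
      positivity
    · have h1 := hη0 x hηx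
      have h2 : ‖x - p‖ < 2 * s := by linarith
      have h3 := hwh _ (hup x h2 hx)
      rw [hφf] at h3
      have h4 := hN x (mem_closedBall_iff_norm.2 h1.le)
      calc _ ≤ ‖η x • Λ x‖ * ‖w (φ x)‖ := (η x • Λ x).le_opNorm _
        _ ≤ N * (C₁ * (C₂ * M) * f x) := mul_le_mul h4 h3 (norm_nonneg _)
            ((norm_nonneg _).trans h4)
        _ ≤ N * (C₁ * (C₂ * M) * (C₀ * |Φ x|)) := by
          have := (norm_nonneg _).trans h4
          gcongr
          exact hΦ x h2 hx
        _ = _ := by ring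
  · exact hηΛ.clm_apply ((hwsm (ha.mul (hgs.comp hϑ))).comp hφ)

end LocalSolver

section GlobalSolver

variable {n : ℕ}

/-- The equation `div v = χ g + m ρ` on `Ω` is solvable, for some constant `m`, with Schauder
estimates on `D` and with `v` vanishing to first order where `Φ` vanishes. -/
def SolvableMod (k : ℕ) (α : ℝ) (Ω D : Set (Euc n)) (Φ ρ χ : Euc n → ℝ) : Prop :=
  ∃ C : ℝ, 0 ≤ C ∧ ∀ (g : Euc n → ℝ) (M : ℝ), ContDiff ℝ k g → 0 ≤ M →
    TopHolderBound k α M D g →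
    ∃ (v : Euc n → Euc n) (m C' : ℝ), ContDiff ℝ (k + 1 : ℕ) v ∧ |m| ≤ C * M ∧
      HolderBound (k + 1) α (C * M) D v ∧ (∀ x ∈ Ω, diver v x = χ x * g x + m * ρ x) ∧
      (∀ x ∈ D, ‖v x‖ ≤ C' * |Φ x|) ∧ (ContDiff ℝ ∞ g → ContDiff ℝ ∞ v)

theorem exists_norm_le_mul_abs {V : Euc n → Euc n} {Φ : Euc n → ℝ} (hV : Continuous V)
    (hΦ : Continuous Φ) (hVc : HasCompactSupport V) (h0 : ∀ x ∈ tsupport V, Φ x ≠ 0) :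
    ∃ K, ∀ x, ‖V x‖ ≤ K * |Φ x| := by
  obtain ⟨K, hK⟩ := IsCompact.exists_bound_of_continuousOn (f := fun x => ‖V x‖ / |Φ x|) hVc
    (hV.norm.continuousOn.div hΦ.abs.continuousOn fun x hx => abs_ne_zero.2 (h0 x hx))
  refine ⟨|K|, fun x => ?_⟩
  by_cases hx : V x = 0
  · rw [hx, norm_zero]
    positivity
  · have h1 := subset_tsupport V hx
    have h2 := (le_abs_self _).trans ((hK x h1).trans (le_abs_self K))
    rwa [div_le_iff₀ (abs_pos.2 (h0 x h1))] at h2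

theorem SolvableMod.of_isDivMod {k : ℕ} {α : ℝ} (hα : α ∈ Ioo (0 : ℝ) 1) {Ω D : Set (Euc n)}
    {Φ ρ R χ : Euc n → ℝ} (hΦ : Continuous Φ) (hΦΩ : ∀ x ∈ Ω, Φ x ≠ 0)
    (h : SolvableMod k α Ω D Φ R χ) (hR : IsDivMod Ω ρ R) : SolvableMod k α Ω D Φ ρ χ := by
  obtain ⟨C, hC, h⟩ := h
  obtain ⟨V, c, hV, hVc, hVΩ, hVd⟩ := hR
  obtain ⟨N, hN, hVN⟩ := HolderBound.of_hasCompactSupport (k + 1) hα hV hVc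
  obtain ⟨K, hK⟩ := exists_norm_le_mul_abs hV.continuous hΦ hVc fun x hx => hΦΩ x (hVΩ hx)
  refine ⟨C + C * |c| + C * N, by positivity, fun g M hg hM hgM => ?_⟩
  obtain ⟨v, m, C', hv, hm, hvM, hvd, hvΦ, hvs⟩ := h g M hg hM hgM
  have hVk : ContDiff ℝ ((k + 1 : ℕ) : WithTop ℕ∞) V := hV.of_le (by exact_mod_cast le_top)
  have hmV : ContDiff ℝ ((k + 1 : ℕ) : WithTop ℕ∞) fun x => (-m) • V x := hVk.const_smul (-m)
  refine ⟨fun x => v x + (-m) • V x, m * c, C' + |m| * K, hv.add hmV, ?_, ?_, fun x hx => ?_,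
    fun x hx => ?_, fun hgs => (hvs hgs).add (hV.const_smul (-m))⟩
  · rw [abs_mul]
    have h1 : |m| * |c| ≤ C * M * |c| := by gcongr
    have h2 : 0 ≤ C * M := by positivity
    have h3 : 0 ≤ C * N * M := by positivity
    linarith
  · have h1 := HolderBound.clm_comp ((-m) • ContinuousLinearMap.id ℝ (Euc n)) hVk
      (hVN.mono_set (subset_univ D))
    refine (HolderBound.add hv hmV hvM h1).mono_const ?_
    have h4 : ‖(-m) • ContinuousLinearMap.id ℝ (Euc n)‖ ≤ |m| := by
      rw [norm_smul, Real.norm_eq_abs, abs_neg]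
      exact mul_le_of_le_one_right (abs_nonneg m) ContinuousLinearMap.norm_id_le
    have h5 : ‖(-m) • ContinuousLinearMap.id ℝ (Euc n)‖ * N ≤ C * M * N :=
      mul_le_mul_of_nonneg_right (h4.trans hm) hN
    have h3 : 0 ≤ C * |c| * M := by positivity
    linarith
  · rw [diver_add (hv.differentiable (by simp) x) (hmV.differentiable (by simp) x),
      diver_const_smul (hV.differentiable (by simp) x), hvd x hx, hVd]
    ring
  · refine (norm_add_le _ _).trans ?_
    rw [norm_smul, Real.norm_eq_abs, abs_neg, add_mul, mul_assoc]
    exact add_le_add (hvΦ x hx) (mul_le_mul_of_nonneg_left (hK x) (abs_nonneg m))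

theorem SolvableMod.sum {k : ℕ} {α : ℝ} {Ω D : Set (Euc n)} {Φ ρ : Euc n → ℝ} {ι : Type}
    {t : Finset ι} {χ : ι → Euc n → ℝ} (h : ∀ i ∈ t, SolvableMod k α Ω D Φ ρ (χ i)) :
    SolvableMod k α Ω D Φ ρ fun x => ∑ i ∈ t, χ i x := by
  classical
  choose! C hC h using h
  refine ⟨∑ i ∈ t, C i, Finset.sum_nonneg hC, fun g M hg hM hgM => ?_⟩
  choose! v m C' hv hm hvM hvd hvΦ hvs using fun i hi => h i hi g M hg hM hgM
  refine ⟨fun x => ∑ i ∈ t, v i x, ∑ i ∈ t, m i, ∑ i ∈ t, C' i, ContDiff.sum hv, ?_, ?_,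
    fun x hx => ?_, fun x hx => ?_, fun hgs => ContDiff.sum fun i hi => hvs i hi hgs⟩
  · rw [Finset.sum_mul]
    exact (Finset.abs_sum_le_sum_abs _ _).trans (Finset.sum_le_sum hm)
  · rw [Finset.sum_mul]
    exact HolderBound.sum t hv hvM
  · rw [diver_sum fun i hi => (hv i hi).differentiable (by simp) x,
      Finset.sum_congr rfl fun i hi => hvd i hi x hx, Finset.sum_add_distrib, Finset.sum_mul,
      Finset.sum_mul]
  · rw [Finset.sum_mul]
    exact (norm_sum_le _ _).trans (Finset.sum_le_sum fun i hi => hvΦ i hi x hx)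

theorem exists_vert_ne_zero {L : Euc n →L[ℝ] ℝ} (hL : L ≠ 0) : ∃ i, L (vert i) ≠ 0 := by
  by_contra! h
  refine hL (ContinuousLinearMap.ext fun x => ?_)
  rw [← sum_hgt_smul_vert x, map_sum]
  simp [h]

theorem exists_solvableMod_nhds {Ω : Set (Euc n)} {Φ ρ : Euc n → ℝ} (k : ℕ) {α : ℝ}
    (hα : α ∈ Ioo (0 : ℝ) 1) (hn : 0 < n) (hΦ : ContDiff ℝ ∞ Φ) (hΩ : Ω = {x | Φ x < 0})
    (hcl : closure Ω = {x | Φ x ≤ 0}) (hreg : ∀ x, Φ x = 0 → fderiv ℝ Φ x ≠ 0)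
    (hρ : ∀ h : Euc n → ℝ, ContDiff ℝ ∞ h → HasCompactSupport h → tsupport h ⊆ Ω → IsDivMod Ω ρ h)
    {p : Euc n} (hp : p ∈ closure Ω) :
    ∃ U : Set (Euc n), IsOpen U ∧ p ∈ U ∧ ∀ χ : Euc n → ℝ, ContDiff ℝ ∞ χ → tsupport χ ⊆ U →
      SolvableMod k α Ω (closure Ω) Φ ρ χ := by
  have hmΩ : ∀ x, x ∈ Ω ↔ Φ x < 0 := fun x => by rw [hΩ]; rfl
  have hmcl : ∀ x, x ∈ closure Ω ↔ Φ x ≤ 0 := fun x => by rw [hcl]; rfl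
  have hΦΩ : ∀ x ∈ Ω, Φ x ≠ 0 := fun x hx => ((hmΩ x).1 hx).ne
  suffices h : ∃ (i : Fin n) (f : Euc n → ℝ) (C₀ : ℝ), 0 ≤ C₀ ∧ ContDiff ℝ ∞ f ∧
      fderiv ℝ f p (vert i) ≠ 0 ∧ 0 ≤ f p ∧ ∀ᶠ x in 𝓝 p, (x ∈ closure Ω ↔ 0 ≤ f x) ∧
        (0 < f x → x ∈ Ω) ∧ (x ∈ closure Ω → f x ≤ C₀ * |Φ x|) by
    obtain ⟨i, f, C₀, hC₀, hf, hJ, hfp, hloc⟩ := h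
    obtain ⟨U, hU, hpU, R, hR, hRc, hRΩ, h⟩ :=
      exists_local_solver i hα k hC₀ subset_closure hf hJ hfp hloc
    exact ⟨U, hU, hpU, fun χ hχ hχU => SolvableMod.of_isDivMod hα hΦ.continuous hΦΩ
      (h χ hχ hχU) (hρ R hR hRc hRΩ)⟩
  rcases ((hmcl p).1 hp).eq_or_lt with h0 | h0
  · obtain ⟨i, hi⟩ := exists_vert_ne_zero (hreg p h0)
    refine ⟨i, fun x => -Φ x, 1, zero_le_one, hΦ.neg, ?_, by simp [h0],
      Eventually.of_forall fun x => ?_⟩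
    · rw [fderiv_fun_neg]
      simpa using hi
    · rw [hmΩ, hmcl, one_mul]
      exact ⟨neg_nonneg.symm, neg_pos.1, fun _ => neg_le_abs (Φ x)⟩
  · have hd : HasFDerivAt (fun x => hgt ⟨0, hn⟩ (x - p) + 1) (hgt ⟨0, hn⟩) p := by
      have h1 : HasFDerivAt (fun x : Euc n => x - p) (ContinuousLinearMap.id ℝ (Euc n)) p :=
        (hasFDerivAt_id p).sub_const p
      exact (((hgt ⟨0, hn⟩).hasFDerivAt.comp p h1).add_const 1).congr_fderiv
        (ContinuousLinearMap.comp_id _)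
    have hs : ContDiff ℝ ∞ fun x : Euc n => hgt ⟨0, hn⟩ (x - p) + 1 :=
      ((hgt ⟨0, hn⟩).contDiff.comp (contDiff_id.sub contDiff_const)).add contDiff_const
    have hp1 : hgt ⟨0, hn⟩ (p - p) + 1 = 1 := by simp
    refine ⟨⟨0, hn⟩, fun x => hgt ⟨0, hn⟩ (x - p) + 1, 4 / |Φ p|, by positivity, hs, ?_, ?_, ?_⟩
    · rw [hd.fderiv, hgt_vert]
      exact one_ne_zero
    · exact zero_le_one.trans_eq hp1.symm
    · have e1 : ∀ᶠ x in 𝓝 p, Φ x < Φ p / 2 :=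
        hΦ.continuous.continuousAt.eventually_lt_const (by linarith)
      have e2 : ∀ᶠ x in 𝓝 p, hgt ⟨0, hn⟩ (x - p) + 1 < 2 :=
        hs.continuous.continuousAt.eventually_lt_const (hp1.trans_lt one_lt_two)
      have e3 : ∀ᶠ x in 𝓝 p, 0 < hgt ⟨0, hn⟩ (x - p) + 1 :=
        hs.continuous.continuousAt.eventually_const_lt (zero_lt_one.trans_eq hp1.symm)
      filter_upwards [e1, e2, e3] with x h1 h2 h3
      rw [hmΩ, hmcl]
      refine ⟨⟨fun _ => h3.le, fun _ => by linarith⟩, fun _ => by linarith, fun _ => ?_⟩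
      rw [abs_of_neg h0, abs_of_neg (by linarith), div_mul_eq_mul_div, le_div_iff₀ (by linarith)]
      nlinarith

theorem exists_global_solver {Ω : Set (Euc n)} {Φ : Euc n → ℝ} (k : ℕ) {α : ℝ}
    (hα : α ∈ Ioo (0 : ℝ) 1) (hn : 0 < n) (ho : IsOpen Ω) (hbd : Bornology.IsBounded Ω)
    (hconn : IsConnected Ω) (hΦ : ContDiff ℝ ∞ Φ) (hΩ : Ω = {x | Φ x < 0})
    (hcl : closure Ω = {x | Φ x ≤ 0}) (hreg : ∀ x, Φ x = 0 → fderiv ℝ Φ x ≠ 0) :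
    ∃ C : ℝ, 0 ≤ C ∧ ∀ (g : Euc n → ℝ) (M : ℝ), ContDiff ℝ k g → 0 ≤ M →
      TopHolderBound k α M (closure Ω) g → ∫ x in Ω, g x = 0 →
      ∃ v : Euc n → Euc n, ContDiff ℝ (k + 1 : ℕ) v ∧
        HolderBound (k + 1) α (C * M) (closure Ω) v ∧ (∀ x ∈ Ω, diver v x = g x) ∧
        (∀ x ∈ closure Ω, Φ x = 0 → v x = 0) ∧ (ContDiff ℝ ∞ g → ContDiff ℝ ∞ v) := by
  have hK : IsCompact (closure Ω) := hbd.isCompact_closure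
  obtain ⟨ρ, hρ, hρc, hρs, hρmod⟩ := exists_isDivMod_of_isConnected ho hconn
  have hintg : ∀ h : Euc n → ℝ, Continuous h → IntegrableOn h Ω := fun h hh =>
    (hh.continuousOn.integrableOn_compact hK).mono_set subset_closure
  have hΦΩ : ∀ x ∈ Ω, Φ x ≠ 0 := fun x hx => by
    rw [hΩ] at hx
    exact ne_of_lt hx
  have hρ0 : ∫ x in Ω, ρ x ≠ 0 := by
    intro h0
    obtain ⟨p, hp⟩ := hconn.nonempty
    obtain ⟨r, hr, hrΩ⟩ := Metric.nhds_basis_closedBall.mem_iff.1 (ho.mem_nhds hp)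
    obtain ⟨b, hb, hbc, hb1, hb0, hbr⟩ := exists_bump p (half_pos hr) (half_lt_self hr)
    have hbΩ : tsupport b ⊆ Ω := (closure_minimal (fun y hy =>
      mem_closedBall_iff_norm.2 (hb0 y hy).le) Metric.isClosed_closedBall).trans hrΩ
    obtain ⟨V, c, hV, hVc, hVs, hVd⟩ := hρmod b hb hbc hbΩ
    obtain ⟨K, hK'⟩ := exists_norm_le_mul_abs hV.continuous hΦ.continuous hVc
      fun x hx => hΦΩ x (hVs hx)
    have h1 := setIntegral_diver_eq_zero hbd hΦ hΩ (hV.of_le (by simp)) fun x _ => hK' x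
    simp only [hVd] at h1
    rw [integral_sub (hintg b hb.continuous) ((hintg ρ hρ.continuous).const_mul c),
      integral_const_mul, h0, mul_zero, sub_zero,
      setIntegral_eq_integral_of_forall_compl_eq_zero fun x hx =>
        image_eq_zero_of_notMem_tsupport fun h => hx (hbΩ h)] at h1
    have h2 : 0 < ∫ x, b x := by
      refine hb.continuous.integral_pos_of_hasCompactSupport_nonneg_nonzero hbc
        (fun x => (hbr x).1) (x := p) ?_
      rw [hb1 p (by rw [sub_self, norm_zero]; positivity)]
      exact one_ne_zero
    exact h2.ne' h1
  choose! U hUo hpU hU using fun p (hp : p ∈ closure Ω) =>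
    exists_solvableMod_nhds k hα hn hΦ hΩ hcl hreg hρmod hp
  obtain ⟨t, χ, hχ, hχU, hχ1⟩ := exists_finite_partition hK fun x hx => ⟨hUo x hx, hpU x hx⟩
  obtain ⟨C, hC, h⟩ := SolvableMod.sum (t := t) (χ := χ)
    fun p hp => hU p p.2 (χ p) (hχ p) (hχU p hp)
  refine ⟨C, hC, fun g M hg hM hgM hg0 => ?_⟩
  obtain ⟨v, m, C', hv, -, hvM, hvd, hvΦ, hvs⟩ := h g M hg hM hgM
  have hvd' : ∀ x ∈ Ω, diver v x = g x + m * ρ x := fun x hx => by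
    have h1 := hχ1 x (subset_closure hx)
    simp only [hvd x hx, h1, one_mul]
  have h1 := setIntegral_diver_eq_zero hbd hΦ hΩ
    (hv.of_le (by exact_mod_cast Nat.le_add_left 1 k)) fun x hx => hvΦ x (subset_closure hx)
  rw [setIntegral_congr_fun ho.measurableSet hvd', integral_add (hintg g hg.continuous)
    ((hintg ρ hρ.continuous).const_mul m), hg0, zero_add, integral_const_mul] at h1
  have hm : m = 0 := (mul_eq_zero.1 h1).resolve_right hρ0
  refine ⟨v, hv, hvM, fun x hx => by rw [hvd' x hx, hm, zero_mul, add_zero], fun x hx h0 => ?_, hvs⟩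
  have h2 := hvΦ x hx
  rw [h0, abs_zero, mul_zero] at h2
  exact norm_le_zero_iff.1 h2

end GlobalSolver

section HolderNorm

variable {n : ℕ} {F : Type} [NormedAddCommGroup F] [NormedSpace ℝ F] {k : ℕ} {α M : ℝ}
  {A : Set (Euc n)} {u : Euc n → F}

theorem holderNorm_nonneg (k : ℕ) (α : ℝ) (u : Euc n → F) (A : Set (Euc n)) :
    0 ≤ holderNorm k α u A := by
  refine add_nonneg (Finset.sum_nonneg fun j _ => Real.sSup_nonneg ?_) (Real.sSup_nonneg ?_)
  · rintro _ ⟨x, -, rfl⟩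
    exact norm_nonneg _
  · rintro _ ⟨p, -, rfl⟩
    positivity

theorem HolderClassOn.topHolderBound (hA : IsCompact A) (h : HolderClassOn k α u A) :
    TopHolderBound k α (holderNorm k α u A) A u := by
  obtain ⟨⟨O, hO, hAO, hu⟩, C, hC, hC'⟩ := h
  have h0 : 0 ≤ sSup ((fun p : Euc n × Euc n =>
      ‖iteratedFDeriv ℝ k u p.1 - iteratedFDeriv ℝ k u p.2‖ / ‖p.1 - p.2‖ ^ α) ''
      {p | p.1 ∈ A ∧ p.2 ∈ A ∧ p.1 ≠ p.2}) := by
    refine Real.sSup_nonneg ?_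
    rintro _ ⟨p, -, rfl⟩
    positivity
  have h1 : ∀ j, 0 ≤ sSup ((fun x => ‖iteratedFDeriv ℝ j u x‖) '' A) := fun j => by
    refine Real.sSup_nonneg ?_
    rintro _ ⟨x, -, rfl⟩
    exact norm_nonneg _
  refine ⟨fun j hj x hx => ?_, fun x hx y hy => ?_⟩
  · have hc : ContinuousOn (fun x => ‖iteratedFDeriv ℝ j u x‖) A := by
      refine ContinuousOn.norm (ContinuousOn.mono ?_ hAO)
      exact (hu.continuousOn_iteratedFDerivWithin (by exact_mod_cast hj) hO.uniqueDiffOn).congr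
        fun y hy => (iteratedFDerivWithin_of_isOpen j hO hy).symm
    have h2 : ‖iteratedFDeriv ℝ j u x‖ ≤ sSup ((fun x => ‖iteratedFDeriv ℝ j u x‖) '' A) :=
      le_csSup (hA.image_of_continuousOn hc).bddAbove (mem_image_of_mem _ hx)
    have h3 := Finset.single_le_sum (fun i _ => h1 i) (Finset.mem_range.2 (Nat.lt_succ_of_le hj))
    exact h2.trans (h3.trans (le_add_of_nonneg_right h0))
  · rcases eq_or_ne x y with rfl | hxy
    · rw [sub_self, norm_zero]
      exact mul_nonneg (holderNorm_nonneg k α u A) (by positivity)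
    have hpos : ∀ a b : Euc n, a ≠ b → 0 < ‖a - b‖ ^ α := fun a b hab =>
      Real.rpow_pos_of_pos (norm_pos_iff.2 (sub_ne_zero.2 hab)) α
    rw [← div_le_iff₀ (hpos x y hxy)]
    have hb : BddAbove ((fun p : Euc n × Euc n =>
        ‖iteratedFDeriv ℝ k u p.1 - iteratedFDeriv ℝ k u p.2‖ / ‖p.1 - p.2‖ ^ α) ''
        {p | p.1 ∈ A ∧ p.2 ∈ A ∧ p.1 ≠ p.2}) := by
      refine ⟨C, ?_⟩
      rintro _ ⟨p, ⟨h1, h2, h3⟩, rfl⟩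
      exact (div_le_iff₀ (hpos _ _ h3)).2 (hC' _ h1 _ h2)
    have h2 := le_csSup hb ⟨(x, y), ⟨hx, hy, hxy⟩, rfl⟩
    exact h2.trans (le_add_of_nonneg_left (Finset.sum_nonneg fun j _ => h1 j))

theorem HolderBound.holderNorm_le (hM : 0 ≤ M) (h : HolderBound k α M A u) :
    holderNorm k α u A ≤ (k + 2) * M := by
  have h1 : ∑ j ∈ Finset.range (k + 1), sSup ((fun x => ‖iteratedFDeriv ℝ j u x‖) '' A) ≤
      ∑ j ∈ Finset.range (k + 1), M := by
    refine Finset.sum_le_sum fun j hj => Real.sSup_le ?_ hM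
    rintro _ ⟨x, hx, rfl⟩
    exact h.1 j (Nat.lt_succ_iff.1 (Finset.mem_range.1 hj)) x hx
  have h2 : sSup ((fun p : Euc n × Euc n =>
      ‖iteratedFDeriv ℝ k u p.1 - iteratedFDeriv ℝ k u p.2‖ / ‖p.1 - p.2‖ ^ α) ''
      {p | p.1 ∈ A ∧ p.2 ∈ A ∧ p.1 ≠ p.2}) ≤ M := by
    refine Real.sSup_le ?_ hM
    rintro _ ⟨p, ⟨h1, h2, h3⟩, rfl⟩
    exact div_le_of_le_mul₀ (by positivity) hM (h.2 k le_rfl _ h1 _ h2)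
  rw [Finset.sum_const, Finset.card_range, nsmul_eq_mul] at h1
  push_cast at h1
  calc holderNorm k α u A ≤ (k + 1) * M + M := add_le_add h1 h2
    _ = (k + 2) * M := by ring

theorem HolderBound.holderClassOn (hM : 0 ≤ M) (hu : ContDiff ℝ k u) (h : HolderBound k α M A u) :
    HolderClassOn k α u A :=
  ⟨⟨univ, isOpen_univ, subset_univ A, hu.contDiffOn⟩, M, hM, h.2 k le_rfl⟩

theorem TopHolderBound.congr {v : Euc n → F} (h : TopHolderBound k α M A u)
    (hv : ∀ x ∈ A, v =ᶠ[𝓝 x] u) : TopHolderBound k α M A v := by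
  have e : ∀ j, ∀ x ∈ A, iteratedFDeriv ℝ j v x = iteratedFDeriv ℝ j u x := fun j x hx =>
    ((hv x hx).iteratedFDeriv ℝ j).self_of_nhds
  refine ⟨fun j hj x hx => ?_, fun x hx y hy => ?_⟩
  · rw [e j x hx]
    exact h.1 j hj x hx
  · rw [e k x hx, e k y hy]
    exact h.2 x hx y hy

theorem exists_extension_of_contDiffOn {K O : Set (Euc n)} (hK : IsCompact K) (hO : IsOpen O)
    (hKO : K ⊆ O) (g : Euc n → ℝ) : ∃ G : Euc n → ℝ, (∀ x ∈ K, G =ᶠ[𝓝 x] g) ∧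
      ∀ m : WithTop ℕ∞, m ≤ ∞ → ContDiffOn ℝ m g O → ContDiff ℝ m G := by
  obtain ⟨L, hL, hKL, hLO⟩ := exists_compact_between hK hO hKO
  obtain ⟨t, χ, hχ, hχO, hχ1⟩ := exists_finite_partition (U := fun _ => O) hL
    fun x hx => ⟨hO, hLO hx⟩
  have hs : ContDiff ℝ ∞ fun x => ∑ i ∈ t, χ i x := ContDiff.sum fun i _ => hχ i
  refine ⟨fun x => ∑ i ∈ t, χ i x * g x, fun x hx => ?_, fun m hm hg => ContDiff.sum fun i hi => ?_⟩
  · filter_upwards [isOpen_interior.mem_nhds (hKL hx)] with y hy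
    rw [← Finset.sum_mul, hχ1 y (interior_subset hy), one_mul]
  · refine contDiff_of_forall_tsupport fun x hx => ?_
    have h1 : x ∈ tsupport (χ i) := by
      refine closure_mono (fun y hy => ?_) hx
      rw [Function.mem_support] at hy ⊢
      exact left_ne_zero_of_mul hy
    exact ((hχ i).contDiffAt.of_le hm).mul (hg.contDiffAt (hO.mem_nhds (hχO i hi h1)))

end HolderNorm

/-- Dacorogna–Moser: solvability of the divergence equation with Dirichlet boundary
condition and C^{k+1,α} estimates. -/
theorem dacorogna_moser_divergence (n : ℕ) (Ω : Set (EuclideanSpace ℝ (Fin n)))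
    (hΩ : SmoothBoundedDomain Ω) (k : ℕ) (α : ℝ) (hα : α ∈ Set.Ioo (0:ℝ) 1) :
    ∃ C > (0:ℝ), ∀ g : EuclideanSpace ℝ (Fin n) → ℝ,
      HolderClassOn k α g (closure Ω) →
      (∫ x in Ω, g x) = 0 →
      ∃ v : EuclideanSpace ℝ (Fin n) → EuclideanSpace ℝ (Fin n),
        HolderClassOn (k + 1) α v (closure Ω) ∧
        (∀ x ∈ Ω, diver v x = g x) ∧
        (∀ x ∈ frontier Ω, v x = 0) ∧
        holderNorm (k + 1) α v (closure Ω) ≤ C * holderNorm k α g (closure Ω) ∧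
        ((∃ O, IsOpen O ∧ closure Ω ⊆ O ∧ ContDiffOn ℝ (⊤ : ℕ∞) g O) →
          ∃ O, IsOpen O ∧ closure Ω ⊆ O ∧ ContDiffOn ℝ (⊤ : ℕ∞) v O) := by
  obtain ⟨ho, hbd, hconn, Φ, hΦ, hΩΦ, hfr, hreg⟩ := hΩ
  rcases Nat.eq_zero_or_pos n with rfl | hn
  · refine ⟨1, one_pos, fun g _ hg0 => ⟨fun _ => 0, ?_, fun x hx => ?_, fun _ _ => rfl, ?_,
      fun _ => ⟨univ, isOpen_univ, subset_univ _, contDiffOn_const⟩⟩⟩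
    · exact HolderBound.holderClassOn le_rfl contDiff_const (HolderBound.zero le_rfl)
    · have hΩu : Ω = univ := Subsingleton.eq_univ_of_nonempty ⟨x, hx⟩
      rw [hΩu, Measure.restrict_univ, volume_euclideanSpace_eq_dirac,
        integral_dirac] at hg0
      rw [Subsingleton.elim x 0, hg0, diver, fderiv_fun_const]
      exact map_zero _
    · refine (HolderBound.holderNorm_le le_rfl (HolderBound.zero le_rfl)).trans ?_
      rw [mul_zero, one_mul]
      exact holderNorm_nonneg k α g _
  have hcl : closure Ω = {x | Φ x ≤ 0} := by
    rw [closure_eq_self_union_frontier, hfr]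
    ext x
    rw [hΩΦ]
    exact (le_iff_lt_or_eq (a := Φ x) (b := 0)).symm
  have hfr' : ∀ x, x ∈ frontier Ω ↔ Φ x = 0 := fun x => by rw [hfr]; rfl
  have hK : IsCompact (closure Ω) := hbd.isCompact_closure
  obtain ⟨C, hC, h⟩ := exists_global_solver k hα hn ho hbd hconn hΦ hΩΦ hcl
    fun x hx => hreg x ((hfr' x).2 hx)
  refine ⟨((k + 1 : ℕ) + 2) * C + 1, by positivity, fun g hg hg0 => ?_⟩
  obtain ⟨O, hO, hΩO, hgO, hgO'⟩ : ∃ O, IsOpen O ∧ closure Ω ⊆ O ∧ ContDiffOn ℝ k g O ∧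
      ((∃ O, IsOpen O ∧ closure Ω ⊆ O ∧ ContDiffOn ℝ (⊤ : ℕ∞) g O) →
        ContDiffOn ℝ (⊤ : ℕ∞) g O) := by
    by_cases hs : ∃ O, IsOpen O ∧ closure Ω ⊆ O ∧ ContDiffOn ℝ (⊤ : ℕ∞) g O
    · obtain ⟨O, hO, hΩO, hgO⟩ := hs
      exact ⟨O, hO, hΩO, hgO.of_le (by exact_mod_cast le_top), fun _ => hgO⟩
    · obtain ⟨O, hO, hΩO, hgO⟩ := hg.1
      exact ⟨O, hO, hΩO, hgO, fun h => absurd h hs⟩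
  obtain ⟨G, hGg, hG⟩ := exists_extension_of_contDiffOn hK hO hΩO g
  have hGΩ : ∀ x ∈ Ω, G x = g x := fun x hx => (hGg x (subset_closure hx)).self_of_nhds
  have hM := holderNorm_nonneg k α g (closure Ω)
  obtain ⟨v, hv, hvM, hvd, hv0, hvs⟩ := h G (holderNorm k α g (closure Ω))
    (hG k (by exact_mod_cast le_top) hgO) hM ((hg.topHolderBound hK).congr hGg)
    ((setIntegral_congr_fun ho.measurableSet hGΩ).trans hg0)
  refine ⟨v, hvM.holderClassOn (by positivity) hv, fun x hx => (hvd x hx).trans (hGΩ x hx),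
    fun x hx => hv0 x (frontier_subset_closure hx) ((hfr' x).1 hx), ?_, fun hs =>
      ⟨univ, isOpen_univ, subset_univ _, (hvs (hG _ le_rfl (hgO' hs))).contDiffOn⟩⟩
  refine (hvM.holderNorm_le (by positivity)).trans ?_
  linarith
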